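/- Let ω be a concave weight function, let U ⊆ ℝ^d be open, and let j be a positive integer. If f : U → ℂ is a function such that f^j and f^{j+1} belong to the Beurling Braun–Meise–Taylor class E^{(ω)}(U), then f belongs to E^{(ω)}(U). -/

import Mathlib

open Set Filter Topology Metric
open scoped ENNReal NNReal Topology

noncomputable section

namespace JorisPaper

/-- The sequence `m` with `m_k = M_k / k!`. -/
def lc (M : ℕ → ℝ) (k : ℕ) : ℝ := M k / (Nat.factorial k : ℝ)

/-- A weight sequence: positive, log-convex, `M_0 = 1 ≤ M_1`, `M_k^{1/k} → ∞`. -/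
structure IsWeightSeq (M : ℕ → ℝ) : Prop where
  pos : ∀ k, 0 < M k
  first : M 0 = 1
  one_le : 1 ≤ M 1
  logconvex : ∀ k, 1 ≤ k → M k ^ 2 ≤ M (k - 1) * M (k + 1)
  root : Filter.Tendsto (fun k : ℕ => M k ^ ((1 : ℝ) / (k : ℝ))) atTop atTop

/-- `m_k^{1/k} → ∞`. -/
def RootsTendsto (m : ℕ → ℝ) : Prop :=
  Filter.Tendsto (fun k : ℕ => m k ^ ((1 : ℝ) / (k : ℝ))) atTop atTop

/-- `h_m(t) = inf_k m_k t^k` for `t > 0`, and `0` for `t ≤ 0`. -/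
def hfn (m : ℕ → ℝ) (t : ℝ) : ℝ := if t ≤ 0 then 0 else ⨅ k : ℕ, m k * t ^ k

/-- `Γ̄_m(t) = min {k | h_m(t) = m_k t^k}`. -/
def GammaUpper (m : ℕ → ℝ) (t : ℝ) : ℕ := sInf {k : ℕ | hfn m t = m k * t ^ k}

/-- `Γ̲_m(t) = min {k | m_{k+1}/m_k ≥ 1/t}`. -/
def GammaLower (m : ℕ → ℝ) (t : ℝ) : ℕ := sInf {k : ℕ | 1 / t ≤ m (k + 1) / m k}

/-- `mg(M,N) = sup_{j+k ≥ 1} (M_{j+k}/(N_j N_k))^{1/(j+k)}`, as an extended real. -/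
def mg (M N : ℕ → ℝ) : ℝ≥0∞ :=
  ⨆ (j : ℕ) (k : ℕ) (_ : 1 ≤ j + k),
    ENNReal.ofReal ((M (j + k) / (N j * N k)) ^ (((j : ℝ) + (k : ℝ))⁻¹))

/-- A weight matrix: a totally ordered (pointwise) family of weight sequences. -/
structure IsWeightMatrix (W : Set (ℕ → ℝ)) : Prop where
  weight : ∀ M ∈ W, IsWeightSeq M
  ordered : ∀ M ∈ W, ∀ N ∈ W, (∀ k, M k ≤ N k) ∨ (∀ k, N k ≤ M k)

/-- R-admissible weight matrix. -/
structure RAdmissible (W : Set (ℕ → ℝ)) : Prop where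
  matrix : IsWeightMatrix W
  roots : ∀ M ∈ W, RootsTendsto (lc M)
  gamma : ∀ M ∈ W, ∃ N ∈ W, ∃ C : ℝ, 1 ≤ C ∧
    ∀ t : ℝ, 0 < t → GammaUpper (lc N) (C * t) ≤ GammaLower (lc M) t
  mgrowth : ∀ M ∈ W, ∃ N ∈ W, mg M N < ⊤

/-- B-admissible weight matrix. -/
structure BAdmissible (W : Set (ℕ → ℝ)) : Prop where
  matrix : IsWeightMatrix W
  roots : ∀ M ∈ W, RootsTendsto (lc M)
  gamma : ∀ M ∈ W, ∃ N ∈ W, ∃ C : ℝ, 1 ≤ C ∧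
    ∀ t : ℝ, 0 < t → GammaUpper (lc M) (C * t) ≤ GammaLower (lc N) t
  mgrowth : ∀ M ∈ W, ∃ N ∈ W, mg N M < ⊤

/-- `‖f‖^M_{K,ρ} < ∞` (derivatives taken within `U`). -/
def SeqBoundedOn {E F : Type*} [NormedAddCommGroup E] [NormedSpace ℝ E]
    [NormedAddCommGroup F] [NormedSpace ℝ F]
    (M : ℕ → ℝ) (ρ : ℝ) (f : E → F) (U K : Set E) : Prop :=
  ∃ C : ℝ, ∀ x ∈ K, ∀ k : ℕ, ‖iteratedFDerivWithin ℝ k f U x‖ ≤ C * ρ ^ k * M k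

/-- `f ∈ B^M_ρ(V)`: smooth on `V` with global bounds `‖f‖^M_{V,ρ} < ∞`. -/
def GlobalClass {E F : Type*} [NormedAddCommGroup E] [NormedSpace ℝ E]
    [NormedAddCommGroup F] [NormedSpace ℝ F]
    (M : ℕ → ℝ) (ρ : ℝ) (f : E → F) (V : Set E) : Prop :=
  ContDiffOn ℝ (⊤ : ℕ∞) f V ∧ SeqBoundedOn M ρ f V V

/-- The Roumieu class `E^{{W}}(U)`. -/
def Roumieu {E F : Type*} [NormedAddCommGroup E] [NormedSpace ℝ E]
    [NormedAddCommGroup F] [NormedSpace ℝ F]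
    (W : Set (ℕ → ℝ)) (U : Set E) (f : E → F) : Prop :=
  ContDiffOn ℝ (⊤ : ℕ∞) f U ∧
    ∀ K ⊆ U, IsCompact K → ∃ M ∈ W, ∃ ρ : ℝ, 0 < ρ ∧ SeqBoundedOn M ρ f U K

/-- The Beurling class `E^{(W)}(U)`. -/
def Beurling {E F : Type*} [NormedAddCommGroup E] [NormedSpace ℝ E]
    [NormedAddCommGroup F] [NormedSpace ℝ F]
    (W : Set (ℕ → ℝ)) (U : Set E) (f : E → F) : Prop :=
  ContDiffOn ℝ (⊤ : ℕ∞) f U ∧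
    ∀ K ⊆ U, IsCompact K → ∀ M ∈ W, ∀ ρ : ℝ, 0 < ρ → SeqBoundedOn M ρ f U K

/-- The open ellipse `Ω_ε` with vertices `±cosh ε` and co-vertices `±i sinh ε`. -/
def Omega (ε : ℝ) : Set ℂ :=
  {z : ℂ | (z.re / Real.cosh ε) ^ 2 + (z.im / Real.sinh ε) ^ 2 < 1}

/-- `V_U = ⋃_{x ∈ U} (x + 𝔹)`. -/
def VU {E : Type*} [NormedAddCommGroup E] [NormedSpace ℝ E] (U : Set E) : Set E :=
  ⋃ x ∈ U, Metric.closedBall x 1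

/-- A weight function in the sense of Braun–Meise–Taylor. -/
structure IsWeightFunction (ω : ℝ → ℝ) : Prop where
  cont : ContinuousOn ω (Ici 0)
  mono : MonotoneOn ω (Ici 0)
  nonneg : ∀ t, 0 ≤ t → 0 ≤ ω t
  bigO : (fun t => ω (2 * t)) =O[atTop] ω
  littleO : ω =o[atTop] (fun t => t)
  logLittleO : Real.log =o[atTop] ω
  convex : ConvexOn ℝ (Ici 0) (fun t => ω (Real.exp t))

/-- The Young conjugate `φ*_ω(s) = sup_{t ≥ 0} (s t - ω(e^t))`. -/
def youngConj (ω : ℝ → ℝ) (s : ℝ) : ℝ :=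
  sSup {y : ℝ | ∃ t : ℝ, 0 ≤ t ∧ y = s * t - ω (Real.exp t)}

/-- The Roumieu class `E^{{ω}}(U)` for a weight function `ω`. -/
def RoumieuW {E F : Type*} [NormedAddCommGroup E] [NormedSpace ℝ E]
    [NormedAddCommGroup F] [NormedSpace ℝ F]
    (ω : ℝ → ℝ) (U : Set E) (f : E → F) : Prop :=
  ContDiffOn ℝ (⊤ : ℕ∞) f U ∧
    ∀ K ⊆ U, IsCompact K → ∃ C : ℝ, 0 < C ∧ ∃ ρ : ℝ, 0 < ρ ∧
      ∀ x ∈ K, ∀ k : ℕ, ‖iteratedFDerivWithin ℝ k f U x‖ ≤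
        C * Real.exp ((1 / ρ) * youngConj ω (ρ * k))

/-- The Beurling class `E^{(ω)}(U)` for a weight function `ω`. -/
def BeurlingW {E F : Type*} [NormedAddCommGroup E] [NormedSpace ℝ E]
    [NormedAddCommGroup F] [NormedSpace ℝ F]
    (ω : ℝ → ℝ) (U : Set E) (f : E → F) : Prop :=
  ContDiffOn ℝ (⊤ : ℕ∞) f U ∧
    ∀ K ⊆ U, IsCompact K → ∀ ρ : ℝ, 0 < ρ → ∃ C : ℝ, 0 < C ∧
      ∀ x ∈ K, ∀ k : ℕ, ‖iteratedFDerivWithin ℝ k f U x‖ ≤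
        C * Real.exp ((1 / ρ) * youngConj ω (ρ * k))

lemma bddAbove_youngConj_set {ω : ℝ → ℝ} (hω : IsWeightFunction ω) (s : ℝ) (hs : 0 ≤ s) :
    BddAbove {y : ℝ | ∃ t : ℝ, 0 ≤ t ∧ y = s * t - ω (Real.exp t)} := by
  have h := hω.logLittleO.def (c := 1 / (s + 1)) (by positivity)
  obtain ⟨T, hT⟩ := eventually_atTop.1 h
  refine ⟨s * max T 0, ?_⟩
  rintro _ ⟨t, ht, rfl⟩
  have hnn := hω.nonneg (Real.exp t) (Real.exp_pos t).le
  by_cases htT : T ≤ Real.exp t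
  · have := hT _ htT
    rw [Real.log_exp, Real.norm_of_nonneg ht, Real.norm_of_nonneg hnn, div_mul_eq_mul_div,
      le_div_iff₀ (by positivity), one_mul] at this
    have : 0 ≤ s * max T 0 := by positivity
    nlinarith
  · have h1 : t ≤ max T 0 := by
      have := Real.add_one_le_exp t
      exact le_max_of_le_left (by linarith)
    have := mul_le_mul_of_nonneg_left h1 hs
    linarith

lemma pow_mul_exp_le_exp_youngConj {ω : ℝ → ℝ} (hω : IsWeightFunction ω) {ρ : ℝ} (hρ : 0 < ρ)
    (k : ℕ) {y : ℝ} (hy : 1 ≤ y) :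
    y ^ k * Real.exp (-(1 / ρ * ω y)) ≤ Real.exp (1 / ρ * youngConj ω (ρ * k)) := by
  have hy0 : 0 < y := by linarith
  have h : ρ * k * Real.log y - ω y ≤ youngConj ω (ρ * k) := by
    refine le_csSup (bddAbove_youngConj_set hω _ (by positivity)) ⟨Real.log y, Real.log_nonneg hy, ?_⟩
    rw [Real.exp_log hy0]
  have h2 : y ^ k = Real.exp (k * Real.log y) := by
    rw [mul_comm, Real.exp_mul, Real.exp_log hy0, Real.rpow_natCast]
  rw [h2, ← Real.exp_add, Real.exp_le_exp]
  calc k * Real.log y + -(1 / ρ * ω y) = 1 / ρ * (ρ * k * Real.log y - ω y) := by field_simp; ring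
    _ ≤ _ := by gcongr

lemma exp_youngConj_le {ω : ℝ → ℝ} {ρ : ℝ} (hρ : 0 < ρ) (k : ℕ) {B : ℝ}
    (hB : ∀ y, 1 ≤ y → y ^ k * Real.exp (-(1 / ρ * ω y)) ≤ B) :
    Real.exp (1 / ρ * youngConj ω (ρ * k)) ≤ B := by
  have hB0 : 0 < B := lt_of_lt_of_le (by positivity) (hB 1 le_rfl)
  rw [← Real.le_log_iff_exp_le hB0, div_mul_eq_mul_div, one_mul, div_le_iff₀ hρ]
  refine csSup_le ⟨_, 0, le_rfl, rfl⟩ ?_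
  rintro _ ⟨t, ht, rfl⟩
  have h := hB (Real.exp t) (Real.one_le_exp ht)
  rw [← Real.exp_nat_mul, ← Real.exp_add, ← Real.le_log_iff_exp_le hB0] at h
  have := mul_le_mul_of_nonneg_right h hρ.le
  have e : (k * t + -(1 / ρ * ω (Real.exp t))) * ρ = ρ * k * t - ω (Real.exp t) := by
    field_simp; ring
  linarith

lemma exists_subgradient {g : ℝ → ℝ} {S : Set ℝ} (hg : ConvexOn ℝ S g) {x : ℝ}
    (hx : x ∈ interior S) : ∃ σ : ℝ, ∀ z ∈ S, g x + σ * (z - x) ≤ g z := by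
  refine ⟨derivWithin g (Ioi x) x, fun z hz => ?_⟩
  rcases lt_trichotomy z x with h | h | h
  · have h1 := (hg.slope_le_leftDeriv_of_mem_interior hz hx h).trans
      (hg.leftDeriv_le_rightDeriv_of_mem_interior hx)
    rw [slope_def_field, div_le_iff₀ (by linarith)] at h1
    linarith
  · simp [h]
  · have h1 := hg.rightDeriv_le_slope_of_mem_interior hx hz h
    rw [slope_def_field, le_div_iff₀ (by linarith)] at h1
    linarith

/-- `r` is the slope at `y` of a concave weight function, expressed through the supporting line of
`ω` and the supporting line of `t ↦ ω (exp t)`. -/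
structure IsSlopeAt (ω : ℝ → ℝ) (y r : ℝ) : Prop where
  le_line : ∀ z, 0 ≤ z → ω z ≤ ω y + r * (z - y)
  log_le : ∀ z, 1 ≤ z → ω y + y * r * (Real.log z - Real.log y) ≤ ω z

lemma exists_isSlopeAt {ω : ℝ → ℝ} (hω : IsWeightFunction ω) (hconc : ConcaveOn ℝ (Ici 0) ω)
    {y : ℝ} (hy : 1 < y) : ∃ r, IsSlopeAt ω y r := by
  have hy0 : 0 < y := by linarith
  obtain ⟨r', hr⟩ := exists_subgradient hconc.neg (x := y) (by simpa using hy0)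
  obtain ⟨σ, hσ⟩ := exists_subgradient hω.convex (x := Real.log y)
    (by simpa using Real.log_pos hy)
  have hr1 : ∀ z, 0 ≤ z → ω z ≤ ω y + (-r') * (z - y) := fun z hz => by
    have := hr z hz
    simp only [Pi.neg_apply] at this
    linarith
  have hσ1 : ∀ z, 1 ≤ z → ω y + σ * (Real.log z - Real.log y) ≤ ω z := fun z hz => by
    have := hσ (Real.log z) (Real.log_nonneg hz)
    rwa [Real.exp_log hy0, Real.exp_log (by linarith)] at this
  have hmin : IsLocalMin (fun z => (-r') * (z - y) - σ * (Real.log z - Real.log y)) y := by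
    filter_upwards [lt_mem_nhds hy] with z hz
    have h1 := hr1 z (by linarith)
    have h2 := hσ1 z hz.le
    simp only [sub_self, mul_zero]
    linarith
  have hd : HasDerivAt (fun z => (-r') * (z - y) - σ * (Real.log z - Real.log y))
      ((-r') * 1 - σ * y⁻¹) y :=
    (((hasDerivAt_id y).sub_const y).const_mul _).sub
      (((Real.hasDerivAt_log hy0.ne').sub_const _).const_mul _)
  have h0 := hmin.hasDerivAt_eq_zero hd
  have hσr : σ = y * (-r') := by field_simp at h0; linarith
  exact ⟨-r', hr1, by rw [← hσr]; exact hσ1⟩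

lemma IsSlopeAt.nonneg {ω : ℝ → ℝ} (hω : IsWeightFunction ω) {y r : ℝ} (hy : 1 < y)
    (h : IsSlopeAt ω y r) : 0 ≤ r := by
  have h1 := h.le_line (y + 1) (by linarith)
  have h2 : ω y ≤ ω (y + 1) := hω.mono (by simp; linarith) (by simp; linarith) (by linarith)
  linarith

lemma IsSlopeAt.mul_le {ω : ℝ → ℝ} (hω : IsWeightFunction ω) {y r : ℝ}
    (h : IsSlopeAt ω y r) : r * y ≤ ω y := by
  have h1 := h.le_line 0 le_rfl
  have h2 := hω.nonneg 0 le_rfl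
  linarith

/-- Terms of the Taylor series at the radius adapted to `y` are bounded. -/
lemma exp_youngConj_mul_pow_le {ω : ℝ → ℝ} (hω : IsWeightFunction ω)
    (hconc : ConcaveOn ℝ (Ici 0) ω) {y r ρ : ℝ}
    (hy : 1 < y) (h : IsSlopeAt ω y r) (hρ : 0 < ρ) {i : ℕ} (hi : (i : ℝ) ≤ 1 / ρ * (y * r)) :
    Real.exp (1 / ρ * youngConj ω (ρ * i)) * (1 / ρ * r) ^ i ≤ (Nat.factorial i : ℝ) := by
  have hy0 : 0 < y := by linarith
  have hr := h.nonneg hω hy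
  have hbase : ∀ u : ℝ, 0 ≤ u → u ^ i * Real.exp (-u) ≤ (Nat.factorial i : ℝ) := fun u hu => by
    rw [Real.exp_neg, ← div_eq_mul_inv, div_le_iff₀ (Real.exp_pos _), ← div_le_iff₀' (by positivity)]
    exact Real.pow_div_factorial_le_exp u hu i
  rcases hr.eq_or_lt with hr0 | hr0
  · have : i = 0 := by
      rw [← hr0] at hi; simp at hi; exact_mod_cast hi
    subst this
    simp only [pow_zero, mul_one, Nat.factorial_zero, Nat.cast_one]
    exact exp_youngConj_le hρ 0 fun z hz => by
      have := hω.nonneg z (by linarith)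
      simp only [pow_zero, one_mul]
      exact Real.exp_le_one_iff.2 (by have : 0 ≤ 1 / ρ * ω z := by positivity
                                      linarith)
  rw [← le_div_iff₀ (by positivity)]
  have hsmall : ∀ z, 1 ≤ z → z ≤ y →
      z ^ i * Real.exp (-(1 / ρ * ω z)) ≤ (Nat.factorial i : ℝ) / (1 / ρ * r) ^ i := by
    intro z hz hzy
    have hz0 : 0 < z := by linarith
    have h1 : r * z ≤ ω z := by
      have h2 := hconc.2 (mem_Ici.2 hy0.le) (mem_Ici.2 le_rfl) (div_nonneg hz0.le hy0.le)
        (sub_nonneg.2 ((div_le_one hy0).2 hzy)) (add_sub_cancel _ _)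
      simp only [smul_eq_mul, mul_zero, add_zero, div_mul_cancel₀ z hy0.ne'] at h2
      have h3 : 0 ≤ (1 - z / y) * ω 0 :=
        mul_nonneg (by rw [sub_nonneg, div_le_one hy0]; exact hzy) (hω.nonneg 0 le_rfl)
      have h4 : z / y * (r * y) ≤ z / y * ω y := by gcongr; exact h.mul_le hω
      have h5 : z / y * (r * y) = r * z := by field_simp
      linarith
    rw [le_div_iff₀ (by positivity)]
    calc z ^ i * Real.exp (-(1 / ρ * ω z)) * (1 / ρ * r) ^ i
        = (1 / ρ * r * z) ^ i * Real.exp (-(1 / ρ * ω z)) := by rw [mul_pow _ z]; ring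
      _ ≤ (1 / ρ * r * z) ^ i * Real.exp (-(1 / ρ * r * z)) := by
          have : 1 / ρ * r * z ≤ 1 / ρ * ω z := by rw [mul_assoc]; gcongr
          gcongr
      _ ≤ _ := hbase _ (by positivity)
  refine exp_youngConj_le hρ i fun z hz => ?_
  rcases le_total z y with hzy | hzy
  · exact hsmall z hz hzy
  refine le_trans ?_ (hsmall y hy.le le_rfl)
  have hz0 : 0 < z := by linarith
  have e : ∀ x : ℝ, 0 < x → x ^ i = Real.exp (i * Real.log x) := fun x hx => by
    rw [mul_comm, Real.exp_mul, Real.exp_log hx, Real.rpow_natCast]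
  rw [e z hz0, e y hy0, ← Real.exp_add, ← Real.exp_add, Real.exp_le_exp]
  have h1 := h.log_le z hz
  have h2 : 0 ≤ Real.log z - Real.log y := by
    have := Real.log_le_log hy0 hzy; linarith
  have h3 : 1 / ρ * (ω y + y * r * (Real.log z - Real.log y)) ≤ 1 / ρ * ω z := by gcongr
  have h4 := mul_le_mul_of_nonneg_right hi h2
  linarith

/-- The Taylor remainder of optimal order at the radius adapted to `y`. -/
lemma exp_youngConj_mul_pow_floor_le {ω : ℝ → ℝ} (hω : IsWeightFunction ω) {y r ρ : ℝ}
    (hy : 1 < y) (h : IsSlopeAt ω y r) (hρ : 0 < ρ) {k : ℕ} (hk : k = ⌊1 / ρ * (y * r)⌋₊) :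
    Real.exp (1 / ρ * youngConj ω (ρ * k)) * (1 / ρ * r / 4) ^ k ≤
      4 * (y * Real.exp (-(1 / ρ * ω y))) * (Nat.factorial k : ℝ) := by
  have hy0 : 0 < y := by linarith
  have hr := h.nonneg hω hy
  set κ := 1 / ρ * (y * r) with hκ
  have hκ0 : 0 ≤ κ := by positivity
  have hk1 : (k : ℝ) ≤ κ := hk ▸ Nat.floor_le hκ0
  have hk2 : κ < k + 1 := hk ▸ Nat.lt_floor_add_one κ
  have e : ∀ x : ℝ, 0 < x → x ^ k = Real.exp (k * Real.log x) := fun x hx => by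
    rw [mul_comm, Real.exp_mul, Real.exp_log hx, Real.rpow_natCast]
  have hM : Real.exp (1 / ρ * youngConj ω (ρ * k)) ≤ y ^ k * (y * Real.exp (-(1 / ρ * ω y))) := by
    refine exp_youngConj_le hρ k fun z hz => ?_
    have hz0 : 0 < z := by linarith
    have hly : y * Real.exp (-(1 / ρ * ω y)) = Real.exp (Real.log y + -(1 / ρ * ω y)) := by
      rw [Real.exp_add, Real.exp_log hy0]
    rw [e z hz0, e y hy0, hly, ← Real.exp_add, ← Real.exp_add, Real.exp_le_exp]
    have h1 := h.log_le z hz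
    have h3 : 1 / ρ * (ω y + y * r * (Real.log z - Real.log y)) ≤ 1 / ρ * ω z := by gcongr
    have h4 : 1 / ρ * (ω y + y * r * (Real.log z - Real.log y)) =
      1 / ρ * ω y + κ * (Real.log z - Real.log y) := by rw [hκ]; ring
    have h5 := Real.log_nonneg hz
    have h6 := Real.log_pos hy
    nlinarith [mul_nonneg (sub_nonneg.2 hk1) h5]
  have hfac : κ ^ k * (1 / 4) ^ k ≤ 4 * (Nat.factorial k : ℝ) := by
    have h1 := Real.pow_div_factorial_le_exp κ hκ0 k
    have h2 : Real.exp κ ≤ Real.exp 1 ^ (k + 1) := by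
      rw [← Real.exp_nat_mul, Real.exp_le_exp]; push_cast; linarith
    have h3 : Real.exp 1 ≤ 4 := by have := Real.exp_one_lt_d9; linarith
    have h4 : Real.exp κ ≤ 4 ^ (k + 1) := h2.trans (by gcongr)
    rw [div_le_iff₀ (by positivity)] at h1
    calc κ ^ k * (1 / 4) ^ k ≤ (4 ^ (k + 1) * (Nat.factorial k : ℝ)) * (1 / 4) ^ k := by
          gcongr; exact h1.trans (by gcongr)
      _ = _ := by rw [pow_succ, div_pow, one_pow]; field_simp
  calc Real.exp (1 / ρ * youngConj ω (ρ * k)) * (1 / ρ * r / 4) ^ k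
      ≤ y ^ k * (y * Real.exp (-(1 / ρ * ω y))) * (1 / ρ * r / 4) ^ k := by gcongr
    _ = (κ ^ k * (1 / 4) ^ k) * (y * Real.exp (-(1 / ρ * ω y))) := by
        rw [hκ, ← mul_pow, mul_right_comm, ← mul_pow]
        ring
    _ ≤ 4 * (Nat.factorial k : ℝ) * (y * Real.exp (-(1 / ρ * ω y))) := by gcongr
    _ = _ := by ring

/-- Lower bound for the weights in terms of the slope. -/
lemma pow_div_mul_exp_le {ω : ℝ → ℝ} (hω : IsWeightFunction ω) {y r ρ : ℝ}
    (hy : 1 < y) (h : IsSlopeAt ω y r) (hr : 0 < r) (hr1 : r ≤ 1) (hρ : 0 < ρ) (k : ℕ) :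
    (k / r) ^ k * Real.exp (-(1 / ρ * ω y)) ≤
      Real.exp (1 / ρ) ^ k * Real.exp (1 / ρ * youngConj ω (ρ * k)) := by
  rcases Nat.eq_zero_or_pos k with rfl | hk
  · simpa using pow_mul_exp_le_exp_youngConj hω hρ 0 hy.le
  have hk1 : (1 : ℝ) ≤ k := by exact_mod_cast hk
  have hz : 1 ≤ k / r := by rw [le_div_iff₀ hr]; linarith
  have h1 := h.le_line (k / r) (by positivity)
  have h2 : ω (k / r) ≤ ω y + k := by
    have : r * (k / r - y) = k - r * y := by field_simp
    have : 0 ≤ r * y := by positivity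
    linarith
  have h3 : Real.exp (-(1 / ρ * ω y)) ≤ Real.exp (1 / ρ) ^ k * Real.exp (-(1 / ρ * ω (k / r))) := by
    rw [← Real.exp_nat_mul, ← Real.exp_add, Real.exp_le_exp]
    have : 1 / ρ * ω (k / r) ≤ 1 / ρ * (ω y + k) := by gcongr
    linarith
  calc (k / r) ^ k * Real.exp (-(1 / ρ * ω y))
      ≤ (k / r) ^ k * (Real.exp (1 / ρ) ^ k * Real.exp (-(1 / ρ * ω (k / r)))) := by gcongr
    _ = Real.exp (1 / ρ) ^ k * ((k / r) ^ k * Real.exp (-(1 / ρ * ω (k / r)))) := by ring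
    _ ≤ _ := by gcongr; exact pow_mul_exp_le_exp_youngConj hω hρ k hz

lemma norm_cosh_lt_two {ζ : ℂ} (h0 : 0 ≤ ζ.re) (h1 : ζ.re ≤ 1) : ‖Complex.cosh ζ‖ < 2 := by
  have h2 : ‖Complex.exp ζ + Complex.exp (-ζ)‖ ≤ Real.exp 1 + 1 := by
    refine (norm_add_le _ _).trans ?_
    rw [Complex.norm_exp, Complex.norm_exp, Complex.neg_re]
    exact add_le_add (Real.exp_le_exp.2 h1) (Real.exp_le_one_iff.2 (by linarith))
  rw [Complex.cosh, norm_div, Complex.norm_ofNat, div_lt_iff₀ (by norm_num)]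
  have := Real.exp_one_lt_d9
  linarith

lemma exists_cosh_eq {w : ℂ} (hw : ‖w‖ ≤ 1 / 2) :
    ∃ ζ : ℂ, Complex.cosh ζ = w ∧ 0 ≤ ζ.re ∧ ζ.re ≤ 1 / 2 := by
  have key : ∀ ζ : ℂ, Complex.cosh ζ = w → |ζ.re| ≤ 1 / 2 := by
    intro ζ hζ
    have h1 : ‖Complex.cosh ζ‖ ^ 2 = Real.sinh ζ.re ^ 2 + Real.cos ζ.im ^ 2 := by
      rw [← Complex.normSq_eq_norm_sq]
      conv_lhs => rw [← Complex.re_add_im ζ, Complex.cosh_add, Complex.cosh_mul_I, Complex.sinh_mul_I]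
      rw [← Complex.ofReal_cosh, ← Complex.ofReal_sinh, ← Complex.ofReal_cos, ← Complex.ofReal_sin]
      simp only [Complex.normSq_apply, Complex.add_re, Complex.add_im, Complex.mul_re,
        Complex.mul_im, Complex.ofReal_re, Complex.ofReal_im, Complex.I_re, Complex.I_im]
      have h2 := Real.cosh_sq ζ.re
      have h3 := Real.sin_sq_add_cos_sq ζ.im
      ring_nf
      rw [h2]
      linear_combination (Real.sinh ζ.re ^ 2) * h3
    have h2 : |Real.sinh ζ.re| ≤ 1 / 2 := by
      apply abs_le_of_sq_le_sq _ (by norm_num)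
      rw [hζ] at h1
      nlinarith [sq_nonneg (Real.cos ζ.im), norm_nonneg w]
    rw [Real.abs_sinh] at h2
    exact (Real.self_le_sinh_iff.2 (abs_nonneg _)).trans h2
  obtain ⟨u, hu⟩ := Complex.cos_surjective w
  have hu' : Complex.cosh (u * Complex.I) = w := by rw [Complex.cosh_mul_I, hu]
  rcases le_total 0 (u * Complex.I).re with h | h
  · exact ⟨_, hu', h, (le_abs_self _).trans (key _ hu')⟩
  · have : Complex.cosh (-(u * Complex.I)) = w := by rw [Complex.cosh_neg, hu']
    exact ⟨_, this, by simpa using h, (le_abs_self _).trans (key _ this)⟩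

/-- A bounded holomorphic function on a disc which is small on the real diameter is small on a
smaller disc. -/
lemma norm_le_of_norm_le_real {Φ : ℂ → ℂ} {R B θ : ℝ} (hΦ : DifferentiableOn ℂ Φ (ball 0 R))
    (hB : 0 < B) (hθ : 0 < θ) (hθ1 : θ ≤ 1) (hbound : ∀ z ∈ ball (0 : ℂ) R, ‖Φ z‖ ≤ B)
    (hreal : ∀ t : ℝ, |t| < R → ‖Φ t‖ ≤ B * θ ^ 2) {z : ℂ} (hz : ‖z‖ ≤ R / 4) (hR : 0 < R) :
    ‖Φ z‖ ≤ B * θ := by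
  obtain ⟨c, hc⟩ : ∃ c : ℂ, c = ((R / 2 : ℝ) : ℂ) := ⟨_, rfl⟩
  have hc0 : c ≠ 0 := by rw [hc]; exact_mod_cast (by positivity : R / 2 ≠ 0)
  have hcn : ‖c‖ = R / 2 := by rw [hc, Complex.norm_real, Real.norm_of_nonneg (by positivity)]
  have hmaps : ∀ ζ ∈ Complex.HadamardThreeLines.verticalClosedStrip 0 1,
      c * Complex.cosh ζ ∈ ball (0 : ℂ) R := by
    intro ζ hζ
    rw [mem_ball_zero_iff, norm_mul, hcn]
    have := norm_cosh_lt_two hζ.1 hζ.2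
    nlinarith
  obtain ⟨ζ, hζ, h0, h1⟩ := exists_cosh_eq (w := z / c) (by
    rw [norm_div, hcn, div_le_iff₀ (by positivity)]; linarith)
  have hzζ : c * Complex.cosh ζ = z := by rw [hζ]; field_simp
  have hd : DifferentiableOn ℂ (fun ζ => Φ (c * Complex.cosh ζ))
      (Complex.HadamardThreeLines.verticalClosedStrip 0 1) :=
    hΦ.comp (by fun_prop) hmaps
  have hcl : closure (Complex.HadamardThreeLines.verticalStrip 0 1) ⊆
      Complex.HadamardThreeLines.verticalClosedStrip 0 1 :=
    closure_minimal (fun x hx => ⟨hx.1.le, hx.2.le⟩) (isClosed_Icc.preimage Complex.continuous_re)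
  have h := Complex.HadamardThreeLines.norm_le_interp_of_mem_verticalClosedStrip₀₁'
    (fun ζ => Φ (c * Complex.cosh ζ)) (z := ζ) (a := B * θ ^ 2) (b := B)
    ⟨h0, by linarith⟩
    (hd.mono hcl).diffContOnCl
    ⟨B, by rintro _ ⟨x, hx, rfl⟩; exact hbound _ (hmaps x hx)⟩
    (fun x hx => by
      have hx' : x = (x.im : ℝ) * Complex.I := by
        apply Complex.ext <;> simp; exact hx
      have he : c * Complex.cosh x = ((R / 2 * Real.cos x.im : ℝ) : ℂ) := by
        rw [hx', Complex.cosh_mul_I, hc]; push_cast; simp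
      rw [he]
      apply hreal
      rw [abs_mul, abs_of_pos (by positivity : 0 < R / 2)]
      have := Real.abs_cos_le_one x.im
      nlinarith)
    (fun x hx => hbound _ (hmaps x (by
      have : x.re = 1 := hx
      exact ⟨by rw [this]; norm_num, by rw [this]⟩)))
  simp only [hzζ] at h
  refine h.trans ?_
  rw [Real.mul_rpow hB.le (by positivity), mul_right_comm, ← Real.rpow_add hB, sub_add_cancel,
    Real.rpow_one, ← Real.rpow_natCast, ← Real.rpow_mul hθ.le]
  gcongr
  conv_rhs => rw [← Real.rpow_one θ]
  apply Real.rpow_le_rpow_of_exponent_ge hθ hθ1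
  push_cast
  linarith

open MeasureTheory

/-- The Cauchy–Riemann operator `∂/∂z̄`. -/
def dbar (φ : ℂ → ℂ) (z : ℂ) : ℂ := (fderiv ℝ φ z 1 + Complex.I * fderiv ℝ φ z Complex.I) / 2

/-- The operator `∂/∂z`. -/
def dz (φ : ℂ → ℂ) (z : ℂ) : ℂ := (fderiv ℝ φ z 1 - Complex.I * fderiv ℝ φ z Complex.I) / 2

lemma integral_fderiv_eq_zero {φ : ℂ → ℂ} (hφ : ContDiff ℝ 1 φ) (hc : HasCompactSupport φ) (v : ℂ) :
    ∫ z, fderiv ℝ φ z v = 0 := by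
  have hcont : Continuous (fun z => fderiv ℝ φ z v) := by
    have := hφ.continuous_fderiv one_ne_zero
    fun_prop
  have h := integral_mul_fderiv_eq_neg_fderiv_mul_of_integrable (μ := (volume : Measure ℂ))
    (f := fun _ => (1 : ℂ)) (g := φ) (v := v) (by simp)
    (by simpa using hcont.integrable_of_hasCompactSupport (hc.fderiv_apply ℝ v))
    (by simpa using hφ.continuous.integrable_of_hasCompactSupport hc)
    (fun _ _ => differentiableAt_const _) (fun x _ => hφ.differentiable one_ne_zero x)
  simpa using h

lemma integrable_fderiv_apply {φ : ℂ → ℂ} (hφ : ContDiff ℝ 1 φ) (hc : HasCompactSupport φ) (v : ℂ) :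
    Integrable (fun z => fderiv ℝ φ z v) := by
  have hcont : Continuous (fun z => fderiv ℝ φ z v) := by
    have := hφ.continuous_fderiv one_ne_zero
    fun_prop
  exact hcont.integrable_of_hasCompactSupport (hc.fderiv_apply ℝ v)

lemma integral_dbar_eq_zero {φ : ℂ → ℂ} (hφ : ContDiff ℝ 1 φ) (hc : HasCompactSupport φ) :
    ∫ z, dbar φ z = 0 := by
  simp only [dbar, integral_div]
  rw [integral_add (integrable_fderiv_apply hφ hc _)
    ((integrable_fderiv_apply hφ hc _).const_mul _), integral_const_mul,
    integral_fderiv_eq_zero hφ hc, integral_fderiv_eq_zero hφ hc]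
  simp

lemma integral_dz_eq_zero {φ : ℂ → ℂ} (hφ : ContDiff ℝ 1 φ) (hc : HasCompactSupport φ) :
    ∫ z, dz φ z = 0 := by
  simp only [dz, integral_div]
  rw [integral_sub (integrable_fderiv_apply hφ hc _)
    ((integrable_fderiv_apply hφ hc _).const_mul _), integral_const_mul,
    integral_fderiv_eq_zero hφ hc, integral_fderiv_eq_zero hφ hc]
  simp

lemma continuous_dbar {φ : ℂ → ℂ} (hφ : ContDiff ℝ 1 φ) : Continuous (dbar φ) := by
  have := hφ.continuous_fderiv one_ne_zero
  unfold dbar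
  fun_prop

/-- Expression of `∂̄φ` in polar directions. -/
lemma dbar_div_exp (φ : ℂ → ℂ) (w : ℂ) (θ : ℝ) :
    dbar φ w / Complex.exp (θ * Complex.I) = (fderiv ℝ φ w (Complex.exp (θ * Complex.I)) +
      Complex.I * fderiv ℝ φ w (Complex.I * Complex.exp (θ * Complex.I))) / 2 := by
  have he : Complex.exp (θ * Complex.I) = Real.cos θ • (1 : ℂ) + Real.sin θ • Complex.I := by
    rw [Complex.exp_mul_I]; simp
  have hie : Complex.I * Complex.exp (θ * Complex.I)
      = Real.cos θ • Complex.I - Real.sin θ • (1 : ℂ) := by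
    rw [he]; simp only [Complex.real_smul]; linear_combination (Real.sin θ : ℂ) * Complex.I_mul_I
  rw [div_eq_iff (Complex.exp_ne_zero _), hie, dbar]
  conv_rhs => rw [he]
  simp only [map_add, map_sub, map_smul]
  simp only [Complex.real_smul, mul_one]
  have hcs : (Real.cos θ : ℂ) ^ 2 + (Real.sin θ : ℂ) ^ 2 = 1 := by
    exact_mod_cast Real.cos_sq_add_sin_sq θ
  generalize fderiv ℝ φ w 1 = a
  generalize fderiv ℝ φ w Complex.I = b
  generalize (Real.cos θ : ℂ) = c at *
  generalize (Real.sin θ : ℂ) = s at *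
  linear_combination (-(a + Complex.I * b) / 2) * hcs +
    (s * s * a / 2 - s * c * b / 2 - Complex.I * s * s * 0) * Complex.I_sq

lemma integrableOn_polar {φ : ℂ → ℂ} (hφ : ContDiff ℝ 1 φ) (hc : HasCompactSupport φ)
    (c : ℂ) : IntegrableOn (fun p : ℝ × ℝ => fderiv ℝ φ (p.1 * Complex.exp (p.2 * Complex.I))
      (c * Complex.exp (p.2 * Complex.I))) (Ioi 0 ×ˢ Ioo (-Real.pi) Real.pi) := by
  obtain ⟨R, hR⟩ := hc.isCompact.isBounded.subset_ball (0 : ℂ)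
  have hcont : Continuous (fun p : ℝ × ℝ => fderiv ℝ φ (p.1 * Complex.exp (p.2 * Complex.I))
      (c * Complex.exp (p.2 * Complex.I))) := by
    have := hφ.continuous_fderiv one_ne_zero
    fun_prop
  have h1 : IntegrableOn (fun p : ℝ × ℝ => fderiv ℝ φ (p.1 * Complex.exp (p.2 * Complex.I))
      (c * Complex.exp (p.2 * Complex.I))) (Icc 0 R ×ˢ Icc (-Real.pi) Real.pi) :=
    hcont.continuousOn.integrableOn_compact (isCompact_Icc.prod isCompact_Icc)
  refine h1.of_forall_sdiff_eq_zero ((measurableSet_Ioi.prod measurableSet_Ioo)) ?_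
  rintro ⟨r, θ⟩ ⟨⟨hr, hθ⟩, h⟩
  have hrR : R < r := by
    by_contra hcon
    exact h ⟨⟨le_of_lt hr, not_lt.1 hcon⟩, ⟨hθ.1.le, hθ.2.le⟩⟩
  have : (r * Complex.exp (θ * Complex.I) : ℂ) ∉ tsupport φ := by
    intro hmem
    have := hR hmem
    rw [mem_ball_zero_iff, norm_mul, Complex.norm_exp_ofReal_mul_I, Complex.norm_real,
      Real.norm_of_nonneg (le_of_lt hr), mul_one] at this
    linarith
  have h0 : fderiv ℝ φ (r * Complex.exp (θ * Complex.I)) = 0 := by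
    by_contra hne
    exact this (support_fderiv_subset ℝ hne)
  simp [h0]

lemma integral_dbar_div_self {φ : ℂ → ℂ} (hφ : ContDiff ℝ 1 φ) (hc : HasCompactSupport φ) :
    ∫ w, dbar φ w / w = -Real.pi * φ 0 := by
  rw [← Complex.integral_comp_polarCoord_symm]
  have hd := hφ.differentiable one_ne_zero
  have hint1 := integrableOn_polar hφ hc 1
  have hint2 := integrableOn_polar hφ hc Complex.I
  have e : ∀ p ∈ polarCoord.target, p.1 • (dbar φ (Complex.polarCoord.symm p) /
      Complex.polarCoord.symm p) = (1 / 2 : ℂ) * fderiv ℝ φ (p.1 * Complex.exp (p.2 * Complex.I))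
      (1 * Complex.exp (p.2 * Complex.I)) + (Complex.I / 2) *
       fderiv ℝ φ (p.1 * Complex.exp (p.2 * Complex.I))
        (Complex.I * Complex.exp (p.2 * Complex.I)) := by
    rintro ⟨r, θ⟩ ⟨hr, hθ⟩
    have hr' : (r : ℂ) ≠ 0 := by exact_mod_cast ne_of_gt hr
    have := dbar_div_exp φ (r * Complex.exp (θ * Complex.I)) θ
    simp only [Complex.polarCoord_symm_apply, Complex.ofReal_cos, Complex.ofReal_sin,
      ← Complex.exp_mul_I, Complex.real_smul, one_mul]
    rw [← div_div, div_right_comm, mul_div_cancel₀ _ hr', this]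
    ring
  rw [setIntegral_congr_fun (s := polarCoord.target) (measurableSet_Ioi.prod measurableSet_Ioo) e]
  change ∫ p in Ioi 0 ×ˢ Ioo (-Real.pi) Real.pi, _ = _
  rw [integral_add (hint1.integrable.const_mul _) (hint2.integrable.const_mul _),
    integral_const_mul, integral_const_mul]
  have hI2 : ∫ p in Ioi (0 : ℝ) ×ˢ Ioo (-Real.pi) Real.pi,
      fderiv ℝ φ (p.1 * Complex.exp (p.2 * Complex.I)) (Complex.I * Complex.exp (p.2 * Complex.I))
      = 0 := by
    rw [Measure.volume_eq_prod, setIntegral_prod _ hint2]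
    apply setIntegral_eq_zero_of_forall_eq_zero
    intro r hr
    have hr' : (r : ℂ) ≠ 0 := by exact_mod_cast ne_of_gt hr
    have hder : ∀ θ : ℝ, HasDerivAt (fun θ : ℝ => φ (r * Complex.exp (θ * Complex.I)) / r)
        (fderiv ℝ φ (r * Complex.exp (θ * Complex.I)) (Complex.I * Complex.exp (θ * Complex.I))) θ := by
      intro θ
      have h1 : HasDerivAt (fun θ : ℝ => (r * Complex.exp (θ * Complex.I) : ℂ))
          (r • (Complex.I * Complex.exp (θ * Complex.I))) θ := by
        have := (((Complex.ofRealCLM.hasDerivAt (x := θ)).mul_const Complex.I).cexp).const_mul (r : ℂ)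
        refine this.congr_deriv ?_
        simp [mul_comm]
      have h2 := ((hd _).hasFDerivAt.comp_hasDerivAt θ h1).div_const (r : ℂ)
      refine h2.congr_deriv ?_
      rw [map_smul, Complex.real_smul]
      field_simp
    rw [← integral_Ioc_eq_integral_Ioo, ← intervalIntegral.integral_of_le (by linarith [Real.pi_pos]),
      intervalIntegral.integral_eq_sub_of_hasDerivAt (fun θ _ => hder θ)]
    · simp [Complex.exp_neg]
    · apply Continuous.intervalIntegrable
      have := hφ.continuous_fderiv one_ne_zero
      fun_prop
  have hI1 : ∫ p in Ioi (0 : ℝ) ×ˢ Ioo (-Real.pi) Real.pi,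
      fderiv ℝ φ (p.1 * Complex.exp (p.2 * Complex.I)) (1 * Complex.exp (p.2 * Complex.I))
      = - (2 * Real.pi) * φ 0 := by
    rw [Measure.volume_eq_prod, ← setIntegral_prod_swap, setIntegral_prod _ (by
      rw [IntegrableOn, ← Measure.prod_restrict]
      rw [IntegrableOn, Measure.volume_eq_prod, ← Measure.prod_restrict] at hint1
      exact hint1.swap)]
    have : ∀ θ ∈ Ioo (-Real.pi) Real.pi, ∫ r in Ioi (0 : ℝ), fderiv ℝ φ ((Prod.swap (θ, r)).1 *
        Complex.exp ((Prod.swap (θ, r)).2 * Complex.I)) (1 * Complex.exp ((Prod.swap (θ, r)).2 * Complex.I)) = - φ 0 := by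
      intro θ _
      have hder : ∀ r : ℝ, HasDerivAt (fun r : ℝ => φ (r * Complex.exp (θ * Complex.I)))
        (fderiv ℝ φ (r * Complex.exp (θ * Complex.I)) (1 * Complex.exp (θ * Complex.I))) r := by
        intro r
        exact (hd _).hasFDerivAt.comp_hasDerivAt r
          ((Complex.ofRealCLM.hasDerivAt (x := r)).mul_const (Complex.exp (θ * Complex.I)))
      have hcs : HasCompactSupport (fun r : ℝ => φ (r * Complex.exp (θ * Complex.I))) := by
        apply hc.comp_isClosedEmbedding (g := fun r : ℝ => (r * Complex.exp (θ * Complex.I) : ℂ))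
        refine Isometry.isClosedEmbedding (Isometry.of_dist_eq fun a b => ?_)
        rw [dist_eq_norm, ← sub_mul, norm_mul, Complex.norm_exp_ofReal_mul_I, mul_one,
          ← Complex.ofReal_sub, Complex.norm_real, dist_eq_norm]
      have hcd : ContDiff ℝ 1 (fun r : ℝ => φ (r * Complex.exp (θ * Complex.I))) := by
        refine hφ.comp ?_
        exact Complex.ofRealCLM.contDiff.mul contDiff_const
      have := hcs.integral_Ioi_deriv_eq hcd 0
      simp only [(hder _).deriv] at this
      simpa using this
    rw [setIntegral_congr_fun measurableSet_Ioo this]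
    rw [setIntegral_const, Real.volume_real_Ioo_of_le (by linarith [Real.pi_pos]),
      Complex.real_smul]
    push_cast; ring
  rw [hI1, hI2]
  ring

/-- **Cauchy–Pompeiu formula** for compactly supported functions. -/
lemma integral_dbar_add_div {φ : ℂ → ℂ} (hφ : ContDiff ℝ 1 φ) (hc : HasCompactSupport φ) (z : ℂ) :
    ∫ w, dbar φ (z + w) / w = -Real.pi * φ z := by
  have h1 : ContDiff ℝ 1 (fun w => φ (z + w)) := hφ.comp (by fun_prop)
  have h2 : HasCompactSupport (fun w => φ (z + w)) := hc.comp_homeomorph (Homeomorph.addLeft z)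
  have h := integral_dbar_div_self h1 h2
  simp only [add_zero] at h
  rw [← h]
  congr 1
  ext w
  simp only [dbar, fderiv_comp_add_left]

open ComplexConjugate

lemma dbar_mul {f g : ℂ → ℂ} {z : ℂ} (hf : DifferentiableAt ℝ f z) (hg : DifferentiableAt ℝ g z) :
    dbar (fun z => f z * g z) z = dbar f z * g z + f z * dbar g z := by
  simp only [dbar, fderiv_fun_mul hf hg, add_apply,
    smul_apply, smul_eq_mul]
  ring

lemma dz_mul {f g : ℂ → ℂ} {z : ℂ} (hf : DifferentiableAt ℝ f z) (hg : DifferentiableAt ℝ g z) :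
    dz (fun z => f z * g z) z = dz f z * g z + f z * dz g z := by
  simp only [dz, fderiv_fun_mul hf hg, add_apply,
    smul_apply, smul_eq_mul]
  ring

lemma fderiv_real_of_differentiableAt {G : ℂ → ℂ} {z : ℂ} (hG : DifferentiableAt ℂ G z) (v : ℂ) :
    fderiv ℝ G z v = v * deriv G z := by
  rw [hG.fderiv_restrictScalars ℝ, ContinuousLinearMap.coe_restrictScalars', fderiv_eq_smul_deriv,
    smul_eq_mul]

lemma dbar_of_differentiableAt {G : ℂ → ℂ} {z : ℂ} (hG : DifferentiableAt ℂ G z) :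
    dbar G z = 0 := by
  simp only [dbar, fderiv_real_of_differentiableAt hG]
  linear_combination deriv G z / 2 * Complex.I_sq

lemma dz_of_differentiableAt {G : ℂ → ℂ} {z : ℂ} (hG : DifferentiableAt ℂ G z) :
    dz G z = deriv G z := by
  simp only [dz, fderiv_real_of_differentiableAt hG]
  linear_combination -deriv G z / 2 * Complex.I_sq

lemma fderiv_conj_of_differentiableAt {G : ℂ → ℂ} {z : ℂ} (hG : DifferentiableAt ℂ G z) (v : ℂ) :
    fderiv ℝ (fun z => conj (G z)) z v = conj v * conj (deriv G z) := by
  have h1 : HasFDerivAt (fun z => conj (G z))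
      ((Complex.conjCLE : ℂ →L[ℝ] ℂ).comp (fderiv ℝ G z)) z :=
    (Complex.conjCLE : ℂ →L[ℝ] ℂ).hasFDerivAt.comp z (hG.restrictScalars ℝ).hasFDerivAt
  rw [h1.fderiv]
  simp [fderiv_real_of_differentiableAt hG]

lemma dbar_conj {G : ℂ → ℂ} {z : ℂ} (hG : DifferentiableAt ℂ G z) :
    dbar (fun z => conj (G z)) z = conj (deriv G z) := by
  simp only [dbar, fderiv_conj_of_differentiableAt hG, map_one, Complex.conj_I]
  linear_combination -conj (deriv G z) / 2 * Complex.I_sq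

lemma dz_conj {G : ℂ → ℂ} {z : ℂ} (hG : DifferentiableAt ℂ G z) :
    dz (fun z => conj (G z)) z = 0 := by
  simp only [dz, fderiv_conj_of_differentiableAt hG, map_one, Complex.conj_I]
  linear_combination conj (deriv G z) / 2 * Complex.I_sq

lemma dz_comp {h : ℂ → ℂ} {h' : ℂ} {f : ℂ → ℂ} {z : ℂ} (hh : HasDerivAt h h' (f z))
    (hf : DifferentiableAt ℝ f z) : dz (fun z => h (f z)) z = h' * dz f z := by
  have := (hh.comp_hasFDerivAt z hf.hasFDerivAt).fderiv
  simp only [Function.comp_def] at this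
  simp only [dz, this, smul_apply, smul_eq_mul]
  ring

/-- The regularised squared modulus `|G|² + δ²`, as a complex-valued function. -/
def regSq (G : ℂ → ℂ) (δ : ℝ) (z : ℂ) : ℂ := G z * conj (G z) + (δ : ℂ) ^ 2

lemma regSq_eq (G : ℂ → ℂ) (δ : ℝ) (z : ℂ) : regSq G δ z = ((‖G z‖ ^ 2 + δ ^ 2 : ℝ) : ℂ) := by
  rw [regSq, Complex.mul_conj']; push_cast; ring

lemma regSq_ne_zero (G : ℂ → ℂ) {δ : ℝ} (hδ : 0 < δ) (z : ℂ) : regSq G δ z ≠ 0 := by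
  rw [regSq_eq]; exact_mod_cast (by positivity : ‖G z‖ ^ 2 + δ ^ 2 ≠ 0)

lemma contDiff_real {G : ℂ → ℂ} (hG : Differentiable ℂ G) {n : WithTop ℕ∞} : ContDiff ℝ n G := hG.contDiff.restrict_scalars ℝ

lemma contDiff_conj {G : ℂ → ℂ} (hG : Differentiable ℂ G) {n : WithTop ℕ∞} : ContDiff ℝ n (fun z => conj (G z)) :=
  (Complex.conjCLE : ℂ →L[ℝ] ℂ).contDiff.comp (contDiff_real hG)

lemma contDiff_regSq {G : ℂ → ℂ} (hG : Differentiable ℂ G) {δ : ℝ} {n : WithTop ℕ∞} : ContDiff ℝ n (regSq G δ) :=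
  ((contDiff_real hG).mul (contDiff_conj hG)).add contDiff_const

lemma dbar_regSq {G : ℂ → ℂ} (hG : Differentiable ℂ G) {δ : ℝ} (z : ℂ) : dbar (regSq G δ) z = G z * conj (deriv G z) := by
  have h : dbar (regSq G δ) z = dbar (fun z => G z * conj (G z)) z := by
    simp only [dbar]
    rw [show regSq G δ = fun z => G z * conj (G z) + (δ : ℂ) ^ 2 from rfl, fderiv_add_const]
  rw [h, dbar_mul ((hG z).restrictScalars ℝ)
    ((contDiff_conj hG (n := 1)).differentiable one_ne_zero z),
    dbar_of_differentiableAt (hG z), dbar_conj (hG z)]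
  ring

lemma dz_regSq {G : ℂ → ℂ} (hG : Differentiable ℂ G) {δ : ℝ} (z : ℂ) : dz (regSq G δ) z = deriv G z * conj (G z) := by
  have h : dz (regSq G δ) z = dz (fun z => G z * conj (G z)) z := by
    simp only [dz]
    rw [show regSq G δ = fun z => G z * conj (G z) + (δ : ℂ) ^ 2 from rfl, fderiv_add_const]
  rw [h, dz_mul ((hG z).restrictScalars ℝ)
    ((contDiff_conj hG (n := 1)).differentiable one_ne_zero z),
    dz_of_differentiableAt (hG z), dz_conj (hG z)]
  ring

lemma contDiff_mul_conj_div {G : ℂ → ℂ} (hG : Differentiable ℂ G) {δ : ℝ} (hδ : 0 < δ)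
    {H : ℂ → ℂ} (hH : Differentiable ℂ H) :
    ContDiff ℝ 1 (fun z => H z * conj (G z) / regSq G δ z) :=
  ((contDiff_real hH).mul (contDiff_conj hG)).mul ((contDiff_regSq hG).inv (regSq_ne_zero G hδ))

lemma dbar_mul_conj_div {G : ℂ → ℂ} (hG : Differentiable ℂ G) {δ : ℝ} (hδ : 0 < δ)
    {H : ℂ → ℂ} (hH : Differentiable ℂ H) (z : ℂ) :
    dbar (fun z => H z * conj (G z) / regSq G δ z) z =
      H z * conj (deriv G z) * (δ : ℂ) ^ 2 / regSq G δ z ^ 2 := by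
  have hW := regSq_ne_zero G hδ
  have hd := (contDiff_mul_conj_div hG hδ hH).differentiable one_ne_zero z
  have h1 := dbar_mul hd ((contDiff_regSq hG (δ := δ) (n := 1)).differentiable one_ne_zero z)
  simp only [div_mul_cancel₀ _ (hW _)] at h1
  rw [dbar_mul ((hH z).restrictScalars ℝ)
    ((contDiff_conj hG (n := 1)).differentiable one_ne_zero z),
    dbar_of_differentiableAt (hH z), dbar_conj (hG z), dbar_regSq hG] at h1
  rw [eq_div_iff (pow_ne_zero 2 (hW z))]
  have h2 : H z * conj (G z) / regSq G δ z * regSq G δ z = H z * conj (G z) :=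
    div_mul_cancel₀ _ (hW z)
  have h3 : regSq G δ z = G z * conj (G z) + (δ : ℂ) ^ 2 := rfl
  linear_combination (-regSq G δ z) * h1 - G z * conj (deriv G z) * h2 +
    (H z * conj (deriv G z)) * h3

lemma contDiff_log_regSq {G : ℂ → ℂ} (hG : Differentiable ℂ G) {δ : ℝ} (hδ : 0 < δ)
    {n : WithTop ℕ∞} : ContDiff ℝ n (fun z => (Complex.log (regSq G δ z))) := by
  rw [contDiff_iff_contDiffAt]
  intro z
  have h : regSq G δ z ∈ Complex.slitPlane := by
    rw [regSq_eq]; exact Complex.ofReal_mem_slitPlane.2 (by positivity)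
  exact ((Complex.contDiffAt_log h).restrict_scalars ℝ).comp z
    (contDiff_regSq hG).contDiffAt

lemma dz_log_regSq {G : ℂ → ℂ} (hG : Differentiable ℂ G) {δ : ℝ} (hδ : 0 < δ)
    (z : ℂ) : dz (fun z => (Complex.log (regSq G δ z))) z =
    deriv G z * conj (G z) / regSq G δ z := by
  have h : regSq G δ z ∈ Complex.slitPlane := by
    rw [regSq_eq]; exact Complex.ofReal_mem_slitPlane.2 (by positivity)
  rw [dz_comp (Complex.hasDerivAt_log h) ((contDiff_regSq hG (n := 1)).differentiable one_ne_zero z),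
    dz_regSq hG]
  field_simp

lemma norm_log_regSq_le {G : ℂ → ℂ} {δ : ℝ} (hδ : 0 < δ) {A : ℝ} (hδ1 : δ ≤ 1) {z : ℂ} (hz : ‖G z‖ ≤ A) :
    ‖Complex.log (regSq G δ z)‖ ≤ (2 + A ^ 2) * (1 + Real.log (1 / δ)) := by
  have hpos : 0 < ‖G z‖ ^ 2 + δ ^ 2 := by positivity
  rw [regSq_eq, ← Complex.ofReal_log hpos.le, Complex.norm_real, Real.norm_eq_abs, abs_le]
  have h0 : 0 ≤ Real.log (1 / δ) := Real.log_nonneg (by rw [le_div_iff₀ hδ]; linarith)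
  have h1 : 2 * Real.log δ ≤ Real.log (‖G z‖ ^ 2 + δ ^ 2) := by
    have := Real.log_le_log (by positivity : 0 < δ ^ 2) (by nlinarith [sq_nonneg ‖G z‖] :
      δ ^ 2 ≤ ‖G z‖ ^ 2 + δ ^ 2)
    rwa [Real.log_pow] at this
  have h2 : Real.log (‖G z‖ ^ 2 + δ ^ 2) ≤ A ^ 2 := by
    have := Real.log_le_sub_one_of_pos hpos
    have hA : ‖G z‖ ^ 2 ≤ A ^ 2 := by gcongr
    nlinarith
  have h3 : Real.log δ = - Real.log (1 / δ) := by rw [one_div, Real.log_inv]; ring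
  constructor <;> nlinarith [sq_nonneg A, mul_nonneg (sq_nonneg A) h0]

lemma contDiff_dbar {φ : ℂ → ℂ} (hφ : ContDiff ℝ 2 φ) : ContDiff ℝ 1 (dbar φ) := by
  have h : ContDiff ℝ 1 (fderiv ℝ φ) := hφ.fderiv_right (by norm_num)
  unfold dbar
  exact ((h.clm_apply contDiff_const).add
    (contDiff_const.mul (h.clm_apply contDiff_const))).div_const _

lemma dbar_eq_zero_of_notMem {φ : ℂ → ℂ} {z : ℂ} (h : z ∉ tsupport φ) : dbar φ z = 0 := by
  have h0 : fderiv ℝ φ z = 0 := by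
    by_contra hne
    exact h (support_fderiv_subset ℝ hne)
  simp [dbar, h0]

lemma dz_eq_zero_of_notMem {φ : ℂ → ℂ} {z : ℂ} (h : z ∉ tsupport φ) : dz φ z = 0 := by
  have h0 : fderiv ℝ φ z = 0 := by
    by_contra hne
    exact h (support_fderiv_subset ℝ hne)
  simp [dz, h0]

lemma tsupport_dbar_subset (φ : ℂ → ℂ) : tsupport (dbar φ) ⊆ tsupport φ :=
  closure_minimal (fun z hz => by
    by_contra h
    exact hz (dbar_eq_zero_of_notMem h)) (isClosed_tsupport _)

lemma continuous_dz {φ : ℂ → ℂ} (hφ : ContDiff ℝ 1 φ) : Continuous (dz φ) := by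
  have := hφ.continuous_fderiv one_ne_zero
  unfold dz
  fun_prop

/-- A bump function on `ℂ` viewed as a complex-valued function. -/
def cbump (χ : ContDiffBump (0 : ℂ)) (z : ℂ) : ℂ := (χ z : ℂ)

lemma contDiff_cbump (χ : ContDiffBump (0 : ℂ)) {n : ℕ∞} : ContDiff ℝ n (cbump χ) :=
  Complex.ofRealCLM.contDiff.comp χ.contDiff

lemma tsupport_cbump (χ : ContDiffBump (0 : ℂ)) : tsupport (cbump χ) = closedBall 0 χ.rOut := by
  rw [← χ.tsupport_eq, tsupport, tsupport]
  congr 1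
  ext z
  simp [cbump]

lemma hasCompactSupport_cbump (χ : ContDiffBump (0 : ℂ)) : HasCompactSupport (cbump χ) := by
  rw [HasCompactSupport, tsupport_cbump]; exact isCompact_closedBall _ _

/-- The density `∂∂̄ log(|G|² + δ²)` has mass at most of logarithmic size. -/
lemma exists_integral_bump_mul_le (χ : ContDiffBump (0 : ℂ)) (A : ℝ) : ∃ C, 0 ≤ C ∧
    ∀ G : ℂ → ℂ, Differentiable ℂ G → (∀ z ∈ closedBall (0 : ℂ) χ.rOut, ‖G z‖ ≤ A) →
      ∀ δ : ℝ, 0 < δ → δ ≤ 1 →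
      ∫ z, χ z * (‖deriv G z‖ ^ 2 * δ ^ 2 / (‖G z‖ ^ 2 + δ ^ 2) ^ 2)
        ≤ C * (1 + Real.log (1 / δ)) := by
  have hX2 : ContDiff ℝ 2 (cbump χ) := contDiff_cbump χ (n := 2)
  have hX1 : ContDiff ℝ 1 (cbump χ) := contDiff_cbump χ (n := 1)
  have hXc := hasCompactSupport_cbump χ
  have hdX := contDiff_dbar hX2
  have hdXc : HasCompactSupport (dbar (cbump χ)) :=
    hXc.of_isClosed_subset (isClosed_tsupport _) (tsupport_dbar_subset _)
  refine ⟨∫ z, (2 + A ^ 2) * ‖dz (dbar (cbump χ)) z‖, integral_nonneg fun z => by positivity, ?_⟩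
  intro G hG hGA δ hδ hδ1
  set a : ℂ → ℂ := fun z => deriv G z * conj (G z) / regSq G δ z with ha
  set L : ℂ → ℂ := fun z => Complex.log (regSq G δ z) with hL
  have hG' : Differentiable ℂ (deriv G) :=
    (hG.contDiff (n := 2)).differentiable_deriv_two
  have hac : ContDiff ℝ 1 a := contDiff_mul_conj_div hG hδ hG'
  have hLc : ContDiff ℝ 1 L := contDiff_log_regSq hG hδ
  have hda : ∀ z, dbar a z = ((‖deriv G z‖ ^ 2 * δ ^ 2 / (‖G z‖ ^ 2 + δ ^ 2) ^ 2 : ℝ) : ℂ) := by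
    intro z
    rw [ha, dbar_mul_conj_div hG hδ hG', Complex.mul_conj', regSq_eq]
    push_cast; ring
  have i1 : ∫ z, dbar (fun z => cbump χ z * a z) z = 0 :=
    integral_dbar_eq_zero (hX1.mul hac) hXc.mul_right
  have i2 : ∫ z, dz (fun z => L z * dbar (cbump χ) z) z = 0 :=
    integral_dz_eq_zero (hLc.mul hdX) hdXc.mul_left
  have e1 : ∀ z, dbar (fun z => cbump χ z * a z) z =
      dbar (cbump χ) z * a z + cbump χ z * dbar a z := fun z =>
    dbar_mul (hX1.differentiable one_ne_zero z) (hac.differentiable one_ne_zero z)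
  have e2 : ∀ z, dz (fun z => L z * dbar (cbump χ) z) z =
      a z * dbar (cbump χ) z + L z * dz (dbar (cbump χ)) z := fun z => by
    rw [dz_mul (hLc.differentiable one_ne_zero z) (hdX.differentiable one_ne_zero z),
      dz_log_regSq hG hδ]
  have hdzc : HasCompactSupport (dz (dbar (cbump χ))) :=
    hdXc.of_isClosed_subset (isClosed_tsupport _) (closure_minimal (fun z hz => by
      by_contra h
      exact hz (dz_eq_zero_of_notMem h)) (isClosed_tsupport _))
  have n1 : Integrable (fun z => dbar (cbump χ) z * a z) :=
    (hdX.continuous.mul hac.continuous).integrable_of_hasCompactSupport hdXc.mul_right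
  have n2 : Integrable (fun z => cbump χ z * dbar a z) :=
    (hX1.continuous.mul (continuous_dbar hac)).integrable_of_hasCompactSupport hXc.mul_right
  have n3 : Integrable (fun z => L z * dz (dbar (cbump χ)) z) :=
    (hLc.continuous.mul (continuous_dz hdX)).integrable_of_hasCompactSupport hdzc.mul_left
  simp only [e1] at i1
  simp only [e2] at i2
  rw [integral_add n1 n2] at i1
  rw [integral_add (by simpa only [mul_comm] using n1) n3] at i2
  have key : ∫ z, cbump χ z * dbar a z = ∫ z, L z * dz (dbar (cbump χ)) z := by
    have : ∫ z, dbar (cbump χ) z * a z = ∫ z, a z * dbar (cbump χ) z := by simp only [mul_comm]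
    linear_combination i1 - i2 - this
  have hre : ∫ z, cbump χ z * dbar a z =
      ((∫ z, χ z * (‖deriv G z‖ ^ 2 * δ ^ 2 / (‖G z‖ ^ 2 + δ ^ 2) ^ 2) : ℝ) : ℂ) := by
    rw [← integral_complex_ofReal]
    congr 1
    ext z
    rw [hda, cbump]; push_cast; ring
  have hnorm : ‖∫ z, L z * dz (dbar (cbump χ)) z‖ ≤
      ∫ z, (2 + A ^ 2) * ‖dz (dbar (cbump χ)) z‖ * (1 + Real.log (1 / δ)) := by
    refine norm_integral_le_of_norm_le ?_ (ae_of_all _ fun z => ?_)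
    · exact ((((continuous_dz hdX).norm).integrable_of_hasCompactSupport hdzc.norm).const_mul
        _).mul_const _
    · rw [norm_mul]
      by_cases hz : z ∈ closedBall (0 : ℂ) χ.rOut
      · have := norm_log_regSq_le hδ hδ1 (hGA z hz)
        calc _ ≤ ((2 + A ^ 2) * (1 + Real.log (1 / δ))) * ‖dz (dbar (cbump χ)) z‖ := by gcongr
          _ = _ := by ring
      · have : z ∉ tsupport (dbar (cbump χ)) := fun h => hz (by
          rw [← tsupport_cbump]; exact tsupport_dbar_subset _ h)
        simp [dz_eq_zero_of_notMem this]
  rw [← key, hre, Complex.norm_real, integral_mul_const] at hnorm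
  exact (le_abs_self _).trans hnorm

lemma lintegral_ball_inv_norm_lt_top (R : ℝ) :
    ∫⁻ w in ball (0 : ℂ) R, ‖w‖ₑ⁻¹ < ∞ := by
  rw [← lintegral_indicator measurableSet_ball, ← Complex.lintegral_comp_polarCoord_symm]
  have hle : ∀ p ∈ polarCoord.target, ENNReal.ofReal p.1 •
      (ball (0 : ℂ) R).indicator (fun w => ‖w‖ₑ⁻¹) (Complex.polarCoord.symm p) ≤
      (Ioo 0 R ×ˢ Ioo (-Real.pi) Real.pi).indicator (fun _ => (1 : ℝ≥0∞)) p := by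
    rintro ⟨r, θ⟩ ⟨hr, hθ⟩
    have hr : 0 < r := hr
    have hn : ‖Complex.polarCoord.symm (r, θ)‖ = r := by
      rw [Complex.norm_polarCoord_symm]; exact abs_of_pos hr
    by_cases h : r < R
    · rw [indicator_of_mem (by rwa [mem_ball_zero_iff, hn]), indicator_of_mem (by exact ⟨⟨hr, h⟩, hθ⟩),
        ← ofReal_norm, hn, smul_eq_mul, ENNReal.mul_inv_cancel (by simpa using hr) (by simp)]
    · rw [indicator_of_notMem (by rwa [mem_ball_zero_iff, hn])]; simp
  refine (setLIntegral_mono' (measurableSet_Ioi.prod measurableSet_Ioo) hle).trans_lt ?_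
  refine (setLIntegral_le_lintegral _ _).trans_lt ?_
  rw [lintegral_indicator (measurableSet_Ioo.prod measurableSet_Ioo), setLIntegral_one,
    Measure.volume_eq_prod, Measure.prod_prod, Real.volume_Ioo, Real.volume_Ioo]
  exact ENNReal.mul_lt_top ENNReal.ofReal_lt_top ENNReal.ofReal_lt_top

/-- The Cauchy transform is bounded on `L¹` of a disc. -/
lemma exists_lintegral_cauchy_le (R : ℝ) : ∃ K : ℝ, 0 < K ∧ ∀ m : ℂ → ℂ, Continuous m →
    tsupport m ⊆ ball 0 R → ∫⁻ z in ball (0 : ℂ) R, ‖∫ w, m (z + w) / w‖ₑ ≤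
      ENNReal.ofReal K * ∫⁻ z, ‖m z‖ₑ := by
  have hK := lintegral_ball_inv_norm_lt_top (2 * R)
  refine ⟨(∫⁻ w in ball (0 : ℂ) (2 * R), ‖w‖ₑ⁻¹).toReal + 1, by positivity, fun m hm hsupp => ?_⟩
  have hmeas : Measurable (fun p : ℂ × ℂ => ‖m (p.1 + p.2)‖ₑ * ‖p.2‖ₑ⁻¹) := by
    have := hm.measurable
    fun_prop
  calc ∫⁻ z in ball (0 : ℂ) R, ‖∫ w, m (z + w) / w‖ₑ
      ≤ ∫⁻ z in ball (0 : ℂ) R, ∫⁻ w in ball (0 : ℂ) (2 * R), ‖m (z + w)‖ₑ * ‖w‖ₑ⁻¹ := by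
        refine setLIntegral_mono' measurableSet_ball fun z hz => ?_
        have h1 : ∫ w, m (z + w) / w = ∫ w in ball (0 : ℂ) (2 * R), m (z + w) / w := by
          rw [setIntegral_eq_integral_of_forall_compl_eq_zero]
          intro w hw
          have : z + w ∉ tsupport m := fun h => hw (by
            have h1 := hsupp h
            rw [mem_ball_zero_iff] at *
            have := norm_sub_le (z + w) z
            rw [add_sub_cancel_left] at this
            linarith)
          rw [image_eq_zero_of_notMem_tsupport this, zero_div]
        rw [h1]
        refine (enorm_integral_le_lintegral_enorm _).trans (lintegral_mono fun w => ?_)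
        by_cases hw : w = 0
        · simp [hw]
        · rw [div_eq_mul_inv, enorm_mul, enorm_inv hw]
    _ = ∫⁻ w in ball (0 : ℂ) (2 * R), ∫⁻ z in ball (0 : ℂ) R, ‖m (z + w)‖ₑ * ‖w‖ₑ⁻¹ :=
        lintegral_lintegral_swap hmeas.aemeasurable
    _ ≤ ∫⁻ w in ball (0 : ℂ) (2 * R), (∫⁻ z, ‖m z‖ₑ) * ‖w‖ₑ⁻¹ := by
        refine lintegral_mono fun w => ?_
        rw [lintegral_mul_const _ (by have := hm.measurable; fun_prop)]
        refine mul_le_mul_left ((setLIntegral_le_lintegral _ _).trans ?_) _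
        rw [lintegral_add_right_eq_self (fun z => ‖m z‖ₑ)]
    _ = (∫⁻ z, ‖m z‖ₑ) * ∫⁻ w in ball (0 : ℂ) (2 * R), ‖w‖ₑ⁻¹ :=
        lintegral_const_mul _ (by fun_prop)
    _ ≤ _ := by
        rw [mul_comm]
        gcongr
        rw [ENNReal.le_ofReal_iff_toReal_le hK.ne (by positivity)]
        linarith

lemma integral_add_div_eq (m : ℂ → ℂ) (z : ℂ) : ∫ w, m (z + w) / w = ∫ ζ, m ζ / (ζ - z) := by
  rw [← integral_add_left_eq_self (fun ζ => m ζ / (ζ - z)) z]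
  simp

/-- The Cauchy transform is holomorphic off the support. -/
lemma differentiableOn_cauchy {m : ℂ → ℂ} (hm : Continuous m) (hc : HasCompactSupport m) {r : ℝ}
    (hr : ∀ z ∈ ball (0 : ℂ) r, m z = 0) :
    DifferentiableOn ℂ (fun z => ∫ w, m (z + w) / w) (ball 0 r) := by
  simp only [integral_add_div_eq]
  intro z₀ hz₀
  rw [mem_ball_zero_iff] at hz₀
  obtain ⟨s, hs1, hs2⟩ := exists_between hz₀
  have hs : ball (0 : ℂ) s ∈ 𝓝 z₀ := isOpen_ball.mem_nhds (by simpa using hs1)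
  have hsep : ∀ ζ z : ℂ, m ζ ≠ 0 → z ∈ ball (0 : ℂ) s → r - s ≤ ‖ζ - z‖ := by
    intro ζ z hζ hz
    have h1 : r ≤ ‖ζ‖ := by
      by_contra h
      exact hζ (hr ζ (by simpa using h))
    rw [mem_ball_zero_iff] at hz
    have := norm_sub_norm_le ζ z
    linarith
  have hmi : Integrable m := hm.integrable_of_hasCompactSupport hc
  refine ((hasDerivAt_integral_of_dominated_loc_of_deriv_le
    (F := fun z ζ => m ζ / (ζ - z)) (F' := fun z ζ => m ζ / (ζ - z) ^ 2)
    (bound := fun ζ => ‖m ζ‖ / (r - s) ^ 2) (μ := volume) hs ?_ ?_ ?_ ?_ ?_ ?_).2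
    ).differentiableAt.differentiableWithinAt
  · refine Eventually.of_forall fun z => Measurable.aestronglyMeasurable ?_
    have := hm.measurable
    fun_prop
  · refine Integrable.mono' (hmi.norm.div_const (r - s)) (Measurable.aestronglyMeasurable ?_)
      (ae_of_all _ fun ζ => ?_)
    · have := hm.measurable
      fun_prop
    · by_cases h : m ζ = 0
      · simp [h]
      · rw [norm_div]
        have hrs : 0 < r - s := by linarith
        gcongr
        exact hsep ζ z₀ h (mem_of_mem_nhds hs)
  · have := hm.measurable
    exact Measurable.aestronglyMeasurable (by fun_prop)
  · refine ae_of_all _ fun ζ z hz => ?_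
    by_cases h : m ζ = 0
    · simp [h]
    · rw [norm_div, norm_pow]
      have hrs : 0 < r - s := by linarith
      gcongr
      exact hsep ζ z h hz
  · exact hmi.norm.div_const _
  · refine ae_of_all _ fun ζ z hz => ?_
    by_cases h : m ζ = 0
    · simpa [h] using hasDerivAt_const z (0 : ℂ)
    · have hne : ζ - z ≠ 0 := by
        intro h0
        have := hsep ζ z h hz
        rw [h0, norm_zero] at this
        linarith
      have := ((hasDerivAt_id z).const_sub ζ).inv hne
      have := this.const_mul (m ζ)
      refine (this.congr_deriv ?_).congr_of_eventuallyEq ?_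
      · simp [div_eq_mul_inv]
      · exact Eventually.of_forall fun w => by simp [div_eq_mul_inv]

/-- Multiplying by a bump function supported in an open set where `g` is `C¹`. -/
lemma contDiff_cbump_mul (χ : ContDiffBump (0 : ℂ)) {g : ℂ → ℂ} {r : ℝ} (hχ : χ.rOut < r)
    (hg : ContDiffOn ℝ 1 g (ball 0 r)) : ContDiff ℝ 1 (fun z => cbump χ z * g z) := by
  rw [contDiff_iff_contDiffAt]
  intro z
  by_cases hz : z ∈ ball (0 : ℂ) r
  · exact (contDiff_cbump χ (n := 1)).contDiffAt.mul (hg.contDiffAt (isOpen_ball.mem_nhds hz))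
  · have : z ∉ tsupport (cbump χ) := by
      rw [tsupport_cbump]
      exact fun h => hz (closedBall_subset_ball hχ h)
    refine (contDiffAt_const (c := (0 : ℂ))).congr_of_eventuallyEq ?_
    filter_upwards [(notMem_tsupport_iff_eventuallyEq.1 this)] with w hw
    simp [hw]

/-- Interior values of a holomorphic function are controlled by its `L¹` norm. -/
lemma exists_norm_le_lintegral {r : ℝ} (hr : 0 < r) : ∃ K : ℝ, 0 < K ∧ ∀ Ψ : ℂ → ℂ,
    DifferentiableOn ℂ Ψ (ball 0 r) → ∀ z ∈ ball (0 : ℂ) (r / 4),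
      ‖Ψ z‖ₑ ≤ ENNReal.ofReal K * ∫⁻ w in ball (0 : ℂ) r, ‖Ψ w‖ₑ := by
  let χ : ContDiffBump (0 : ℂ) := ⟨r / 2, 3 * r / 4, by positivity, by linarith⟩
  have hX1 : ContDiff ℝ 1 (cbump χ) := contDiff_cbump χ (n := 1)
  have hXc := hasCompactSupport_cbump χ
  have hdXc : HasCompactSupport (dbar (cbump χ)) :=
    hXc.of_isClosed_subset (isClosed_tsupport _) (tsupport_dbar_subset _)
  obtain ⟨D, hD⟩ := hdXc.exists_bound_of_continuous (continuous_dbar hX1)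
  have hD0 : 0 ≤ D := (norm_nonneg _).trans (hD 0)
  refine ⟨(D + 1) * (4 / r) / Real.pi, by positivity, fun Ψ hΨ z hz => ?_⟩
  have hΨ1 : ContDiffOn ℝ 1 Ψ (ball 0 r) :=
    (hΨ.contDiffOn isOpen_ball).restrict_scalars ℝ
  have hcd := contDiff_cbump_mul χ (show χ.rOut < r by change 3 * r / 4 < r; linarith) hΨ1
  have hcp := integral_dbar_add_div hcd hXc.mul_right z
  have hdb : ∀ ζ, dbar (fun z => cbump χ z * Ψ z) ζ = dbar (cbump χ) ζ * Ψ ζ := by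
    intro ζ
    by_cases hζ : ζ ∈ ball (0 : ℂ) r
    · have hd := hΨ.differentiableAt (isOpen_ball.mem_nhds hζ)
      rw [dbar_mul (hX1.differentiable one_ne_zero ζ) (hd.restrictScalars ℝ),
        dbar_of_differentiableAt hd]
      ring
    · have : ζ ∉ tsupport (cbump χ) := by
        rw [tsupport_cbump]
        exact fun h => hζ (closedBall_subset_ball (by change 3 * r / 4 < r; linarith) h)
      rw [dbar_eq_zero_of_notMem this, dbar_eq_zero_of_notMem
        (fun h => this (tsupport_mul_subset_left h)), zero_mul]
  have hz1 : cbump χ z = 1 := by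
    have : z ∈ closedBall (0 : ℂ) χ.rIn := by
      rw [mem_closedBall_zero_iff]
      rw [mem_ball_zero_iff] at hz
      change ‖z‖ ≤ r / 2
      linarith
    rw [cbump, χ.one_of_mem_closedBall this, Complex.ofReal_one]
  simp only [hdb, integral_add_div_eq (fun ζ => dbar (cbump χ) ζ * Ψ ζ), hz1, one_mul] at hcp
  have hpi : Ψ z = (-Real.pi : ℂ)⁻¹ * ∫ ζ, dbar (cbump χ) ζ * Ψ ζ / (ζ - z) := by
    rw [hcp, ← mul_assoc, inv_mul_cancel₀ (by simp [Real.pi_ne_zero]), one_mul]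
  have hpt : ∀ ζ, ‖dbar (cbump χ) ζ * Ψ ζ / (ζ - z)‖ₑ ≤
      (ball (0 : ℂ) r).indicator (fun ζ => ENNReal.ofReal ((D + 1) * (4 / r)) * ‖Ψ ζ‖ₑ) ζ := by
    intro ζ
    by_cases hζ : dbar (cbump χ) ζ = 0
    · simp [hζ]
    have hmem : ζ ∈ closedBall (0 : ℂ) χ.rOut := by
      rw [← tsupport_cbump]
      by_contra h
      exact hζ (dbar_eq_zero_of_notMem h)
    have hin : r / 2 ≤ ‖ζ‖ := by
      by_contra h
      push Not at h
      have he : cbump χ =ᶠ[𝓝 ζ] fun _ => 1 := by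
        filter_upwards [isOpen_ball.mem_nhds (show ζ ∈ ball (0 : ℂ) (r / 2) by simpa using h)]
          with w hw
        rw [cbump, χ.one_of_mem_closedBall (ball_subset_closedBall hw), Complex.ofReal_one]
      exact hζ (by simp [dbar, he.fderiv_eq])
    rw [indicator_of_mem (closedBall_subset_ball (by change 3 * r / 4 < r; linarith) hmem),
      ← ofReal_norm, ← ofReal_norm, ← ENNReal.ofReal_mul (by positivity)]
    apply ENNReal.ofReal_le_ofReal
    rw [norm_div, norm_mul]
    have hzn : ‖z‖ < r / 4 := by simpa using hz
    have h4 : r / 4 ≤ ‖ζ - z‖ := by have := norm_sub_norm_le ζ z; linarith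
    calc ‖dbar (cbump χ) ζ‖ * ‖Ψ ζ‖ / ‖ζ - z‖ ≤ (D + 1) * ‖Ψ ζ‖ / (r / 4) := by
          gcongr
          linarith [hD ζ]
      _ = _ := by field_simp
  have hfin := (enorm_integral_le_lintegral_enorm
    (μ := (volume : Measure ℂ)) fun ζ => dbar (cbump χ) ζ * Ψ ζ / (ζ - z)).trans (lintegral_mono hpt)
  rw [lintegral_indicator measurableSet_ball, lintegral_const_mul' _ _ ENNReal.ofReal_ne_top] at hfin
  rw [hpi, enorm_mul]
  have hpe : ‖(-Real.pi : ℂ)⁻¹‖ₑ = ENNReal.ofReal (1 / Real.pi) := by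
    rw [← ofReal_norm]
    simp [abs_of_pos Real.pi_pos]
  rw [hpe]
  refine (mul_le_mul_right hfin _).trans (le_of_eq ?_)
  rw [← mul_assoc, ← ENNReal.ofReal_mul (by positivity)]
  congr 2
  field_simp

lemma norm_pow_sub_pow_le {a b : ℂ} {M : ℝ} (hM : 1 ≤ M) (ha : ‖a‖ ≤ M) (hb : ‖b‖ ≤ M) (n : ℕ) :
    ‖a ^ n - b ^ n‖ ≤ n * M ^ n * ‖a - b‖ := by
  induction n with
  | zero => simp
  | succ n ih =>
    have e : a ^ (n + 1) - b ^ (n + 1) = a * (a ^ n - b ^ n) + (a - b) * b ^ n := by ring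
    rw [e]
    refine (norm_add_le _ _).trans ?_
    rw [norm_mul, norm_mul, norm_pow]
    have h1 : ‖b‖ ^ n ≤ M ^ (n + 1) :=
      (pow_le_pow_left₀ (norm_nonneg _) hb n).trans (pow_le_pow_right₀ hM (Nat.le_succ n))
    calc ‖a‖ * ‖a ^ n - b ^ n‖ + ‖a - b‖ * ‖b‖ ^ n
        ≤ M * (n * M ^ n * ‖a - b‖) + ‖a - b‖ * M ^ (n + 1) := by gcongr
      _ = _ := by push_cast; ring

/-- If consecutive powers of `a` and `b` are close, so are `a` and `b`. -/
lemma norm_sub_pow_le_of_pow_sub {a b : ℂ} {M ε : ℝ} (j : ℕ) (ha : ‖a‖ ≤ M) (hb : ‖b‖ ≤ M)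
    (h1 : ‖a ^ j - b ^ j‖ ≤ ε) (h2 : ‖a ^ (j + 1) - b ^ (j + 1)‖ ≤ ε) :
    ‖a - b‖ ^ (j + 1) ≤ 2 ^ j * ((1 + M) * ε) := by
  have hε : 0 ≤ ε := (norm_nonneg _).trans h1
  have key : ∀ a b : ℂ, ‖a‖ ≤ M → ‖a ^ j - b ^ j‖ ≤ ε → ‖a ^ (j + 1) - b ^ (j + 1)‖ ≤ ε →
      ‖b‖ ^ j * ‖a - b‖ ≤ (1 + M) * ε := by
    intro a b ha h1 h2
    have e : b ^ j * (a - b) = (a ^ (j + 1) - b ^ (j + 1)) - a * (a ^ j - b ^ j) := by ring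
    rw [← norm_pow, ← norm_mul, e]
    refine (norm_sub_le _ _).trans ?_
    rw [norm_mul]
    nlinarith [mul_le_mul ha h1 (norm_nonneg _) ((norm_nonneg _).trans ha)]
  have hk1 := key a b ha h1 h2
  have hk2 := key b a hb (by rwa [norm_sub_rev]) (by rwa [norm_sub_rev])
  rw [norm_sub_rev] at hk2
  rw [pow_succ]
  rcases le_total ‖a‖ ‖b‖ with h | h
  · have : ‖a - b‖ ≤ 2 * ‖b‖ := (norm_sub_le _ _).trans (by linarith)
    calc ‖a - b‖ ^ j * ‖a - b‖ ≤ (2 * ‖b‖) ^ j * ‖a - b‖ := by gcongr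
      _ = 2 ^ j * (‖b‖ ^ j * ‖a - b‖) := by ring
      _ ≤ _ := by gcongr
  · have : ‖a - b‖ ≤ 2 * ‖a‖ := (norm_sub_le _ _).trans (by linarith)
    calc ‖a - b‖ ^ j * ‖a - b‖ ≤ (2 * ‖a‖) ^ j * ‖a - b‖ := by gcongr
      _ = 2 ^ j * (‖a‖ ^ j * ‖a - b‖) := by ring
      _ ≤ _ := by gcongr

lemma le_of_pow_le_self {x C : ℝ} {n : ℕ} (hn : n ≠ 0) (hC : 1 ≤ C) (h : x ^ n ≤ C) : x ≤ C := by
  by_contra hx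
  push Not at hx
  linarith [le_self_pow₀ (hC.trans hx.le) hn]

section Pointwise

variable {g h : ℂ} {A B τ δ : ℝ} {j : ℕ}

lemma norm_pow_le_regularised (hδ : 0 < δ) (hΦ : ‖h ^ j - g ^ (j + 1)‖ ≤ B * δ ^ (j + 1)) :
    ‖h‖ ^ (2 * j) ≤ 2 * (1 + B ^ 2) * (‖g‖ ^ 2 + δ ^ 2) ^ (j + 1) := by
  have h1 : ‖h‖ ^ j ≤ ‖g‖ ^ (j + 1) + B * δ ^ (j + 1) := by
    rw [← norm_pow, ← norm_pow]
    have := norm_sub_norm_le (h ^ j) (g ^ (j + 1))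
    linarith
  have h2 : (‖g‖ ^ (j + 1)) ^ 2 ≤ (‖g‖ ^ 2 + δ ^ 2) ^ (j + 1) := by
    rw [← pow_mul, mul_comm, pow_mul]
    gcongr
    nlinarith
  have h3 : (δ ^ (j + 1)) ^ 2 ≤ (‖g‖ ^ 2 + δ ^ 2) ^ (j + 1) := by
    rw [← pow_mul, mul_comm, pow_mul]
    gcongr
    nlinarith [norm_nonneg g]
  calc ‖h‖ ^ (2 * j) = (‖h‖ ^ j) ^ 2 := by rw [← pow_mul, mul_comm]
    _ ≤ (‖g‖ ^ (j + 1) + B * δ ^ (j + 1)) ^ 2 := by gcongr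
    _ ≤ 2 * ((‖g‖ ^ (j + 1)) ^ 2 + B ^ 2 * (δ ^ (j + 1)) ^ 2) := by
        nlinarith [sq_nonneg (‖g‖ ^ (j + 1) - B * δ ^ (j + 1))]
    _ ≤ 2 * ((‖g‖ ^ 2 + δ ^ 2) ^ (j + 1) + B ^ 2 * (‖g‖ ^ 2 + δ ^ 2) ^ (j + 1)) := by gcongr
    _ = _ := by ring

lemma norm_quotient_le (hj : 1 ≤ j) (hA : ‖g‖ ≤ A) (hδ : 0 < δ) (hδ1 : δ ≤ 1)
    (hΦ : ‖h ^ j - g ^ (j + 1)‖ ≤ B * δ ^ (j + 1)) :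
    ‖h‖ * ‖g‖ / (‖g‖ ^ 2 + δ ^ 2) ≤ 2 * (1 + B ^ 2) * (A ^ 2 + 1) := by
  have hw : 0 < ‖g‖ ^ 2 + δ ^ 2 := by positivity
  have h0 := norm_pow_le_regularised hδ hΦ
  apply le_of_pow_le_self (n := 2 * j) (by lia) (by nlinarith [sq_nonneg B, sq_nonneg A])
  rw [div_pow, div_le_iff₀ (by positivity), mul_pow]
  have hg : ‖g‖ ^ (2 * j) ≤ (‖g‖ ^ 2 + δ ^ 2) ^ j := by
    rw [pow_mul]; gcongr; nlinarith
  have hwA : ‖g‖ ^ 2 + δ ^ 2 ≤ A ^ 2 + 1 := by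
    have : ‖g‖ ^ 2 ≤ A ^ 2 := by gcongr
    nlinarith
  calc ‖h‖ ^ (2 * j) * ‖g‖ ^ (2 * j)
      ≤ (2 * (1 + B ^ 2) * (‖g‖ ^ 2 + δ ^ 2) ^ (j + 1)) * (‖g‖ ^ 2 + δ ^ 2) ^ j := by gcongr
    _ = 2 * (1 + B ^ 2) * (‖g‖ ^ 2 + δ ^ 2) * (‖g‖ ^ 2 + δ ^ 2) ^ (2 * j) := by ring
    _ ≤ _ := by gcongr

lemma norm_mul_div_le (hj : 1 ≤ j) (hτ : 0 < τ) (hδτ : δ = τ ^ (2 * j))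
    (hΦ : ‖h ^ j - g ^ (j + 1)‖ ≤ B * δ ^ (j + 1)) :
    ‖h‖ * δ / (‖g‖ ^ 2 + δ ^ 2) ≤ 2 * (1 + B ^ 2) * τ ^ 2 := by
  have hδ : 0 < δ := by rw [hδτ]; positivity
  have hw : 0 < ‖g‖ ^ 2 + δ ^ 2 := by positivity
  have h0 := norm_pow_le_regularised hδ hΦ
  have hmain : ‖h‖ * δ / (‖g‖ ^ 2 + δ ^ 2) / τ ^ 2 ≤ 2 * (1 + B ^ 2) := by
    apply le_of_pow_le_self (n := 2 * j) (by lia) (by nlinarith [sq_nonneg B])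
    rw [div_pow, div_pow, mul_pow, div_div, div_le_iff₀ (by positivity)]
    have hτδ : (τ ^ 2) ^ (2 * j) = δ ^ 2 := by rw [hδτ]; ring
    have hdw : δ ^ (2 * j) ≤ (‖g‖ ^ 2 + δ ^ 2) ^ (j - 1) * δ ^ 2 := by
      obtain ⟨i, rfl⟩ := Nat.exists_eq_add_of_le' hj
      rw [Nat.add_sub_cancel, mul_add, pow_add, pow_mul]
      gcongr
      nlinarith [norm_nonneg g]
    have he : (‖g‖ ^ 2 + δ ^ 2) ^ (2 * j) = (‖g‖ ^ 2 + δ ^ 2) ^ (j + 1) * (‖g‖ ^ 2 + δ ^ 2) ^ (j - 1) := by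
      rw [← pow_add]; congr 1; lia
    rw [hτδ, he]
    calc ‖h‖ ^ (2 * j) * δ ^ (2 * j) ≤ (2 * (1 + B ^ 2) * (‖g‖ ^ 2 + δ ^ 2) ^ (j + 1)) *
          ((‖g‖ ^ 2 + δ ^ 2) ^ (j - 1) * δ ^ 2) := by gcongr
      _ = _ := by ring
  rwa [div_le_iff₀ (by positivity)] at hmain

lemma norm_quotient_pow_sub_le (hB : 0 ≤ B) (hδ : 0 < δ)
    (hΦ : ‖h ^ j - g ^ (j + 1)‖ ≤ B * δ ^ (j + 1)) :
    ‖(h * conj g / ((‖g‖ ^ 2 + δ ^ 2 : ℝ) : ℂ)) ^ j - g‖ ≤ (B + j) * δ := by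
  set w : ℝ := ‖g‖ ^ 2 + δ ^ 2 with hw
  have hw0 : 0 < w := by positivity
  have hwc : (w : ℂ) ≠ 0 := by exact_mod_cast hw0.ne'
  have hgg : g * conj g = ((‖g‖ ^ 2 : ℝ) : ℂ) := by rw [Complex.mul_conj']; push_cast; ring
  have e : (h * conj g / (w : ℂ)) ^ j - g = (h ^ j - g ^ (j + 1)) * (conj g / w) ^ j +
      g * (((‖g‖ ^ 2 / w : ℝ) : ℂ) ^ j - 1) := by
    have : ((‖g‖ ^ 2 / w : ℝ) : ℂ) = g * (conj g / w) := by
      rw [Complex.ofReal_div, ← hgg]; ring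
    rw [this, mul_div_assoc, mul_pow, mul_pow]; ring
  have hq : δ * (‖g‖ / w) ≤ 1 := by
    rw [← mul_div_assoc, div_le_one hw0]
    nlinarith [sq_nonneg (‖g‖ - δ), sq_nonneg ‖g‖, sq_nonneg δ]
  rw [e]
  refine (norm_add_le _ _).trans ?_
  rw [norm_mul, norm_mul, norm_pow, norm_div, RCLike.norm_conj, Complex.norm_real,
    Real.norm_of_nonneg hw0.le]
  have t1 : ‖h ^ j - g ^ (j + 1)‖ * (‖g‖ / w) ^ j ≤ B * δ := by
    calc _ ≤ B * δ ^ (j + 1) * (‖g‖ / w) ^ j := by gcongr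
      _ = B * δ * (δ * (‖g‖ / w)) ^ j := by ring
      _ ≤ B * δ * 1 := by
        gcongr
        exact pow_le_one₀ (by positivity) hq
      _ = _ := by ring
  have t2 : ‖g‖ * ‖((‖g‖ ^ 2 / w : ℝ) : ℂ) ^ j - 1‖ ≤ j * δ := by
    have h1 := norm_pow_sub_pow_le (a := ((‖g‖ ^ 2 / w : ℝ) : ℂ)) (b := 1) le_rfl (by
      rw [Complex.norm_real, Real.norm_of_nonneg (by positivity), div_le_one hw0]; nlinarith)
      (by simp) j
    have h2 : ‖((‖g‖ ^ 2 / w : ℝ) : ℂ) - 1‖ = δ ^ 2 / w := by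
      have : ((‖g‖ ^ 2 / w : ℝ) : ℂ) - 1 = ((-(δ ^ 2 / w) : ℝ) : ℂ) := by
        rw [← Complex.ofReal_one, ← Complex.ofReal_sub]
        congr 1
        field_simp
        rw [hw]; ring
      rw [this, Complex.norm_real, norm_neg, Real.norm_of_nonneg (by positivity)]
    rw [h2, one_pow, one_pow, mul_one] at h1
    calc _ ≤ ‖g‖ * (j * (δ ^ 2 / w)) := by gcongr
      _ = j * δ * (δ * (‖g‖ / w)) := by ring
      _ ≤ j * δ * 1 := by gcongr
      _ = _ := by ring
  linarith

lemma norm_quotient_pow_succ_sub_le (hj : 1 ≤ j) (hA : ‖g‖ ≤ A) (hB : 0 ≤ B) (hτ : 0 < τ)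
    (hτ1 : τ ≤ 1) (hδτ : δ = τ ^ (2 * j)) (hΦ : ‖h ^ j - g ^ (j + 1)‖ ≤ B * δ ^ (j + 1)) :
    ‖(h * conj g / ((‖g‖ ^ 2 + δ ^ 2 : ℝ) : ℂ)) ^ (j + 1) - h‖ ≤
      2 * (1 + B ^ 2) * (A ^ 2 + 1) * (B + j + 1) * δ := by
  have hδ : 0 < δ := by rw [hδτ]; positivity
  have hδ1 : δ ≤ 1 := by rw [hδτ]; exact pow_le_one₀ hτ.le hτ1
  have b1 := norm_quotient_le hj hA hδ hδ1 hΦ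
  have b2 := norm_mul_div_le hj hτ hδτ hΦ
  have b3 := norm_quotient_pow_sub_le hB hδ hΦ
  set w : ℝ := ‖g‖ ^ 2 + δ ^ 2 with hw
  have hw0 : 0 < w := by positivity
  have hwc : (w : ℂ) ≠ 0 := by exact_mod_cast hw0.ne'
  set u := h * conj g / (w : ℂ) with hu
  have hun : ‖u‖ ≤ 2 * (1 + B ^ 2) * (A ^ 2 + 1) := by
    rw [hu, norm_div, norm_mul, RCLike.norm_conj, Complex.norm_real, Real.norm_of_nonneg hw0.le]
    exact b1
  have hgg : g * conj g = ((‖g‖ ^ 2 : ℝ) : ℂ) := by rw [Complex.mul_conj']; push_cast; ring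
  have e : u ^ (j + 1) - h = u * (u ^ j - g) - h * ((δ : ℂ) ^ 2 / w) := by
    have : u * g = h - h * ((δ : ℂ) ^ 2 / w) := by
      rw [hu]
      field_simp
      rw [mul_assoc, mul_comm (conj g), hgg, hw]
      push_cast; ring
    linear_combination this
  clear_value u
  rw [e]
  refine (norm_sub_le _ _).trans ?_
  rw [norm_mul, norm_mul, norm_div, norm_pow, Complex.norm_real, Complex.norm_real,
    Real.norm_of_nonneg hw0.le, Real.norm_of_nonneg hδ.le]
  have hA1 : 1 ≤ A ^ 2 + 1 := by nlinarith
  have hτ2 : τ ^ 2 ≤ 1 := pow_le_one₀ hτ.le hτ1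
  calc ‖u‖ * ‖u ^ j - g‖ + ‖h‖ * (δ ^ 2 / w)
      = ‖u‖ * ‖u ^ j - g‖ + ‖h‖ * δ / w * δ := by ring
    _ ≤ 2 * (1 + B ^ 2) * (A ^ 2 + 1) * ((B + j) * δ) + 2 * (1 + B ^ 2) * 1 * δ := by
        gcongr
        exact b2.trans (by gcongr)
    _ ≤ 2 * (1 + B ^ 2) * (A ^ 2 + 1) * ((B + j) * δ) + 2 * (1 + B ^ 2) * (A ^ 2 + 1) * δ := by
        gcongr
    _ = _ := by ring

end Pointwise

lemma integrable_comp_add_div {m : ℂ → ℂ} (hm : Continuous m) (hc : HasCompactSupport m) (z : ℂ) :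
    Integrable (fun w => m (z + w) / w) := by
  obtain ⟨D, hD⟩ := hc.exists_bound_of_continuous hm
  have hD0 : 0 ≤ D := (norm_nonneg _).trans (hD 0)
  obtain ⟨R, hR⟩ := (hc.comp_homeomorph (Homeomorph.addLeft z)).isCompact.isBounded.subset_ball
    (0 : ℂ)
  refine ⟨Measurable.aestronglyMeasurable (by have := hm.measurable; fun_prop), ?_⟩
  have hpt : ∀ w, ‖m (z + w) / w‖ₑ ≤
      (ball (0 : ℂ) R).indicator (fun w => ENNReal.ofReal D * ‖w‖ₑ⁻¹) w := by
    intro w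
    by_cases hw : w ∈ ball (0 : ℂ) R
    · rw [indicator_of_mem hw]
      by_cases h0 : w = 0
      · simp [h0]
      rw [div_eq_mul_inv, enorm_mul, enorm_inv h0]
      gcongr
      rw [← ofReal_norm]
      exact ENNReal.ofReal_le_ofReal (hD _)
    · have := image_eq_zero_of_notMem_tsupport (fun h => hw (hR h))
      simp only [Function.comp_apply, Homeomorph.coe_addLeft] at this
      simp [this]
  refine (lintegral_mono hpt).trans_lt ?_
  rw [lintegral_indicator measurableSet_ball, lintegral_const_mul' _ _ ENNReal.ofReal_ne_top]
  exact ENNReal.mul_lt_top ENNReal.ofReal_lt_top (lintegral_ball_inv_norm_lt_top R)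

/-- The cutoff function used to localise the `∂̄`-problem. -/
def cutoff : ContDiffBump (0 : ℂ) := ⟨1 / 8, 1 / 5, by norm_num, by norm_num⟩

lemma dbar_cutoff_eq_zero {ζ : ℂ} (h : ζ ∈ ball (0 : ℂ) (1 / 8)) : dbar (cbump cutoff) ζ = 0 := by
  have he : cbump cutoff =ᶠ[𝓝 ζ] fun _ => 1 := by
    filter_upwards [isOpen_ball.mem_nhds h] with w hw
    rw [cbump, cutoff.one_of_mem_closedBall (ball_subset_closedBall hw), Complex.ofReal_one]
  simp [dbar, he.fderiv_eq]

/-- Correcting an almost holomorphic function to a holomorphic one, with `L¹` control. -/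
lemma exists_holomorphic_correction : ∃ K : ℝ, 1 ≤ K ∧ ∀ u : ℂ → ℂ, ContDiff ℝ 1 u →
    ∀ c : ℝ, (∀ z ∈ closedBall (0 : ℂ) (1 / 5), ‖u z‖ ≤ c) →
    ∀ ε : ℝ, ∫ z, ‖cbump cutoff z * dbar u z‖ ≤ ε →
    ∃ F : ℂ → ℂ, DifferentiableOn ℂ F (ball 0 (1 / 8)) ∧
      (∀ z ∈ ball (0 : ℂ) (1 / 16), ‖F z‖ ≤ K * c) ∧
      ∫⁻ z in ball (0 : ℂ) (1 / 8), ‖u z - F z‖ₑ ≤ ENNReal.ofReal (K * ε) := by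
  obtain ⟨K₁, hK₁, hcauchy⟩ := exists_lintegral_cauchy_le (1 / 4)
  set X := cbump cutoff with hX
  have hX1 : ContDiff ℝ 1 X := contDiff_cbump cutoff (n := 1)
  have hXc : HasCompactSupport X := hasCompactSupport_cbump cutoff
  have hXs : tsupport X = closedBall 0 (1 / 5) := tsupport_cbump cutoff
  have hdX := continuous_dbar hX1
  have hdXc : HasCompactSupport (dbar X) :=
    hXc.of_isClosed_subset (isClosed_tsupport _) (tsupport_dbar_subset _)
  set I := ∫ z, ‖dbar X z‖ with hI
  have hI0 : 0 ≤ I := integral_nonneg fun _ => norm_nonneg _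
  have hpi := Real.pi_pos
  refine ⟨1 + 1 / Real.pi * 16 * I + 1 / Real.pi * K₁, by
    have : 0 ≤ 1 / Real.pi * 16 * I + 1 / Real.pi * K₁ := by positivity
    linarith, fun u hu c hc ε hε => ?_⟩
  have hc0 : 0 ≤ c := (norm_nonneg _).trans (hc 0 (by simp))
  have hε0 : 0 ≤ ε := (integral_nonneg fun _ => norm_nonneg _).trans hε
  set m₁ : ℂ → ℂ := fun z => X z * dbar u z with hm₁
  set m₂ : ℂ → ℂ := fun z => dbar X z * u z with hm₂
  have cm₁ : Continuous m₁ := hX1.continuous.mul (continuous_dbar hu)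
  have cm₂ : Continuous m₂ := hdX.mul hu.continuous
  have sm₁ : HasCompactSupport m₁ := hXc.mul_right
  have sm₂ : HasCompactSupport m₂ := hdXc.mul_right
  have hpiC : ‖(-Real.pi : ℂ)⁻¹‖ = 1 / Real.pi := by simp [abs_of_pos hpi]
  have hpie : ‖(-Real.pi : ℂ)⁻¹‖ₑ = ENNReal.ofReal (1 / Real.pi) := by
    rw [← ofReal_norm, hpiC]
  refine ⟨fun z => (-Real.pi : ℂ)⁻¹ * ∫ w, m₂ (z + w) / w, ?_, ?_, ?_⟩
  · refine (differentiableOn_cauchy cm₂ sm₂ fun z hz => ?_).const_mul _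
    simp [hm₂, hX, dbar_cutoff_eq_zero hz]
  · intro z hz
    rw [mem_ball_zero_iff] at hz
    rw [norm_mul, hpiC, integral_add_div_eq]
    have hb : ‖∫ ζ, m₂ ζ / (ζ - z)‖ ≤ ∫ ζ, 16 * c * ‖dbar X ζ‖ := by
      refine norm_integral_le_of_norm_le
        ((hdX.norm.integrable_of_hasCompactSupport hdXc.norm).const_mul _)
        (ae_of_all _ fun ζ => ?_)
      by_cases h0 : dbar X ζ = 0
      · simp [hm₂, h0]
      have h1 : ζ ∈ closedBall (0 : ℂ) (1 / 5) := by
        rw [← hXs]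
        by_contra h
        exact h0 (dbar_eq_zero_of_notMem h)
      have h2 : 1 / 8 ≤ ‖ζ‖ := by
        by_contra h
        exact h0 (dbar_cutoff_eq_zero (by simpa using h))
      have h3 : 1 / 16 ≤ ‖ζ - z‖ := by have := norm_sub_norm_le ζ z; linarith
      rw [norm_div, norm_mul]
      calc ‖dbar X ζ‖ * ‖u ζ‖ / ‖ζ - z‖ ≤ ‖dbar X ζ‖ * c / (1 / 16) := by
            gcongr
            exact hc ζ h1
        _ = _ := by ring
    rw [integral_const_mul] at hb
    calc 1 / Real.pi * ‖∫ ζ, m₂ ζ / (ζ - z)‖ ≤ 1 / Real.pi * (16 * c * I) := by gcongr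
      _ = (1 / Real.pi * 16 * I) * c := by ring
      _ ≤ _ := by
        gcongr
        have : 0 ≤ 1 / Real.pi * K₁ := by positivity
        linarith
  · have hdiff : ∀ z ∈ ball (0 : ℂ) (1 / 8), ‖u z - (-Real.pi : ℂ)⁻¹ * ∫ w, m₂ (z + w) / w‖ₑ =
        ENNReal.ofReal (1 / Real.pi) * ‖∫ w, m₁ (z + w) / w‖ₑ := by
      intro z hz
      have hXz : X z = 1 := by
        rw [hX, cbump, cutoff.one_of_mem_closedBall (ball_subset_closedBall hz),
          Complex.ofReal_one]
      have hcp := integral_dbar_add_div (hX1.mul hu) hXc.mul_right z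
      have hsplit : ∀ w, dbar (fun z => X z * u z) (z + w) / w =
          m₂ (z + w) / w + m₁ (z + w) / w := fun w => by
        rw [dbar_mul (hX1.differentiable one_ne_zero _) (hu.differentiable one_ne_zero _), add_div]
      simp only [hsplit, hXz, one_mul] at hcp
      rw [integral_add (integrable_comp_add_div cm₂ sm₂ z) (integrable_comp_add_div cm₁ sm₁ z)]
        at hcp
      rw [← hpie, ← enorm_mul]
      congr 1
      have hpi0 : (-Real.pi : ℂ) ≠ 0 := by simp [Real.pi_ne_zero]
      rw [sub_eq_iff_eq_add, ← mul_add, add_comm, hcp, ← mul_assoc, inv_mul_cancel₀ hpi0, one_mul]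
    rw [setLIntegral_congr_fun measurableSet_ball hdiff,
      lintegral_const_mul' _ _ ENNReal.ofReal_ne_top]
    have hb := hcauchy m₁ cm₁ ((tsupport_mul_subset_left.trans hXs.le).trans
      (closedBall_subset_ball (by norm_num)))
    have hm1 : ∫⁻ z, ‖m₁ z‖ₑ ≤ ENNReal.ofReal ε := by
      rw [← ofReal_integral_norm_eq_lintegral_enorm (cm₁.integrable_of_hasCompactSupport sm₁)]
      exact ENNReal.ofReal_le_ofReal hε
    calc ENNReal.ofReal (1 / Real.pi) * ∫⁻ z in ball (0 : ℂ) (1 / 8), ‖∫ w, m₁ (z + w) / w‖ₑ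
        ≤ ENNReal.ofReal (1 / Real.pi) * (ENNReal.ofReal K₁ * ENNReal.ofReal ε) := by
          refine mul_le_mul_right ?_ _
          refine (lintegral_mono_set (ball_subset_ball (by norm_num))).trans (hb.trans ?_)
          exact mul_le_mul_right hm1 _
      _ = ENNReal.ofReal ((1 / Real.pi * K₁) * ε) := by
          rw [← ENNReal.ofReal_mul hK₁.le, ← ENNReal.ofReal_mul (by positivity)]
          congr 1; ring
      _ ≤ _ := by
          apply ENNReal.ofReal_le_ofReal
          gcongr
          have : 0 ≤ 1 / Real.pi * 16 * I := by positivity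
          linarith

lemma integral_norm_cbump_mul_dbar_le (j : ℕ) (hj : 1 ≤ j) (A B : ℝ) :
    ∃ C : ℝ, 0 ≤ C ∧ ∀ G H : ℂ → ℂ, Differentiable ℂ G → Differentiable ℂ H →
      (∀ z ∈ closedBall (0 : ℂ) (1 / 5), ‖G z‖ ≤ A) → ∀ τ : ℝ, 0 < τ → τ ≤ 1 →
      (∀ z ∈ closedBall (0 : ℂ) (1 / 5),
        ‖H z ^ j - G z ^ (j + 1)‖ ≤ B * (τ ^ (2 * j)) ^ (j + 1)) →
      ∫ z, ‖cbump cutoff z *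
        dbar (fun z => H z * conj (G z) / regSq G (τ ^ (2 * j)) z) z‖ ≤ C * τ := by
  obtain ⟨C, hC, hbump⟩ := exists_integral_bump_mul_le cutoff A
  set I : ℝ := ∫ z, cutoff z with hI
  have hI0 : 0 ≤ I := integral_nonneg fun z => cutoff.nonneg
  have hcutint : Integrable (fun z => cutoff z) :=
    cutoff.continuous.integrable_of_hasCompactSupport cutoff.hasCompactSupport
  refine ⟨2 * (1 + B ^ 2) * (I + C * (1 + 2 * j)), by positivity, ?_⟩
  intro G H hG hH hA τ hτ hτ1 hΦ
  set δ := τ ^ (2 * j) with hδτ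
  have hδ : 0 < δ := by positivity
  have hδ1 : δ ≤ 1 := pow_le_one₀ hτ.le hτ1
  set q : ℂ → ℝ := fun z => ‖deriv G z‖ ^ 2 * δ ^ 2 / (‖G z‖ ^ 2 + δ ^ 2) ^ 2 with hq
  have hqc : Continuous q := by
    have h1 : Continuous (deriv G) := (hG.contDiff (n := 2)).continuous_deriv (by norm_num)
    have h2 := hG.continuous
    refine Continuous.div (by fun_prop) (by fun_prop) fun z => by positivity
  have hqint : Integrable (fun z => cutoff z * q z) :=
    (cutoff.continuous.mul hqc).integrable_of_hasCompactSupport cutoff.hasCompactSupport.mul_right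
  have hlog : Real.log (1 / δ) ≤ 2 * j / τ := by
    rw [hδτ, one_div, ← inv_pow, Real.log_pow]
    have := Real.log_le_sub_one_of_pos (inv_pos.2 hτ)
    push_cast
    rw [div_eq_mul_inv]
    gcongr
    linarith
  have hpt : ∀ z, ‖cbump cutoff z * dbar (fun z => H z * conj (G z) / regSq G δ z) z‖ ≤
      2 * (1 + B ^ 2) * τ ^ 2 * (cutoff z + cutoff z * q z) := by
    intro z
    have hw : 0 < ‖G z‖ ^ 2 + δ ^ 2 := by positivity
    have hχ : 0 ≤ cutoff z := cutoff.nonneg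
    by_cases hz : z ∈ closedBall (0 : ℂ) (1 / 5)
    · have b := norm_mul_div_le hj hτ hδτ (hΦ z hz)
      rw [norm_mul, dbar_mul_conj_div hG hδ hH, regSq_eq]
      have e : ‖H z * conj (deriv G z) * (δ : ℂ) ^ 2 / ((‖G z‖ ^ 2 + δ ^ 2 : ℝ) : ℂ) ^ 2‖ =
          (‖H z‖ * δ / (‖G z‖ ^ 2 + δ ^ 2)) * (‖deriv G z‖ * δ / (‖G z‖ ^ 2 + δ ^ 2)) := by
        rw [norm_div, norm_mul, norm_mul, RCLike.norm_conj, norm_pow, norm_pow, Complex.norm_real,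
          Complex.norm_real, Real.norm_of_nonneg hw.le, Real.norm_of_nonneg hδ.le]
        field_simp
      have e2 : q z = (‖deriv G z‖ * δ / (‖G z‖ ^ 2 + δ ^ 2)) ^ 2 := by
        simp only [hq]; rw [div_pow]; ring
      rw [e, e2, cbump, Complex.norm_real, Real.norm_of_nonneg hχ]
      set a := ‖deriv G z‖ * δ / (‖G z‖ ^ 2 + δ ^ 2)
      have ha : 0 ≤ a := by positivity
      have ha2 : a ≤ 1 + a ^ 2 := by nlinarith [sq_nonneg (a - 1)]
      calc cutoff z * (‖H z‖ * δ / (‖G z‖ ^ 2 + δ ^ 2) * a)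
          ≤ cutoff z * (2 * (1 + B ^ 2) * τ ^ 2 * (1 + a ^ 2)) := by gcongr
        _ = _ := by ring
    · have : cbump cutoff z = 0 := by
        apply image_eq_zero_of_notMem_tsupport
        rw [tsupport_cbump]; exact hz
      rw [this, zero_mul, norm_zero]
      have : 0 ≤ q z := by positivity
      positivity
  calc ∫ z, ‖cbump cutoff z * dbar (fun z => H z * conj (G z) / regSq G δ z) z‖
      ≤ ∫ z, 2 * (1 + B ^ 2) * τ ^ 2 * (cutoff z + cutoff z * q z) :=
        integral_mono_of_nonneg (Eventually.of_forall fun z => norm_nonneg _)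
          ((hcutint.add hqint).const_mul _) (Eventually.of_forall hpt)
    _ = 2 * (1 + B ^ 2) * τ ^ 2 * (I + ∫ z, cutoff z * q z) := by
        rw [integral_const_mul, integral_add hcutint hqint]
    _ ≤ 2 * (1 + B ^ 2) * τ ^ 2 * (I + C * (1 + 2 * j / τ)) := by
        gcongr
        refine (hbump G hG hA δ hδ hδ1).trans ?_
        gcongr
    _ = 2 * (1 + B ^ 2) * (τ * I + C * (τ + 2 * j)) * τ := by field_simp
    _ ≤ 2 * (1 + B ^ 2) * (1 * I + C * (1 + 2 * j)) * τ := by gcongr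
    _ = _ := by ring

lemma exists_norm_pow_sub_le {r : ℝ} (hr : 0 < r) : ∃ K : ℝ, 1 ≤ K ∧
    ∀ (n : ℕ) (M e ε : ℝ), 1 ≤ M → 0 ≤ e → 0 ≤ ε → ∀ F u P : ℂ → ℂ,
      DifferentiableOn ℂ F (ball 0 r) → DifferentiableOn ℂ P (ball 0 r) →
      (∀ z ∈ ball (0 : ℂ) r, ‖F z‖ ≤ M) → (∀ z ∈ ball (0 : ℂ) r, ‖u z‖ ≤ M) →
      (∀ z ∈ ball (0 : ℂ) r, ‖u z ^ n - P z‖ ≤ e) →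
      ∫⁻ z in ball (0 : ℂ) r, ‖u z - F z‖ₑ ≤ ENNReal.ofReal ε →
      ∀ z ∈ ball (0 : ℂ) (r / 4), ‖F z ^ n - P z‖ ≤ K * (n * M ^ n * ε + e) := by
  obtain ⟨K, hK, hmean⟩ := exists_norm_le_lintegral hr
  set V : ℝ := (volume (ball (0 : ℂ) r)).toReal with hV
  have hV0 : 0 ≤ V := ENNReal.toReal_nonneg
  have hVe : volume (ball (0 : ℂ) r) = ENNReal.ofReal V :=
    (ENNReal.ofReal_toReal measure_ball_lt_top.ne).symm
  refine ⟨1 + K * (1 + V), by nlinarith [mul_nonneg hK.le hV0], ?_⟩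
  intro n M e ε hM he hε F u P hF hP hFM huM hue hL z hz
  have hpt : ∀ w ∈ ball (0 : ℂ) r,
      ‖F w ^ n - P w‖ₑ ≤ ENNReal.ofReal (n * M ^ n) * ‖u w - F w‖ₑ + ENNReal.ofReal e := by
    intro w hw
    rw [← ofReal_norm, ← ofReal_norm, ← ENNReal.ofReal_mul (by positivity),
      ← ENNReal.ofReal_add (by positivity) he]
    apply ENNReal.ofReal_le_ofReal
    have h1 := norm_pow_sub_pow_le hM (hFM w hw) (huM w hw) n
    have h2 := norm_sub_le_norm_sub_add_norm_sub (F w ^ n) (u w ^ n) (P w)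
    rw [norm_sub_rev (F w)] at h1
    linarith [hue w hw]
  have h3 : ∫⁻ w in ball (0 : ℂ) r, ‖F w ^ n - P w‖ₑ ≤
      ENNReal.ofReal (n * M ^ n * ε + e * V) := by
    calc ∫⁻ w in ball (0 : ℂ) r, ‖F w ^ n - P w‖ₑ
        ≤ ∫⁻ w in ball (0 : ℂ) r,
          (ENNReal.ofReal (n * M ^ n) * ‖u w - F w‖ₑ + ENNReal.ofReal e) :=
          setLIntegral_mono' measurableSet_ball hpt
      _ = ENNReal.ofReal (n * M ^ n) * (∫⁻ w in ball (0 : ℂ) r, ‖u w - F w‖ₑ) +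
          ENNReal.ofReal e * ENNReal.ofReal V := by
          rw [lintegral_add_right _ measurable_const, lintegral_const_mul' _ _ ENNReal.ofReal_ne_top,
            lintegral_const, Measure.restrict_apply_univ, hVe]
      _ ≤ ENNReal.ofReal (n * M ^ n) * ENNReal.ofReal ε + ENNReal.ofReal e * ENNReal.ofReal V := by
          gcongr
      _ = _ := by
          rw [← ENNReal.ofReal_mul (by positivity), ← ENNReal.ofReal_mul he,
            ← ENNReal.ofReal_add (by positivity) (by positivity)]
  have h4 := hmean (fun w => F w ^ n - P w) ((hF.pow n).sub hP) z hz
  have h5 := h4.trans (mul_le_mul_right h3 (ENNReal.ofReal K))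
  rw [← ofReal_norm, ← ENNReal.ofReal_mul hK.le, ENNReal.ofReal_le_ofReal_iff (by positivity)] at h5
  have hp : 0 ≤ n * M ^ n * ε := by positivity
  have : K * (n * M ^ n * ε + e * V) ≤ K * ((1 + V) * (n * M ^ n * ε + e)) := by
    gcongr
    nlinarith [mul_nonneg hV0 hp]
  have h6 : 0 ≤ n * M ^ n * ε + e := by positivity
  nlinarith

lemma norm_pow_sub_pow_le_of_close {j : ℕ} {A η : ℝ} (hA : 1 ≤ A) (hη : 0 ≤ η) (hη1 : η ≤ 1)
    {g h f : ℂ} (hg : ‖g‖ ≤ A) (hh : ‖h‖ ≤ A) (h1 : ‖g - f ^ j‖ ≤ A * η)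
    (h2 : ‖h - f ^ (j + 1)‖ ≤ A * η) :
    ‖h ^ j - g ^ (j + 1)‖ ≤ (2 * j + 1) * (2 * A) ^ (j + 1) * A * η := by
  have hAη : A * η ≤ A := by nlinarith
  have hM : (1 : ℝ) ≤ 2 * A := by linarith
  have f1 : ‖f ^ j‖ ≤ 2 * A := by
    have := norm_le_norm_add_norm_sub g (f ^ j); linarith
  have f2 : ‖f ^ (j + 1)‖ ≤ 2 * A := by
    have := norm_le_norm_add_norm_sub h (f ^ (j + 1)); linarith
  have a1 := norm_pow_sub_pow_le hM (hg.trans (by linarith)) f1 (j + 1)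
  have a2 := norm_pow_sub_pow_le hM (hh.trans (by linarith)) f2 j
  have e : (f ^ (j + 1)) ^ j = (f ^ j) ^ (j + 1) := by rw [← pow_mul, ← pow_mul, mul_comm]
  have t : ‖h ^ j - g ^ (j + 1)‖ ≤ ‖h ^ j - (f ^ (j + 1)) ^ j‖ + ‖g ^ (j + 1) - (f ^ j) ^ (j + 1)‖ := by
    rw [e]
    have := norm_sub_le (h ^ j - (f ^ j) ^ (j + 1)) (g ^ (j + 1) - (f ^ j) ^ (j + 1))
    rwa [sub_sub_sub_cancel_right] at this
  have p : (2 * A) ^ j ≤ (2 * A) ^ (j + 1) := pow_le_pow_right₀ hM (Nat.le_succ j)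
  calc ‖h ^ j - g ^ (j + 1)‖
      ≤ j * (2 * A) ^ j * (A * η) + (j + 1 : ℕ) * (2 * A) ^ (j + 1) * (A * η) := by
        refine t.trans (add_le_add (a2.trans ?_) (a1.trans ?_)) <;> gcongr
    _ ≤ j * (2 * A) ^ (j + 1) * (A * η) + (j + 1 : ℕ) * (2 * A) ^ (j + 1) * (A * η) := by gcongr
    _ = _ := by push_cast; ring

lemma norm_le_of_norm_pow_le {a : ℂ} {C : ℝ} {n : ℕ} (hn : n ≠ 0) (hC : 1 ≤ C)
    (h : ‖a ^ n‖ ≤ C) : ‖a‖ ≤ C :=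
  le_of_pow_le_self hn hC (by rwa [← norm_pow])

set_option maxHeartbeats 1000000 in
/-- If `f ^ j` and `f ^ (j + 1)` are close on a real interval to holomorphic functions bounded on
a disc, then `f` is close on a smaller interval to a holomorphic function bounded on a smaller
disc. -/
lemma exists_holomorphic_approx_unit (j : ℕ) (hj : 1 ≤ j) (A : ℝ) (hA : 1 ≤ A) :
    ∃ C : ℝ, 1 ≤ C ∧ ∀ G H : ℂ → ℂ, Differentiable ℂ G → Differentiable ℂ H →
      (∀ z ∈ ball (0 : ℂ) 1, ‖G z‖ ≤ A) → (∀ z ∈ ball (0 : ℂ) 1, ‖H z‖ ≤ A) →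
      ∀ (f : ℝ → ℂ) (θ : ℝ), 0 < θ → θ ≤ 1 →
      (∀ t : ℝ, |t| < 1 → ‖G t - f t ^ j‖ ≤ A * θ ^ (4 * j * (j + 1) ^ 2)) →
      (∀ t : ℝ, |t| < 1 → ‖H t - f t ^ (j + 1)‖ ≤ A * θ ^ (4 * j * (j + 1) ^ 2)) →
      ∃ F : ℂ → ℂ, DifferentiableOn ℂ F (ball 0 (1 / 64)) ∧
        (∀ z ∈ ball (0 : ℂ) (1 / 64), ‖F z‖ ≤ C) ∧
        ∀ t : ℝ, |t| < 1 / 64 → ‖F t - f t‖ ≤ C * θ := by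
  set B : ℝ := (2 * j + 1) * (2 * A) ^ (j + 1) * A with hB
  have hB0 : 0 < B := by positivity
  obtain ⟨C₁, hC₁, hdbar⟩ := integral_norm_cbump_mul_dbar_le j hj A B
  obtain ⟨K₁, hK₁, hcorr⟩ := exists_holomorphic_correction
  obtain ⟨K₂, hK₂, hmean⟩ := exists_norm_pow_sub_le (show (0 : ℝ) < 1 / 16 by norm_num)
  set c : ℝ := 2 * (1 + B ^ 2) * (A ^ 2 + 1) with hc
  have hc1 : 1 ≤ c := by nlinarith [sq_nonneg B, sq_nonneg A]
  set M : ℝ := K₁ * c with hM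
  have hM1 : 1 ≤ M := one_le_mul_of_one_le_of_one_le hK₁ hc1
  have hcM : c ≤ M := le_mul_of_one_le_left (by positivity) hK₁
  set E : ℝ := c * (B + j + 1) with hE
  set L : ℝ := K₂ * ((j + 1) * M ^ (j + 1) * (K₁ * C₁) + E) with hL
  have hL0 : 0 ≤ L := by positivity
  set D : ℝ := 2 ^ j * ((1 + (M + 2 * A)) * (L + A)) with hD
  have hD0 : 0 ≤ D := by positivity
  refine ⟨M + D + 1, by linarith, ?_⟩
  intro G H hG hH hGA hHA f θ hθ hθ1 hGf hHf
  set τ : ℝ := θ ^ (j + 1) with hτθ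
  have hτ : 0 < τ := by positivity
  have hτ1 : τ ≤ 1 := pow_le_one₀ hθ.le hθ1
  set δ : ℝ := τ ^ (2 * j) with hδτ
  have hδ : 0 < δ := by positivity
  have hδ1 : δ ≤ 1 := pow_le_one₀ hτ.le hτ1
  have hδle : δ ≤ τ := pow_le_of_le_one hτ.le hτ1 (by lia)
  have hη : θ ^ (4 * j * (j + 1) ^ 2) = (δ ^ (j + 1)) ^ 2 := by
    rw [hδτ, hτθ, ← pow_mul, ← pow_mul, ← pow_mul]; congr 1; ring
  have hη1 : θ ^ (4 * j * (j + 1) ^ 2) ≤ 1 := pow_le_one₀ hθ.le hθ1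
  have hητ : θ ^ (4 * j * (j + 1) ^ 2) ≤ τ := by
    rw [hτθ]; exact pow_le_pow_of_le_one hθ.le hθ1 (by nlinarith)
  have hofR : ∀ t : ℝ, |t| < 1 → (t : ℂ) ∈ ball (0 : ℂ) 1 := fun t ht => by
    rwa [mem_ball_zero_iff, Complex.norm_real]
  have hΦ : ∀ z ∈ closedBall (0 : ℂ) (1 / 5), ‖H z ^ j - G z ^ (j + 1)‖ ≤ B * δ ^ (j + 1) := by
    intro z hz
    refine norm_le_of_norm_le_real (Φ := fun z => H z ^ j - G z ^ (j + 1)) (R := 1)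
      ((hH.pow j).sub (hG.pow (j + 1))).differentiableOn hB0 (by positivity)
      (pow_le_one₀ hδ.le hδ1) ?_ ?_ ?_ one_pos
    · intro w hw
      have h1 : ‖H w ^ j‖ ≤ A ^ (j + 1) := by
        rw [norm_pow]
        exact (pow_le_pow_left₀ (norm_nonneg _) (hHA w hw) j).trans
          (pow_le_pow_right₀ hA (Nat.le_succ j))
      have h2 : ‖G w ^ (j + 1)‖ ≤ A ^ (j + 1) := by
        rw [norm_pow]; exact pow_le_pow_left₀ (norm_nonneg _) (hGA w hw) _
      have h3 : A ^ (j + 1) ≤ (2 * A) ^ (j + 1) := by gcongr; linarith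
      have h4 : (1 : ℝ) ≤ j := by exact_mod_cast hj
      have h5 : 0 < (2 * A) ^ (j + 1) := by positivity
      calc _ ≤ 2 * (2 * A) ^ (j + 1) * 1 := by
            refine (norm_sub_le _ _).trans ?_
            linarith
        _ ≤ (2 * j + 1) * (2 * A) ^ (j + 1) * A := by gcongr; linarith
    · intro t ht
      rw [← hη]
      exact norm_pow_sub_pow_le_of_close hA (by positivity) hη1 (hGA _ (hofR t ht))
        (hHA _ (hofR t ht)) (hGf t ht) (hHf t ht)
    · rw [mem_closedBall_zero_iff] at hz; linarith
  have hsub : closedBall (0 : ℂ) (1 / 5) ⊆ ball 0 1 := closedBall_subset_ball (by norm_num)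
  set u : ℂ → ℂ := fun z => H z * conj (G z) / regSq G δ z with hu
  have huc : ∀ z ∈ closedBall (0 : ℂ) (1 / 5), ‖u z‖ ≤ c := by
    intro z hz
    have hw : 0 < ‖G z‖ ^ 2 + δ ^ 2 := by positivity
    simp only [hu]
    rw [regSq_eq, norm_div, norm_mul, RCLike.norm_conj, Complex.norm_real,
      Real.norm_of_nonneg hw.le]
    exact norm_quotient_le hj (hGA z (hsub hz)) hδ hδ1 (hΦ z hz)
  have huj : ∀ z ∈ closedBall (0 : ℂ) (1 / 5), ‖u z ^ j - G z‖ ≤ E * τ := by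
    intro z hz
    have := norm_quotient_pow_sub_le hB0.le hδ (hΦ z hz)
    rw [← regSq_eq] at this
    refine this.trans ?_
    have : B + j ≤ E := by
      rw [hE]
      exact (by linarith : B + j ≤ B + j + 1).trans
        (le_mul_of_one_le_left (by positivity) hc1)
    gcongr
  have huj1 : ∀ z ∈ closedBall (0 : ℂ) (1 / 5), ‖u z ^ (j + 1) - H z‖ ≤ E * τ := by
    intro z hz
    have := norm_quotient_pow_succ_sub_le hj (hGA z (hsub hz)) hB0.le hτ hτ1 hδτ (hΦ z hz)
    rw [← regSq_eq] at this
    refine this.trans ?_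
    rw [hE]
    gcongr
  obtain ⟨F, hF, hFM, hFu⟩ := hcorr u (contDiff_mul_conj_div hG hδ hH) c huc (C₁ * τ)
    (hdbar G H hG hH (fun z hz => hGA z (hsub hz)) τ hτ hτ1 hΦ)
  have s1 : ball (0 : ℂ) (1 / 16) ⊆ ball 0 (1 / 8) := ball_subset_ball (by norm_num)
  have s2 : ball (0 : ℂ) (1 / 16) ⊆ closedBall 0 (1 / 5) :=
    ball_subset_closedBall.trans (closedBall_subset_closedBall (by norm_num))
  have hFu' : ∫⁻ z in ball (0 : ℂ) (1 / 16), ‖u z - F z‖ₑ ≤ ENNReal.ofReal (K₁ * (C₁ * τ)) :=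
    (lintegral_mono_set s1).trans hFu
  have hEτ : 0 ≤ E * τ := by positivity
  have hKτ : 0 ≤ K₁ * (C₁ * τ) := by positivity
  have e64 : (1 : ℝ) / 16 / 4 = 1 / 64 := by norm_num
  have r1 : ∀ z ∈ ball (0 : ℂ) (1 / 64), ‖F z ^ j - G z‖ ≤ L * τ := by
    intro z hz
    rw [← e64] at hz
    refine (hmean j M _ _ hM1 hEτ hKτ F u G (hF.mono s1) hG.differentiableOn hFM
      (fun z hz => (huc z (s2 hz)).trans hcM) (fun z hz => huj z (s2 hz)) hFu' z hz).trans ?_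
    have p : M ^ j ≤ M ^ (j + 1) := pow_le_pow_right₀ hM1 (Nat.le_succ j)
    calc K₂ * (j * M ^ j * (K₁ * (C₁ * τ)) + E * τ)
        ≤ K₂ * ((j + 1) * M ^ (j + 1) * (K₁ * (C₁ * τ)) + E * τ) := by gcongr; linarith
      _ = L * τ := by ring
  have r2 : ∀ z ∈ ball (0 : ℂ) (1 / 64), ‖F z ^ (j + 1) - H z‖ ≤ L * τ := by
    intro z hz
    rw [← e64] at hz
    refine (hmean (j + 1) M _ _ hM1 hEτ hKτ F u H (hF.mono s1) hH.differentiableOn hFM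
      (fun z hz => (huc z (s2 hz)).trans hcM) (fun z hz => huj1 z (s2 hz)) hFu' z hz).trans ?_
    apply le_of_eq
    rw [hL]; push_cast; ring
  have s3 : ball (0 : ℂ) (1 / 64) ⊆ ball 0 (1 / 16) := ball_subset_ball (by norm_num)
  refine ⟨F, hF.mono (s3.trans s1), fun z hz => ?_, fun t ht => ?_⟩
  · linarith [hFM z (s3 hz)]
  have ht1 : |t| < 1 := by linarith
  have htb : (t : ℂ) ∈ ball (0 : ℂ) (1 / 64) := by rwa [mem_ball_zero_iff, Complex.norm_real]
  have hfA : ‖f t‖ ≤ 2 * A := by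
    apply norm_le_of_norm_pow_le (n := j) (by lia) (by linarith)
    have := norm_le_norm_add_norm_sub (G t) (f t ^ j)
    have := hGf t ht1
    have : A * θ ^ (4 * j * (j + 1) ^ 2) ≤ A * 1 := by gcongr
    linarith [hGA _ (hofR t ht1)]
  have hdist : ∀ {a b p : ℂ}, ‖a - p‖ ≤ L * τ → ‖p - b‖ ≤ A * θ ^ (4 * j * (j + 1) ^ 2) →
      ‖a - b‖ ≤ (L + A) * τ := by
    intro a b p h1 h2
    have := norm_sub_le_norm_sub_add_norm_sub a p b
    have : A * θ ^ (4 * j * (j + 1) ^ 2) ≤ A * τ := by gcongr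
    linarith
  have key := norm_sub_pow_le_of_pow_sub (a := F t) (b := f t) (M := M + 2 * A) j
    ((hFM _ (s3 htb)).trans (by linarith)) (hfA.trans (by linarith))
    (hdist (r1 _ htb) (hGf t ht1)) (hdist (r2 _ htb) (hHf t ht1))
  have key2 : ‖F t - f t‖ / θ ≤ M + D + 1 := by
    apply le_of_pow_le_self (n := j + 1) (by lia) (by linarith)
    rw [div_pow, div_le_iff₀ (by positivity), ← hτθ]
    refine key.trans ?_
    calc 2 ^ j * ((1 + (M + 2 * A)) * ((L + A) * τ)) = D * τ := by rw [hD]; ring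
      _ ≤ _ := by gcongr; linarith
  rwa [div_le_iff₀ hθ] at key2

lemma exists_holomorphic_approx (j : ℕ) (hj : 1 ≤ j) (A : ℝ) (hA : 1 ≤ A) :
    ∃ C : ℝ, 1 ≤ C ∧ ∀ R : ℝ, 0 < R → ∀ G H : ℂ → ℂ, Differentiable ℂ G → Differentiable ℂ H →
      (∀ z ∈ ball (0 : ℂ) R, ‖G z‖ ≤ A) → (∀ z ∈ ball (0 : ℂ) R, ‖H z‖ ≤ A) →
      ∀ (f : ℝ → ℂ) (θ : ℝ), 0 < θ → θ ≤ 1 →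
      (∀ t : ℝ, |t| < R → ‖G t - f t ^ j‖ ≤ A * θ ^ (4 * j * (j + 1) ^ 2)) →
      (∀ t : ℝ, |t| < R → ‖H t - f t ^ (j + 1)‖ ≤ A * θ ^ (4 * j * (j + 1) ^ 2)) →
      ∃ F : ℂ → ℂ, DifferentiableOn ℂ F (ball 0 (R / 64)) ∧
        (∀ z ∈ ball (0 : ℂ) (R / 64), ‖F z‖ ≤ C) ∧
        ∀ t : ℝ, |t| < R / 64 → ‖F t - f t‖ ≤ C * θ := by
  obtain ⟨C, hC, hunit⟩ := exists_holomorphic_approx_unit j hj A hA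
  refine ⟨C, hC, ?_⟩
  intro R hR G H hG hH hGA hHA f θ hθ hθ1 hGf hHf
  have hRc : (R : ℂ) ≠ 0 := by exact_mod_cast hR.ne'
  have hmem : ∀ z ∈ ball (0 : ℂ) 1, (R : ℂ) * z ∈ ball (0 : ℂ) R := by
    intro z hz
    rw [mem_ball_zero_iff] at hz ⊢
    rw [norm_mul, Complex.norm_real, Real.norm_of_nonneg hR.le]
    nlinarith
  have hreal : ∀ t : ℝ, |t| < 1 → |R * t| < R := by
    intro t ht
    rw [abs_mul, abs_of_pos hR]; nlinarith
  have hback : ∀ z ∈ ball (0 : ℂ) (R / 64), z / R ∈ ball (0 : ℂ) (1 / 64) := by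
    intro z hz
    rw [mem_ball_zero_iff] at hz ⊢
    rw [norm_div, Complex.norm_real, Real.norm_of_nonneg hR.le, div_lt_iff₀ hR]
    linarith
  obtain ⟨F, hF, hFC, hFf⟩ := hunit (fun z => G (R * z)) (fun z => H (R * z))
    (hG.comp (differentiable_id.const_mul _)) (hH.comp (differentiable_id.const_mul _))
    (fun z hz => hGA _ (hmem z hz)) (fun z hz => hHA _ (hmem z hz)) (fun t => f (R * t)) θ hθ hθ1
    (fun t ht => by simpa using hGf (R * t) (hreal t ht))
    (fun t ht => by simpa using hHf (R * t) (hreal t ht))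
  refine ⟨fun z => F (z / R), hF.comp (differentiable_id.div_const _).differentiableOn hback,
    fun z hz => hFC _ (hback z hz), fun t ht => ?_⟩
  have h := hFf (t / R) (by rw [abs_div, abs_of_pos hR, div_lt_iff₀ hR]; linarith)
  rw [mul_div_cancel₀ _ hR.ne'] at h
  simpa using h

/-- `ψ` is a sequence of successive derivatives on `s`. -/
def IsDerivFamily (ψ : ℕ → ℝ → ℂ) (s : Set ℝ) : Prop :=
  ∀ m, ∀ t ∈ s, HasDerivAt (ψ m) (ψ (m + 1) t) t

lemma norm_fwdDiff_iter_sub_le {h : ℝ} (hh : 0 ≤ h) (k : ℕ) : ∀ {ψ : ℕ → ℝ → ℂ} {c : ℂ} {ε : ℝ},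
    IsDerivFamily ψ (Icc 0 (k * h)) → (∀ t ∈ Icc 0 (k * h), ‖ψ k t - c‖ ≤ ε) →
    ‖(fwdDiff h)^[k] (ψ 0) 0 - h ^ k * c‖ ≤ h ^ k * ε := by
  induction k with
  | zero =>
    intro ψ c ε _ hc
    simpa using hc 0 (by simp)
  | succ k ih =>
    intro ψ c ε hψ hc
    have hk : (k : ℝ) * h ≤ (k + 1 : ℕ) * h := by push_cast; nlinarith
    have hsub : ∀ t ∈ Icc 0 (k * h), t ∈ Icc 0 ((k + 1 : ℕ) * h) ∧ t + h ∈ Icc 0 ((k + 1 : ℕ) * h) := by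
      intro t ht
      refine ⟨⟨ht.1, ht.2.trans hk⟩, add_nonneg ht.1 hh, ?_⟩
      push_cast; linarith [ht.2]
    have hχ : IsDerivFamily (fun m t => ψ m (t + h) - ψ m t) (Icc 0 (k * h)) := by
      intro m t ht
      exact ((hψ m _ (hsub t ht).2).comp_add_const t h).sub (hψ m t (hsub t ht).1)
    have key := ih (c := h * c) (ε := h * ε) hχ (fun t ht => by
      have hd : ∀ x ∈ Icc 0 ((k + 1 : ℕ) * h), HasDerivWithinAt (fun x : ℝ => ψ k x - x * c)
          (ψ (k + 1) x - c) (Icc 0 ((k + 1 : ℕ) * h)) x := by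
        intro x hx
        exact (((hψ k x hx).sub ((Complex.ofRealCLM.hasDerivAt (x := x)).mul_const c)).congr_deriv
          (by simp)).hasDerivWithinAt
      have := (convex_Icc 0 ((k + 1 : ℕ) * h)).norm_image_sub_le_of_norm_hasDerivWithin_le hd hc
        (hsub t ht).1 (hsub t ht).2
      rw [add_sub_cancel_left, Real.norm_of_nonneg hh, mul_comm ε] at this
      refine le_of_eq_of_le (congrArg norm ?_) this
      push_cast; ring)
    rw [Function.iterate_succ_apply]
    have e1 : fwdDiff h (ψ 0) = fun t => ψ 0 (t + h) - ψ 0 t := rfl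
    rw [e1]
    calc _ = ‖(fwdDiff h)^[k] (fun t => ψ 0 (t + h) - ψ 0 t) 0 - h ^ k * (h * c)‖ := by
          congr 2; ring
      _ ≤ _ := key.trans (by rw [pow_succ, mul_assoc])

lemma norm_sub_taylor_le_of_nonneg {r B : ℝ} (k : ℕ) : ∀ {ψ : ℕ → ℝ → ℂ},
    IsDerivFamily ψ (Icc 0 r) → (∀ t ∈ Icc 0 r, ‖ψ k t‖ ≤ B) → ∀ t ∈ Icc 0 r,
    ‖ψ 0 t - ∑ i ∈ Finset.range k, ψ i 0 / (i.factorial : ℂ) * (t : ℂ) ^ i‖ ≤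
      B * t ^ k / k.factorial := by
  induction k with
  | zero => intro ψ _ hB t ht; simpa using hB t ht
  | succ k ih =>
    intro ψ hψ hB t ht
    have hder : ∀ t ∈ Icc 0 r, HasDerivAt (fun t : ℝ => ψ 0 t -
        ∑ i ∈ Finset.range (k + 1), ψ i 0 / (i.factorial : ℂ) * (t : ℂ) ^ i)
        (ψ 1 t - ∑ i ∈ Finset.range k, ψ (i + 1) 0 / (i.factorial : ℂ) * (t : ℂ) ^ i) t := by
      intro t ht
      refine (hψ 0 t ht).sub ?_
      simp only [Finset.sum_range_succ' _ k]
      have h0 : HasDerivAt (fun t : ℝ => ∑ i ∈ Finset.range k,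
          ψ (i + 1) 0 / ((i + 1).factorial : ℂ) * (t : ℂ) ^ (i + 1))
          (∑ i ∈ Finset.range k, ψ (i + 1) 0 / (i.factorial : ℂ) * (t : ℂ) ^ i) t := by
        refine HasDerivAt.fun_sum fun i _ => ?_
        have h1 := ((hasDerivAt_pow (i + 1) (t : ℂ)).comp_ofReal).const_mul
          (ψ (i + 1) 0 / ((i + 1).factorial : ℂ))
        refine h1.congr_deriv ?_
        have : (i.factorial : ℂ) ≠ 0 := by exact_mod_cast i.factorial_ne_zero
        have : (i + 1 : ℂ) ≠ 0 := by exact_mod_cast i.succ_ne_zero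
        rw [Nat.factorial_succ]
        push_cast
        field_simp
      exact h0.add_const (ψ 0 0 / (Nat.factorial 0 : ℂ) * (t : ℂ) ^ 0)
    have hψ' : IsDerivFamily (fun m => ψ (m + 1)) (Icc 0 r) := fun m => hψ (m + 1)
    have := image_norm_le_of_norm_deriv_right_le_deriv_boundary
      (fun t ht => (hder t ht).continuousAt.continuousWithinAt)
      (fun t ht => (hder t (Ico_subset_Icc_self ht)).hasDerivWithinAt)
      (B := fun t => B * t ^ (k + 1) / (k + 1).factorial)
      (B' := fun t => B * t ^ k / k.factorial) ?_ ?_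
      (fun t ht => ih hψ' hB t (Ico_subset_Icc_self ht)) ht
    · exact this
    · simp [Finset.sum_range_succ']
    · intro x
      have h1 := ((hasDerivAt_pow (k + 1) x).const_mul B).div_const ((k + 1).factorial : ℝ)
      refine h1.congr_deriv ?_
      have : (k.factorial : ℝ) ≠ 0 := by exact_mod_cast k.factorial_ne_zero
      rw [Nat.factorial_succ]
      push_cast
      field_simp

lemma norm_sub_taylor_le {r B : ℝ} (k : ℕ) {ψ : ℕ → ℝ → ℂ} (hψ : IsDerivFamily ψ (Icc (-r) r))
    (hB : ∀ t ∈ Icc (-r) r, ‖ψ k t‖ ≤ B) {t : ℝ} (ht : |t| ≤ r) :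
    ‖ψ 0 t - ∑ i ∈ Finset.range k, ψ i 0 / (i.factorial : ℂ) * (t : ℂ) ^ i‖ ≤
      B * |t| ^ k / k.factorial := by
  have hr : 0 ≤ r := (abs_nonneg t).trans ht
  rcases le_total 0 t with h0 | h0
  · rw [abs_of_nonneg h0] at ht ⊢
    have hs : Icc 0 r ⊆ Icc (-r) r := Icc_subset_Icc_left (by linarith)
    exact norm_sub_taylor_le_of_nonneg k (fun m t ht => hψ m t (hs ht)) (fun t ht => hB t (hs ht)) t
      ⟨h0, ht⟩
  · rw [abs_of_nonpos h0] at ht ⊢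
    have hs : ∀ x ∈ Icc 0 r, -x ∈ Icc (-r) r := fun x hx => ⟨by linarith [hx.2], by linarith [hx.1]⟩
    have := norm_sub_taylor_le_of_nonneg (r := r) (B := B) k
      (ψ := fun m x => (-1) ^ m * ψ m (-x)) ?_ ?_ (-t) ⟨by linarith, ht⟩
    · convert this using 2
      simp only [neg_neg, pow_zero, one_mul, neg_zero]
      congr 1
      refine Finset.sum_congr rfl fun i _ => ?_
      rw [Complex.ofReal_neg, neg_pow (t : ℂ)]
      have : ((-1 : ℂ)) ^ i * (-1) ^ i = 1 := by rw [← mul_pow]; simp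
      linear_combination (-(ψ i 0 / (i.factorial : ℂ) * (t : ℂ) ^ i)) * this
    · intro m x hx
      refine (((hψ m (-x) (hs x hx)).scomp x (hasDerivAt_neg x)).const_mul ((-1 : ℂ) ^ m)).congr_deriv ?_
      simp only [neg_one_smul, pow_succ]
      ring
    · intro x hx
      rw [norm_mul, norm_pow, norm_neg, norm_one, one_pow, one_mul]
      exact hB _ (hs x hx)

lemma isDerivFamily_iteratedDeriv {W : ℂ → ℂ} {s : Set ℂ} (hs : IsOpen s)
    (hW : DifferentiableOn ℂ W s) {I : Set ℝ} (hI : ∀ t ∈ I, (t : ℂ) ∈ s) :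
    IsDerivFamily (fun m t => iteratedDeriv m W t) I := by
  have hd : ∀ m, DifferentiableOn ℂ (iteratedDeriv m W) s := by
    intro m
    induction m with
    | zero => simpa using hW
    | succ m ih => rw [iteratedDeriv_succ]; exact ih.deriv hs
  intro m t ht
  have := ((hd m).differentiableAt (hs.mem_nhds (hI t ht))).hasDerivAt
  rw [← iteratedDeriv_succ] at this
  exact this.comp_ofReal

/-- Finite differences of a bounded holomorphic function. -/
lemma norm_fwdDiff_iter_le_of_holomorphic {W : ℂ → ℂ} {R B h : ℝ} (hR : 0 < R) (hh : 0 ≤ h) (k : ℕ)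
    (hW : DifferentiableOn ℂ W (ball 0 R)) (hB : ∀ z ∈ ball (0 : ℂ) R, ‖W z‖ ≤ B)
    (hk : k * h ≤ R / 4) :
    ‖(fwdDiff h)^[k] (fun t : ℝ => W t) 0‖ ≤ (2 * k / R * h) ^ k * B := by
  have hB0 : 0 ≤ B := (norm_nonneg _).trans (hB 0 (mem_ball_self hR))
  have hfam : IsDerivFamily (fun m t => iteratedDeriv m W t) (Icc 0 (k * h)) := by
    refine isDerivFamily_iteratedDeriv isOpen_ball hW fun t ht => ?_
    rw [mem_ball_zero_iff, Complex.norm_real, Real.norm_of_nonneg ht.1]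
    linarith [ht.2]
  have hder : ∀ t ∈ Icc 0 (k * h), ‖iteratedDeriv k W t - 0‖ ≤ k.factorial * B / (R / 2) ^ k := by
    intro t ht
    have hsub : closedBall (t : ℂ) (R / 2) ⊆ ball 0 R := by
      apply closedBall_subset_ball'
      rw [dist_zero_right, Complex.norm_real, Real.norm_of_nonneg ht.1]
      linarith [ht.2]
    rw [sub_zero]
    exact Complex.norm_iteratedDeriv_le_of_forall_mem_sphere_norm_le k (by positivity)
      ((hW.mono hsub).diffContOnCl_ball Subset.rfl)
      fun z hz => hB z (hsub (sphere_subset_closedBall hz))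
  have := norm_fwdDiff_iter_sub_le hh k hfam hder
  simp only [iteratedDeriv_zero, mul_zero, sub_zero] at this
  refine this.trans ?_
  have hf : (k.factorial : ℝ) ≤ (k : ℝ) ^ k := by exact_mod_cast Nat.factorial_le_pow k
  calc h ^ k * (k.factorial * B / (R / 2) ^ k) ≤ h ^ k * ((k : ℝ) ^ k * B / (R / 2) ^ k) := by gcongr
    _ = _ := by
      rw [mul_pow, div_pow, div_pow, mul_pow]
      field_simp

/-- Finite differences of a bounded function. -/
lemma norm_fwdDiff_iter_le {E : Type*} [AddCommMonoid E] {u : E → ℂ} {h y : E} {B : ℝ} (k : ℕ)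
    (hu : ∀ i ≤ k, ‖u (y + i • h)‖ ≤ B) : ‖(fwdDiff h)^[k] u y‖ ≤ 2 ^ k * B := by
  rw [fwdDiff_iter_eq_sum_shift]
  refine (norm_sum_le _ _).trans ?_
  have : ∀ i ∈ Finset.range (k + 1), ‖((-1 : ℤ) ^ (k - i) * (k.choose i : ℤ)) • u (y + i • h)‖ ≤
      k.choose i * B := by
    intro i hi
    rw [zsmul_eq_mul]
    push_cast
    rw [norm_mul, norm_mul, norm_pow, norm_neg, norm_one, one_pow, one_mul, Complex.norm_natCast]
    gcongr
    exact hu i (Nat.lt_succ_iff.1 (Finset.mem_range.1 hi))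
  refine (Finset.sum_le_sum this).trans ?_
  rw [← Finset.sum_mul]
  have := Nat.sum_range_choose k
  exact_mod_cast le_of_eq (by rw [← this])

/-- `φ` has derivatives of all orders near `[-R, R]`, bounded by `A` times the weight sequence of
`ω` with parameter `ρ`. -/
def HasWeightBounds (ω : ℝ → ℝ) (ρ A R : ℝ) (φ : ℝ → ℂ) : Prop :=
  ∃ ψ : ℕ → ℝ → ℂ, ψ 0 = φ ∧ IsDerivFamily ψ (Icc (-R) R) ∧
    ∀ m, ∀ t ∈ Icc (-R) R, ‖ψ m t‖ ≤ A * Real.exp (1 / ρ * youngConj ω (ρ * m))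

lemma HasWeightBounds.mono {ω : ℝ → ℝ} {ρ A R R' : ℝ} {φ : ℝ → ℂ}
    (h : HasWeightBounds ω ρ A R φ) (hR : R' ≤ R) : HasWeightBounds ω ρ A R' φ := by
  obtain ⟨ψ, h0, hd, hb⟩ := h
  have hs : Icc (-R') R' ⊆ Icc (-R) R := Icc_subset_Icc (by linarith) hR
  exact ⟨ψ, h0, fun m t ht => hd m t (hs ht), fun m t ht => hb m t (hs ht)⟩

lemma exists_le_mul_exp_weight {ω : ℝ → ℝ} (hω : IsWeightFunction ω) :
    ∃ C : ℝ, 1 ≤ C ∧ ∀ y, 1 ≤ y → y ≤ C * Real.exp (ω y) := by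
  obtain ⟨T, hT⟩ := eventually_atTop.1 (hω.logLittleO.def (c := 1) one_pos)
  refine ⟨max T 1, le_max_right _ _, fun y hy => ?_⟩
  have hy0 : 0 < y := by linarith
  have hωy := hω.nonneg y hy0.le
  rcases le_total T y with h | h
  · have h1 := hT y h
    rw [Real.norm_of_nonneg (Real.log_nonneg hy), Real.norm_of_nonneg hωy, one_mul,
      Real.log_le_iff_le_exp hy0] at h1
    exact h1.trans (le_mul_of_one_le_left (Real.exp_pos _).le (le_max_right _ _))
  · calc y ≤ max T 1 := h.trans (le_max_left _ _)
      _ ≤ _ := le_mul_of_one_le_right (by positivity) (Real.one_le_exp hωy)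

/-- The Taylor polynomial of optimal order at the radius adapted to `y`. -/
lemma exists_entire_approx {ω : ℝ → ℝ} (hω : IsWeightFunction ω) (hconc : ConcaveOn ℝ (Ici 0) ω)
    {y r ρ A : ℝ} (hy : 1 < y) (h : IsSlopeAt ω y r) (hρ : 0 < ρ) (hA : 0 ≤ A) {φ : ℝ → ℂ}
    (hφ : HasWeightBounds ω ρ A (1 / ρ * r / 4) φ) :
    ∃ G : ℂ → ℂ, Differentiable ℂ G ∧ (∀ z ∈ ball (0 : ℂ) (1 / ρ * r / 4), ‖G z‖ ≤ 2 * A) ∧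
      ∀ t : ℝ, |t| < 1 / ρ * r / 4 → ‖G t - φ t‖ ≤ A * (4 * (y * Real.exp (-(1 / ρ * ω y)))) := by
  obtain ⟨ψ, rfl, hd, hb⟩ := hφ
  have hr := h.nonneg hω hy
  have hy0 : 0 < y := by linarith
  set R := 1 / ρ * r / 4 with hR
  have hR0 : 0 ≤ R := by positivity
  obtain ⟨k, hk⟩ : ∃ k : ℕ, k = ⌊1 / ρ * (y * r)⌋₊ := ⟨_, rfl⟩
  refine ⟨fun z => ∑ i ∈ Finset.range k, ψ i 0 / (i.factorial : ℂ) * z ^ i, by fun_prop, ?_, ?_⟩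
  · intro z hz
    rw [mem_ball_zero_iff] at hz
    have hterm : ∀ i ∈ Finset.range k, ‖ψ i 0 / (i.factorial : ℂ) * z ^ i‖ ≤ A * (1 / 2) ^ i := by
      intro i hi
      have hik : (i : ℝ) ≤ 1 / ρ * (y * r) := by
        have h1 : i ≤ ⌊1 / ρ * (y * r)⌋₊ := hk ▸ (Finset.mem_range.1 hi).le
        exact (Nat.cast_le.2 h1).trans (Nat.floor_le (by positivity))
      have h1 := exp_youngConj_mul_pow_le hω hconc hy h hρ hik
      have h2 := hb i 0 ⟨by linarith, hR0⟩
      have hf : (0 : ℝ) < i.factorial := by positivity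
      rw [norm_mul, norm_div, norm_pow, Complex.norm_natCast, div_mul_eq_mul_div, div_le_iff₀ hf]
      have hz2 : ‖z‖ ≤ (1 / ρ * r) * (1 / 2) := by
        rw [hR] at hz
        have : 0 ≤ 1 / ρ * r := by positivity
        linarith
      calc ‖ψ i 0‖ * ‖z‖ ^ i
          ≤ (A * Real.exp (1 / ρ * youngConj ω (ρ * i))) * ((1 / ρ * r) * (1 / 2)) ^ i := by gcongr
        _ = A * (1 / 2) ^ i * (Real.exp (1 / ρ * youngConj ω (ρ * i)) * (1 / ρ * r) ^ i) := by
          rw [mul_pow]; ring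
        _ ≤ _ := by gcongr
    calc _ ≤ ∑ i ∈ Finset.range k, A * (1 / 2 : ℝ) ^ i :=
          (norm_sum_le _ _).trans (Finset.sum_le_sum hterm)
      _ = A * ∑ i ∈ Finset.range k, (1 / 2 : ℝ) ^ i := by rw [Finset.mul_sum]
      _ ≤ A * 2 := by gcongr; exact sum_geometric_two_le k
      _ = _ := mul_comm _ _
  · intro t ht
    rw [norm_sub_rev]
    refine (norm_sub_taylor_le k hd (hb k) ht.le).trans ?_
    have hf : (0 : ℝ) < k.factorial := by positivity
    rw [div_le_iff₀ hf]
    have h1 := exp_youngConj_mul_pow_floor_le hω hy h hρ hk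
    calc A * Real.exp (1 / ρ * youngConj ω (ρ * k)) * |t| ^ k
        ≤ A * Real.exp (1 / ρ * youngConj ω (ρ * k)) * R ^ k := by gcongr
      _ = A * (Real.exp (1 / ρ * youngConj ω (ρ * k)) * R ^ k) := by ring
      _ ≤ A * (4 * (y * Real.exp (-(1 / ρ * ω y))) * k.factorial) := by gcongr
      _ = _ := by ring

/-- Holomorphic approximation of `f` at the scale adapted to `y`. -/
lemma exists_holomorphic_approx_at_scale {ω : ℝ → ℝ} (hω : IsWeightFunction ω)
    (hconc : ConcaveOn ℝ (Ici 0) ω) (j : ℕ) (hj : 1 ≤ j) {ρ A : ℝ} (hρ : 0 < ρ) (hρ1 : ρ ≤ 1)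
    (hA : 1 ≤ A) : ∃ C : ℝ, 1 ≤ C ∧ ∀ y r : ℝ, 1 < y → IsSlopeAt ω y r → 0 < r →
      ∀ f : ℝ → ℂ, HasWeightBounds ω ρ A (1 / ρ * r / 4) (fun t => f t ^ j) →
      HasWeightBounds ω ρ A (1 / ρ * r / 4) (fun t => f t ^ (j + 1)) →
      ∃ F : ℂ → ℂ, DifferentiableOn ℂ F (ball 0 (1 / ρ * r / 256)) ∧
        (∀ z ∈ ball (0 : ℂ) (1 / ρ * r / 256), ‖F z‖ ≤ C) ∧
        ∀ t : ℝ, |t| < 1 / ρ * r / 256 →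
          ‖F t - f t‖ ≤ C * Real.exp (-((1 / ρ - 1) / (4 * j * (j + 1) ^ 2) * ω y)) := by
  obtain ⟨C₁, hC₁, hlog⟩ := exists_le_mul_exp_weight hω
  have hA' : 1 ≤ 4 * A * C₁ := by nlinarith
  obtain ⟨C, hC, happ⟩ := exists_holomorphic_approx j hj (4 * A * C₁) hA'
  refine ⟨C, hC, ?_⟩
  intro y r hy h hr f hf1 hf2
  obtain ⟨G, hG, hGb, hGf⟩ := exists_entire_approx hω hconc hy h hρ (by linarith) hf1
  obtain ⟨H, hH, hHb, hHf⟩ := exists_entire_approx hω hconc hy h hρ (by linarith) hf2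
  have hωy := hω.nonneg y (by linarith)
  have hs : 0 ≤ 1 / ρ - 1 := by
    rw [sub_nonneg, le_div_iff₀ hρ]; linarith
  set θ := Real.exp (-((1 / ρ - 1) / (4 * j * (j + 1) ^ 2) * ω y)) with hθ
  have hθ1 : θ ≤ 1 := by
    rw [hθ, Real.exp_le_one_iff, neg_nonpos]; positivity
  have hpow : θ ^ (4 * j * (j + 1) ^ 2) = Real.exp (-((1 / ρ - 1) * ω y)) := by
    have hj0 : (0 : ℝ) < j := by exact_mod_cast hj
    rw [hθ, ← Real.exp_nat_mul]
    congr 1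
    push_cast
    field_simp
  have h2A : 2 * A ≤ 4 * A * C₁ := by nlinarith
  have herr : A * (4 * (y * Real.exp (-(1 / ρ * ω y)))) ≤
      4 * A * C₁ * θ ^ (4 * j * (j + 1) ^ 2) := by
    rw [hpow]
    have : y * Real.exp (-(1 / ρ * ω y)) ≤ C₁ * Real.exp (-((1 / ρ - 1) * ω y)) := by
      calc y * Real.exp (-(1 / ρ * ω y)) ≤ C₁ * Real.exp (ω y) * Real.exp (-(1 / ρ * ω y)) := by
            gcongr; exact hlog y hy.le
        _ = _ := by rw [mul_assoc, ← Real.exp_add]; congr 2; ring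
    calc A * (4 * (y * Real.exp (-(1 / ρ * ω y))))
        ≤ A * (4 * (C₁ * Real.exp (-((1 / ρ - 1) * ω y)))) := by gcongr
      _ = _ := by ring
  have e : 1 / ρ * r / 256 = 1 / ρ * r / 4 / 64 := by ring
  rw [e]
  exact happ (1 / ρ * r / 4) (by positivity) G H hG hH (fun z hz => (hGb z hz).trans h2A)
    (fun z hz => (hHb z hz).trans h2A) f θ (Real.exp_pos _) hθ1
    (fun t ht => (hGf t ht).trans herr) (fun t ht => (hHf t ht).trans herr)

lemma IsSlopeAt.le_of_lt {ω : ℝ → ℝ} {y y' r r' : ℝ} (hy : 0 ≤ y) (hyy : y < y')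
    (h : IsSlopeAt ω y r) (h' : IsSlopeAt ω y' r') : r' ≤ r := by
  have h1 := h.le_line y' (by linarith)
  have h2 := h'.le_line y hy
  nlinarith

lemma IsSlopeAt.pos {ω : ℝ → ℝ} (hω : IsWeightFunction ω) {y r : ℝ} (h : IsSlopeAt ω y r) :
    0 < r := by
  by_contra! hr
  obtain ⟨C, hC, hlog⟩ := exists_le_mul_exp_weight hω
  set z := max (max y 1) (C * Real.exp (ω y) + 1) with hz
  have hzy : y ≤ z := (le_max_left _ _).trans (le_max_left _ _)
  have hz1 : 1 ≤ z := (le_max_right _ _).trans (le_max_left _ _)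
  have h1 := h.le_line z (by linarith)
  have h2 : ω z ≤ ω y := by nlinarith
  have h3 := hlog z hz1
  have h4 : C * Real.exp (ω y) + 1 ≤ z := le_max_right _ _
  have h5 : C * Real.exp (ω z) ≤ C * Real.exp (ω y) := by gcongr
  linarith

lemma weight_two_mul_le {ω : ℝ → ℝ} (hω : IsWeightFunction ω) (hconc : ConcaveOn ℝ (Ici 0) ω)
    {y : ℝ} (hy : 0 ≤ y) : ω (2 * y) ≤ 2 * ω y := by
  have h := hconc.2 (show (0 : ℝ) ∈ Ici 0 by simp) (show 2 * y ∈ Ici (0 : ℝ) by simpa using hy)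
    (show (0 : ℝ) ≤ 1 / 2 by norm_num) (show (0 : ℝ) ≤ 1 / 2 by norm_num) (by norm_num)
  have h0 := hω.nonneg 0 le_rfl
  simp only [smul_eq_mul, mul_zero, zero_add] at h
  rw [show 1 / 2 * (2 * y) = y by ring] at h
  linarith

/-- A dyadic sequence of scales. -/
structure IsScaleSeq (ω : ℝ → ℝ) (y r : ℕ → ℝ) : Prop where
  one_lt : ∀ i, 1 < y i
  slope : ∀ i, IsSlopeAt ω (y i) (r i)
  pos : ∀ i, 0 < r i
  anti : Antitone r
  tendsto : Tendsto r atTop (𝓝 0)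
  le : ∀ i, ω (y i) ≤ ω (y (i + 1))
  le_two_mul : ∀ i, ω (y (i + 1)) ≤ 2 * ω (y i)
  summable : Summable fun i => Real.exp (-ω (y i))

lemma exists_isScaleSeq {ω : ℝ → ℝ} (hω : IsWeightFunction ω) (hconc : ConcaveOn ℝ (Ici 0) ω)
    {η : ℝ} (hη : 0 < η) : ∃ y r : ℕ → ℝ, IsScaleSeq ω y r ∧ ∀ i, r i ≤ η := by
  obtain ⟨C, hC, hlog⟩ := exists_le_mul_exp_weight hω
  have hy1 : ∀ i : ℕ, (1 : ℝ) < 2 ^ (i + 1) := fun i => one_lt_pow₀ (by norm_num) (by lia)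
  choose r hr using fun i : ℕ => exists_isSlopeAt hω hconc (hy1 i)
  have hyt : Tendsto (fun i : ℕ => (2 : ℝ) ^ (i + 1)) atTop atTop :=
    (tendsto_pow_atTop_atTop_of_one_lt (by norm_num)).comp (tendsto_add_atTop_nat 1)
  have hpos : ∀ i, 0 < r i := fun i => (hr i).pos hω
  have hanti : Antitone r := antitone_nat_of_succ_le fun i =>
    (hr i).le_of_lt (by positivity) (pow_lt_pow_right₀ (by norm_num) (by lia)) (hr (i + 1))
  have hrt : Tendsto r atTop (𝓝 0) := by
    have h1 := (hω.littleO.tendsto_div_nhds_zero).comp hyt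
    refine squeeze_zero (fun i => (hpos i).le) (fun i => ?_) h1
    simp only [Function.comp_apply]
    rw [le_div_iff₀ (by positivity)]
    exact (hr i).mul_le hω
  have hsum : Summable fun i : ℕ => Real.exp (-ω (2 ^ (i + 1))) := by
    refine Summable.of_nonneg_of_le (fun i => (Real.exp_pos _).le) (fun i => ?_)
      ((summable_geometric_two).mul_left C)
    have h1 := hlog _ (hy1 i).le
    rw [Real.exp_neg, inv_le_comm₀ (Real.exp_pos _) (by positivity), mul_inv, ← inv_pow,
      one_div, inv_inv, inv_mul_le_iff₀ (by positivity)]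
    exact (pow_le_pow_right₀ (by norm_num) (by lia)).trans h1
  obtain ⟨n, hn⟩ := eventually_atTop.1 (hrt.eventually (ge_mem_nhds hη))
  refine ⟨fun i => 2 ^ (i + n + 1), fun i => r (i + n), ⟨fun i => hy1 _, fun i => hr _,
    fun i => hpos _, fun a b hab => hanti (by lia), hrt.comp (tendsto_add_atTop_nat n),
    fun i => ?_, fun i => ?_, (summable_nat_add_iff n).2 hsum⟩, fun i => hn _ (by lia)⟩
  · exact hω.mono (by simp) (by simp) (pow_le_pow_right₀ (by norm_num) (by lia))
  · have := weight_two_mul_le hω hconc (y := 2 ^ (i + n + 1)) (by positivity)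
    rwa [← pow_succ', show i + n + 1 + 1 = i + 1 + n + 1 by lia] at this

lemma mul_pow_mul_exp_le {ω : ℝ → ℝ} (hω : IsWeightFunction ω) {y r ρ ε s a c : ℝ}
    (hy : 1 < y) (h : IsSlopeAt ω y r) (hr : 0 < r) (hr1 : r ≤ 1) (hρ : 0 < ρ) (hs : 0 < s)
    (hc : 0 ≤ c) (hcs : c * Real.exp (1 / ρ) ≤ ε * s) (ha : 1 / ρ + 1 ≤ a) (k : ℕ) :
    (c * k / (s * r)) ^ k * Real.exp (-(a * ω y)) ≤
      ε ^ k * Real.exp (1 / ρ * youngConj ω (ρ * k)) * Real.exp (-ω y) := by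
  have hωy := hω.nonneg y (by linarith)
  have h1 := pow_div_mul_exp_le hω hy h hr hr1 hρ k
  have h2 : Real.exp (-(a * ω y)) ≤ Real.exp (-(1 / ρ * ω y)) * Real.exp (-ω y) := by
    rw [← Real.exp_add, Real.exp_le_exp]; nlinarith
  have h3 : c / s * Real.exp (1 / ρ) ≤ ε := by
    rw [div_mul_eq_mul_div, div_le_iff₀ hs]; exact hcs
  calc (c * k / (s * r)) ^ k * Real.exp (-(a * ω y))
      ≤ (c / s * (k / r)) ^ k * (Real.exp (-(1 / ρ * ω y)) * Real.exp (-ω y)) := by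
        rw [div_mul_div_comm]; gcongr
    _ = (c / s) ^ k * ((k / r) ^ k * Real.exp (-(1 / ρ * ω y))) * Real.exp (-ω y) := by
        rw [mul_pow]; ring
    _ ≤ (c / s) ^ k * (Real.exp (1 / ρ) ^ k * Real.exp (1 / ρ * youngConj ω (ρ * k))) *
        Real.exp (-ω y) := by gcongr
    _ = (c / s * Real.exp (1 / ρ)) ^ k * Real.exp (1 / ρ * youngConj ω (ρ * k)) *
        Real.exp (-ω y) := by rw [mul_pow]; ring
    _ ≤ _ := by gcongr

set_option maxHeartbeats 2000000 in
/-- Joris' theorem in one variable, expressed through finite differences. -/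
lemma exists_norm_fwdDiff_iter_le {ω : ℝ → ℝ} (hω : IsWeightFunction ω)
    (hconc : ConcaveOn ℝ (Ici 0) ω) (j : ℕ) (hj : 1 ≤ j) {ρ' ε : ℝ} (hρ' : 0 < ρ') (hε : 0 < ε) :
    ∃ ρ : ℝ, 0 < ρ ∧ ∀ r₀ A : ℝ, 0 < r₀ → 1 ≤ A → ∃ C : ℝ, 0 ≤ C ∧ ∀ k : ℕ, ∃ h : ℕ → ℝ,
      (∀ n, 0 < h n) ∧ Tendsto h atTop (𝓝 0) ∧ (∀ n, k * h n ≤ r₀) ∧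
      ∀ f : ℝ → ℂ, HasWeightBounds ω ρ A r₀ (fun t => f t ^ j) →
        HasWeightBounds ω ρ A r₀ (fun t => f t ^ (j + 1)) → ∀ n,
        ‖(fwdDiff (h n))^[k] f 0‖ ≤
          C * (ε ^ k * Real.exp (1 / ρ' * youngConj ω (ρ' * k))) * h n ^ k := by
  set N : ℝ := 4 * j * (j + 1) ^ 2 with hN
  have hj1 : (1 : ℝ) ≤ j := by exact_mod_cast hj
  have hN0 : 0 < N := by positivity
  set a : ℝ := 1 / ρ' + 1 + 16384 * Real.exp (1 / ρ') / ε with ha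
  set s : ℝ := 1 + 4 * N * a with hs
  have ha1 : 1 / ρ' + 1 ≤ a := by
    have : 0 ≤ 16384 * Real.exp (1 / ρ') / ε := by positivity
    linarith
  have ha0 : 0 < a := by positivity
  have hN1 : 1 ≤ 4 * N := by nlinarith
  have hs1 : 1 ≤ s := by
    have : 0 ≤ 4 * N * a := by positivity
    linarith
  have hs0 : 0 < s := by linarith
  have has : a ≤ s := by nlinarith
  have hcs : ∀ c : ℝ, c ≤ 16384 → c * Real.exp (1 / ρ') ≤ ε * s := by
    intro c hc
    have h1 : 16384 * Real.exp (1 / ρ') / ε ≤ s := by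
      have : 0 < 1 / ρ' := by positivity
      linarith
    rw [div_le_iff₀ hε] at h1
    have h2 : c * Real.exp (1 / ρ') ≤ 16384 * Real.exp (1 / ρ') := by gcongr
    linarith
  have hsN : (s - 1) / N = 4 * a := by rw [hs]; field_simp; ring
  refine ⟨1 / s, by positivity, ?_⟩
  intro r₀ A hr₀ hA
  obtain ⟨C, hC, happ⟩ := exists_holomorphic_approx_at_scale hω hconc j hj (ρ := 1 / s) (A := A)
    (by positivity) (by rw [div_le_one hs0]; exact hs1) hA
  simp only [one_div_one_div, ← hN, hsN] at happ
  obtain ⟨y, r, hyr, hrη⟩ := exists_isScaleSeq hω hconc (η := min 1 (r₀ / s)) (by positivity)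
  have hr1 : ∀ i, r i ≤ 1 := fun i => (hrη i).trans (min_le_left _ _)
  have hrr₀ : ∀ i, s * r i ≤ r₀ := fun i => by
    have := (hrη i).trans (min_le_right _ _)
    rwa [le_div_iff₀' hs0] at this
  have hωy : ∀ i, 0 ≤ ω (y i) := fun i => hω.nonneg _ (by linarith [hyr.one_lt i])
  set P : ℕ → ℝ := fun i => s * r i / 256 with hP
  have hP0 : ∀ i, 0 < P i := fun i => by have := hyr.pos i; positivity
  have hPanti : Antitone P := fun i i' hi => by
    simp only [hP]; have := hyr.anti hi; gcongr
  set T : ℝ := ∑' i, Real.exp (-ω (y (i + 1))) with hT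
  have hsum : Summable fun i => Real.exp (-ω (y (i + 1))) :=
    (summable_nat_add_iff 1).2 hyr.summable
  have hT0 : 0 ≤ T := tsum_nonneg fun i => (Real.exp_pos _).le
  refine ⟨C * Real.exp (a * ω (y 0)) + 2 * C * T + C, by positivity, ?_⟩
  intro k
  set Z : ℝ := ε ^ k * Real.exp (1 / ρ' * youngConj ω (ρ' * k)) with hZ
  have hZ0 : 0 ≤ Z := by positivity
  have hgen : ∀ c : ℝ, 0 ≤ c → c ≤ 16384 → ∀ i,
      (c * k / (s * r i)) ^ k * Real.exp (-(a * ω (y i))) ≤ Z * Real.exp (-ω (y i)) :=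
    fun c hc hc' i => mul_pow_mul_exp_le hω (hyr.one_lt i) (hyr.slope i) (hyr.pos i) (hr1 i) hρ' hs0
      hc (hcs c hc') ha1 k
  have hPt : Tendsto P atTop (𝓝 0) := by
    have := (hyr.tendsto.const_mul s).div_const 256
    simpa using this
  set h : ℕ → ℝ := fun n => P n / (16 * (k + 1)) with hh
  have hh0 : ∀ n, 0 < h n := fun n => by have := hP0 n; positivity
  have hkh : ∀ n, k * h n ≤ P n / 16 := fun n => by
    simp only [hh]
    rw [← mul_div_assoc, div_le_div_iff₀ (by positivity) (by norm_num)]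
    nlinarith [hP0 n]
  refine ⟨h, hh0, ?_, fun n => ?_, ?_⟩
  · have := hPt.div_const (16 * ((k : ℝ) + 1))
    simpa using this
  · have h1 := hkh n
    have h2 := hrr₀ n
    have h3 := hP0 n
    simp only [hP] at h1 h3
    linarith
  intro f hf1 hf2 n
  have hsr : ∀ i, s * r i / 4 ≤ r₀ := fun i => by
    have h2 := hrr₀ i
    have := hyr.pos i
    have : 0 < s * r i := by positivity
    linarith
  choose F hF hFC hFf using fun i => happ (y i) (r i) (hyr.one_lt i) (hyr.slope i) (hyr.pos i) f
    (hf1.mono (hsr i)) (hf2.mono (hsr i))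
  have hdiff : ∀ i < n, ‖(fwdDiff (h n))^[k] (fun t : ℝ => F (i + 1) t - F i t) 0‖ ≤
      2 * C * Real.exp (-ω (y (i + 1))) * (Z * h n ^ k) := by
    intro i hi
    have hPi : P (i + 1) ≤ P i := hPanti (Nat.le_succ i)
    have hsub : ball (0 : ℂ) (P (i + 1)) ⊆ ball 0 (P i) := ball_subset_ball hPi
    have hW : DifferentiableOn ℂ (fun z => F (i + 1) z - F i z) (ball 0 (P (i + 1))) :=
      (hF (i + 1)).sub ((hF i).mono hsub)
    have hWs : ∀ z ∈ ball (0 : ℂ) (P (i + 1) / 4), ‖F (i + 1) z - F i z‖ ≤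
        2 * C * Real.exp (-(a * ω (y (i + 1)))) := by
      intro z hz
      have h1 : ‖F (i + 1) z - F i z‖ ≤ 2 * C * Real.exp (-(2 * a * ω (y i))) := by
        refine norm_le_of_norm_le_real hW (by positivity) (Real.exp_pos _) ?_ ?_ ?_
          (mem_ball_zero_iff.1 hz).le (hP0 _)
        · rw [Real.exp_le_one_iff, neg_nonpos]
          have := hωy i
          positivity
        · intro w hw
          have := norm_sub_le (F (i + 1) w) (F i w)
          linarith [hFC (i + 1) w hw, hFC i w (hsub hw)]
        · intro t ht
          have e1 := hFf (i + 1) t ht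
          have e2 := hFf i t (ht.trans_le hPi)
          have e3 : Real.exp (-(4 * a * ω (y (i + 1)))) ≤ Real.exp (-(4 * a * ω (y i))) := by
            have := hyr.le i
            gcongr
          have e4 : C * Real.exp (-(4 * a * ω (y (i + 1)))) ≤ C * Real.exp (-(4 * a * ω (y i))) := by
            gcongr
          have e5 : Real.exp (-(2 * a * ω (y i))) ^ 2 = Real.exp (-(4 * a * ω (y i))) := by
            rw [← Real.exp_nat_mul]; congr 1; push_cast; ring
          rw [e5]
          have e6 := norm_sub_le (F (i + 1) t - f t) (F i t - f t)
          rw [sub_sub_sub_cancel_right] at e6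
          linarith
      refine h1.trans ?_
      have := hyr.le_two_mul i
      gcongr 2 * C * Real.exp ?_
      nlinarith
    have hb := norm_fwdDiff_iter_le_of_holomorphic (by have := hP0 (i + 1); positivity) (hh0 n).le k
      (hW.mono (ball_subset_ball (by linarith [hP0 (i + 1)]))) hWs (by
        have := hkh n
        have := hPanti (Nat.succ_le_of_lt hi)
        simp only [Nat.succ_eq_add_one] at this
        linarith)
    refine hb.trans ?_
    have e : 2 * k / (P (i + 1) / 4) * h n = 2048 * k / (s * r (i + 1)) * h n := by
      simp only [hP]
      have := (hyr.pos (i + 1)).ne'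
      field_simp
      ring
    rw [e, mul_pow]
    calc _ = 2 * C * ((2048 * k / (s * r (i + 1))) ^ k * Real.exp (-(a * ω (y (i + 1))))) * h n ^ k := by
          ring
      _ ≤ 2 * C * (Z * Real.exp (-ω (y (i + 1)))) * h n ^ k := by
          exact mul_le_mul_of_nonneg_right (mul_le_mul_of_nonneg_left
            (hgen 2048 (by norm_num) (by norm_num) (i + 1)) (by positivity))
            (pow_nonneg (hh0 n).le k)
      _ = _ := by ring
  have hfirst : ‖(fwdDiff (h n))^[k] (fun t : ℝ => F 0 t) 0‖ ≤
      C * Real.exp (a * ω (y 0)) * (Z * h n ^ k) := by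
    have hb := norm_fwdDiff_iter_le_of_holomorphic (hP0 0) (hh0 n).le k (hF 0) (hFC 0) (by
        have := hkh n
        have := hPanti (Nat.zero_le n)
        linarith [hP0 0])
    refine hb.trans ?_
    have e : 2 * k / P 0 * h n = 512 * k / (s * r 0) * h n := by
      simp only [hP]
      have := (hyr.pos 0).ne'
      field_simp
      ring
    have e1 : Real.exp (a * ω (y 0)) * Real.exp (-(a * ω (y 0))) = 1 := by
      rw [← Real.exp_add]; simp
    rw [e, mul_pow]
    calc _ = C * Real.exp (a * ω (y 0)) *
          ((512 * k / (s * r 0)) ^ k * Real.exp (-(a * ω (y 0)))) * h n ^ k := by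
          linear_combination (-(C * (512 * k / (s * r 0)) ^ k * h n ^ k)) * e1
      _ ≤ C * Real.exp (a * ω (y 0)) * (Z * 1) * h n ^ k := by
          have hz := hgen 512 (by norm_num) (by norm_num) 0
          have : Real.exp (-ω (y 0)) ≤ 1 := by
            rw [Real.exp_le_one_iff]; linarith [hωy 0]
          have h2 : Z * Real.exp (-ω (y 0)) ≤ Z * 1 := by gcongr
          exact mul_le_mul_of_nonneg_right (mul_le_mul_of_nonneg_left (hz.trans h2) (by positivity))
            (pow_nonneg (hh0 n).le k)
      _ = _ := by ring
  have hall : ∀ m ≤ n, ‖(fwdDiff (h n))^[k] (fun t : ℝ => F m t) 0‖ ≤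
      (C * Real.exp (a * ω (y 0)) + 2 * C * ∑ i ∈ Finset.range m, Real.exp (-ω (y (i + 1)))) *
        (Z * h n ^ k) := by
    intro m
    induction m with
    | zero => intro _; simpa using hfirst
    | succ m ih =>
      intro hm
      have e : (fun t : ℝ => F (m + 1) t) =
          (fun t : ℝ => F m t) + fun t : ℝ => F (m + 1) t - F m t := by
        ext t; simp
      rw [e, fwdDiff_iter_add, Pi.add_apply, Finset.sum_range_succ]
      refine (norm_add_le _ _).trans ((add_le_add (ih (by lia)) (hdiff m (by lia))).trans
        (le_of_eq (by ring)))
  have herr : ‖(fwdDiff (h n))^[k] (fun t : ℝ => f t - F n t) 0‖ ≤ C * (Z * h n ^ k) := by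
    have hb := norm_fwdDiff_iter_le (u := fun t : ℝ => f t - F n t) (h := h n) (y := 0)
      (B := C * Real.exp (-(4 * a * ω (y n)))) k (fun i hi => by
        rw [norm_sub_rev]
        apply hFf n
        rw [zero_add, nsmul_eq_mul, abs_of_nonneg (by have := hh0 n; positivity)]
        have h1 : (i : ℝ) * h n ≤ k * h n := by have := hh0 n; gcongr
        have h2 := hkh n
        have h3 := hP0 n
        exact (h1.trans h2).trans_lt (by simp only [hP] at h3 ⊢; linarith))
    refine hb.trans ?_
    have hs4 : Real.exp (-(4 * a * ω (y n))) ≤ Real.exp (-(a * ω (y n))) := by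
      have := mul_nonneg ha0.le (hωy n)
      exact Real.exp_le_exp.2 (by linarith)
    have h2k : (2 : ℝ) ^ k ≤ (16384 * k / (s * r n)) ^ k * h n ^ k := by
      rcases Nat.eq_zero_or_pos k with rfl | hk
      · simp
      rw [← mul_pow]
      gcongr
      have hk1 : (1 : ℝ) ≤ k := by exact_mod_cast hk
      simp only [hh, hP]
      have := hyr.pos n
      rw [show 16384 * k / (s * r n) * (s * r n / 256 / (16 * (k + 1))) = 4 * k / ((k : ℝ) + 1) by
        field_simp; ring]
      rw [le_div_iff₀ (by positivity)]
      linarith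
    have hhk := pow_nonneg (hh0 n).le k
    have hrn := hyr.pos n
    calc (2 : ℝ) ^ k * (C * Real.exp (-(4 * a * ω (y n))))
        ≤ ((16384 * k / (s * r n)) ^ k * h n ^ k) * (C * Real.exp (-(a * ω (y n)))) := by gcongr
      _ = C * ((16384 * k / (s * r n)) ^ k * Real.exp (-(a * ω (y n)))) * h n ^ k := by ring
      _ ≤ C * (Z * 1) * h n ^ k := by
          have hz := hgen 16384 (by norm_num) le_rfl n
          have : Real.exp (-ω (y n)) ≤ 1 := by
            rw [Real.exp_le_one_iff]; linarith [hωy n]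
          have h2 : Z * Real.exp (-ω (y n)) ≤ Z * 1 := by gcongr
          exact mul_le_mul_of_nonneg_right (mul_le_mul_of_nonneg_left (hz.trans h2) (by positivity))
            hhk
      _ = _ := by ring
  have e : f = (fun t : ℝ => F n t) + fun t : ℝ => f t - F n t := by ext t; simp
  rw [e, fwdDiff_iter_add, Pi.add_apply]
  have hTn : ∑ i ∈ Finset.range n, Real.exp (-ω (y (i + 1))) ≤ T :=
    hsum.sum_le_tsum _ fun i _ => (Real.exp_pos _).le
  have hhk := pow_nonneg (hh0 n).le k
  calc _ ≤ (C * Real.exp (a * ω (y 0)) +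
        2 * C * ∑ i ∈ Finset.range n, Real.exp (-ω (y (i + 1)))) * (Z * h n ^ k) +
        C * (Z * h n ^ k) := (norm_add_le _ _).trans (add_le_add (hall n le_rfl) herr)
    _ ≤ (C * Real.exp (a * ω (y 0)) + 2 * C * T) * (Z * h n ^ k) + C * (Z * h n ^ k) := by gcongr
    _ = _ := by ring

/-- The iterated derivatives of a smooth function are symmetric. -/
lemma iteratedFDeriv_comp_perm_of_contDiff {E F : Type*} [NormedAddCommGroup E] [NormedSpace ℝ E]
    [NormedAddCommGroup F] [NormedSpace ℝ F] {g : E → F} (hg : ContDiff ℝ (⊤ : ℕ∞) g) (n : ℕ) :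
    ∀ (x : E) (v : Fin n → E) (σ : Equiv.Perm (Fin n)),
      iteratedFDeriv ℝ n g x (v ∘ σ) = iteratedFDeriv ℝ n g x v := by
  have hd : ∀ m, Differentiable ℝ (iteratedFDeriv ℝ m g) := fun m =>
    hg.differentiable_iteratedFDeriv (mod_cast WithTop.coe_lt_top m)
  induction n with
  | zero => intro x v σ; rw [Subsingleton.elim (v ∘ σ) v]
  | succ n ih =>
    have hswap : ∀ (i : Fin n) (x : E) (v : Fin (n + 1) → E),
        iteratedFDeriv ℝ (n + 1) g x (v ∘ Equiv.swap i.castSucc i.succ) =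
          iteratedFDeriv ℝ (n + 1) g x v := by
      intro i x v
      cases n with
      | zero => exact i.elim0
      | succ m =>
        refine Fin.cases ?_ (fun i => ?_) i
        · have key : ∀ u : Fin (m + 2) → E, iteratedFDeriv ℝ (m + 2) g x u =
              fderiv ℝ (fderiv ℝ fun z => iteratedFDeriv ℝ m g z (Fin.tail (Fin.tail u))) x
                (u 0) (u 1) := by
            intro u
            have hs : ContDiff ℝ (⊤ : ℕ∞)
                fun z => iteratedFDeriv ℝ m g z (Fin.tail (Fin.tail u)) :=
              (ContinuousMultilinearMap.apply ℝ (fun _ : Fin m => E) F _).contDiff.comp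
                (hg.iteratedFDeriv_right (mod_cast le_top))
            have hs' : DifferentiableAt ℝ
                (fderiv ℝ fun z => iteratedFDeriv ℝ m g z (Fin.tail (Fin.tail u))) x :=
              ((contDiff_infty_iff_fderiv.1 hs).2.differentiable (by simp)) x
            rw [(hd (m + 1) x).iteratedFDeriv_succ_apply_left']
            have e : (fun y => iteratedFDeriv ℝ (m + 1) g y (Fin.tail u)) = fun y =>
                fderiv ℝ (fun z => iteratedFDeriv ℝ m g z (Fin.tail (Fin.tail u))) y
                  (Fin.tail u 0) :=
              funext fun y => (hd m y).iteratedFDeriv_succ_apply_left'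
            rw [e, fderiv_clm_apply hs' (differentiableAt_const _)]
            simp [Fin.tail]
          have hs : ContDiff ℝ (⊤ : ℕ∞)
              fun z => iteratedFDeriv ℝ m g z (Fin.tail (Fin.tail v)) :=
            (ContinuousMultilinearMap.apply ℝ (fun _ : Fin m => E) F _).contDiff.comp
              (hg.iteratedFDeriv_right (mod_cast le_top))
          have ht : Fin.tail (Fin.tail (v ∘ Equiv.swap (0 : Fin (m + 1)).castSucc
              (0 : Fin (m + 1)).succ)) = Fin.tail (Fin.tail v) := by
            funext l
            simp only [Fin.tail, Function.comp_apply]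
            rw [Equiv.swap_apply_of_ne_of_ne]
            · simp [Fin.ext_iff]
            · simp [Fin.ext_iff]
          rw [key, key, ht]
          have hsymm := (hs.contDiffAt (x := x)).isSymmSndFDerivAt (by
            rw [minSmoothness_of_isRCLikeNormedField]; exact WithTop.coe_le_coe.2 le_top)
          simpa using hsymm (v 1) (v 0)
        · rw [(hd (m + 1) x).iteratedFDeriv_succ_apply_left',
            (hd (m + 1) x).iteratedFDeriv_succ_apply_left']
          have h0 : (v ∘ Equiv.swap i.succ.castSucc i.succ.succ) 0 = v 0 := by
            rw [Function.comp_apply, Equiv.swap_apply_of_ne_of_ne]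
            · simp [Fin.ext_iff]
            · simp [Fin.ext_iff]
          have ht : Fin.tail (v ∘ Equiv.swap i.succ.castSucc i.succ.succ) =
              Fin.tail v ∘ Equiv.swap i.castSucc i.succ := by
            funext l
            simp only [Fin.tail, Function.comp_apply]
            rw [← Fin.succ_castSucc, Equiv.swap_apply_def, Equiv.swap_apply_def]
            simp only [Fin.succ_inj]
            split_ifs <;> rfl
          rw [h0, ht]
          simp_rw [ih]
    intro x v σ
    have hσ : σ ∈ Submonoid.closure
        (range fun i : Fin n => Equiv.swap i.castSucc i.succ) := by
      rw [Equiv.Perm.mclosure_swap_castSucc_succ]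
      trivial
    induction hσ using Submonoid.closure_induction generalizing v with
    | mem σ hσ =>
      obtain ⟨i, rfl⟩ := hσ
      exact hswap i x v
    | one => rfl
    | mul σ τ _ _ hσ hτ =>
      rw [Equiv.Perm.coe_mul, ← Function.comp_assoc, hτ, hσ]

lemma sum_prod_sign {k : ℕ} (g : Fin k → Fin k) :
    ∑ e ∈ Fintype.piFinset (fun _ : Fin k => ({1, -1} : Finset ℝ)), (∏ i, e i) * ∏ i, e (g i) =
      if Function.Bijective g then 2 ^ k else 0 := by
  have h1 : ∀ e : Fin k → ℝ, (∏ i, e i) * ∏ i, e (g i) =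
      ∏ i, e i ^ (1 + (Finset.univ.filter fun l => g l = i).card) := by
    intro e
    rw [← Finset.prod_fiberwise' (s := Finset.univ) g e, ← Finset.prod_mul_distrib]
    refine Finset.prod_congr rfl fun i _ => ?_
    rw [Finset.prod_const, pow_add, pow_one]
  simp_rw [h1]
  rw [← Finset.prod_univ_sum (fun _ : Fin k => ({1, -1} : Finset ℝ))
    (fun i x => x ^ (1 + (Finset.univ.filter fun l => g l = i).card))]
  have hne : (1 : ℝ) ≠ -1 := by norm_num
  simp_rw [Finset.sum_pair hne]
  split_ifs with hg
  · have : ∀ i, (Finset.univ.filter fun l => g l = i).card = 1 := by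
      intro i
      obtain ⟨l, rfl⟩ := hg.2 i
      rw [Finset.card_eq_one]
      exact ⟨l, by ext x; simp [hg.1.eq_iff]⟩
    simp only [this]
    norm_num
  · have hs : ¬ Function.Surjective g := fun h => hg (Finite.surjective_iff_bijective.1 h)
    simp only [Function.Surjective, not_forall, not_exists] at hs
    obtain ⟨i, hi⟩ := hs
    refine Finset.prod_eq_zero (Finset.mem_univ i) ?_
    simp [hi]

lemma card_filter_bijective (k : ℕ) :
    (Finset.univ.filter fun g : Fin k → Fin k => Function.Bijective g).card = k.factorial := by
  have e : {g : Fin k → Fin k // Function.Bijective g} ≃ Equiv.Perm (Fin k) :=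
    { toFun := fun g => Equiv.ofBijective g.1 g.2
      invFun := fun σ => ⟨σ, σ.bijective⟩
      left_inv := fun g => by ext; simp
      right_inv := fun σ => by ext; simp }
  rw [← Fintype.card_subtype, Fintype.card_congr e, Fintype.card_perm, Fintype.card_fin]

lemma polarization_identity {E F : Type*} [NormedAddCommGroup E] [NormedSpace ℝ E]
    [NormedAddCommGroup F] [NormedSpace ℝ F] {k : ℕ} (A : E [×k]→L[ℝ] F)
    (hA : ∀ (v : Fin k → E) (σ : Equiv.Perm (Fin k)), A (v ∘ σ) = A v) (v : Fin k → E) :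
    ∑ e ∈ Fintype.piFinset (fun _ : Fin k => ({1, -1} : Finset ℝ)),
      (∏ i, e i) • A (fun _ => ∑ i, e i • v i) = ((2 : ℝ) ^ k * k.factorial) • A v := by
  have h1 : ∀ e : Fin k → ℝ, (∏ i, e i) • A (fun _ => ∑ i, e i • v i) =
      ∑ g : Fin k → Fin k, ((∏ i, e i) * ∏ i, e (g i)) • A (v ∘ g) := by
    intro e
    rw [ContinuousMultilinearMap.map_sum, Finset.smul_sum]
    refine Finset.sum_congr rfl fun g _ => ?_
    rw [ContinuousMultilinearMap.map_smul_univ, smul_smul]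
    rfl
  simp_rw [h1]
  rw [Finset.sum_comm]
  simp_rw [← Finset.sum_smul, sum_prod_sign, ite_smul, zero_smul]
  rw [← Finset.sum_filter]
  have h2 : ∀ g ∈ Finset.univ.filter (fun g : Fin k → Fin k => Function.Bijective g),
      (2 : ℝ) ^ k • A (v ∘ g) = (2 : ℝ) ^ k • A v := by
    intro g hg
    rw [← hA v (Equiv.ofBijective g (Finset.mem_filter.1 hg).2)]
    rfl
  rw [Finset.sum_congr rfl h2, Finset.sum_const, card_filter_bijective, ← Nat.cast_smul_eq_nsmul ℝ,
    smul_smul, mul_comm]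

lemma norm_le_of_diagonal_le {E F : Type*} [NormedAddCommGroup E] [NormedSpace ℝ E]
    [NormedAddCommGroup F] [NormedSpace ℝ F] {k : ℕ} (A : E [×k]→L[ℝ] F)
    (hA : ∀ (v : Fin k → E) (σ : Equiv.Perm (Fin k)), A (v ∘ σ) = A v) {B : ℝ} (hB : 0 ≤ B)
    (h : ∀ v : E, ‖v‖ ≤ 1 → ‖A fun _ => v‖ ≤ B) : ‖A‖ ≤ Real.exp 1 ^ k * B := by
  have hfac : (k : ℝ) ^ k ≤ k.factorial * Real.exp 1 ^ k := by
    rw [← Real.exp_nat_mul, mul_one, ← div_le_iff₀' (by positivity)]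
    exact Real.pow_div_factorial_le_exp _ (by positivity) k
  have hdiag : ∀ c : ℝ, 0 ≤ c → ∀ v : E, ‖v‖ ≤ c → ‖A fun _ => v‖ ≤ c ^ k * B := by
    intro c hc v hv
    rcases hc.eq_or_lt with rfl | hc
    · obtain rfl : v = 0 := norm_le_zero_iff.1 hv
      rcases Nat.eq_zero_or_pos k with rfl | hk
      · simpa using h 0 (by simp)
      · have : Nonempty (Fin k) := ⟨⟨0, hk⟩⟩
        rw [show (fun _ : Fin k => (0 : E)) = 0 from rfl, A.map_zero, norm_zero]
        positivity
    · have e : (fun _ : Fin k => v) = fun _ : Fin k => c • (c⁻¹ • v) := by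
        funext; rw [smul_smul, mul_inv_cancel₀ hc.ne', one_smul]
      rw [e, A.map_smul_univ (fun _ => c) (fun _ => c⁻¹ • v), norm_smul]
      simp only [Finset.prod_const, Finset.card_univ, Fintype.card_fin]
      rw [norm_pow, Real.norm_of_nonneg hc.le]
      gcongr
      apply h
      rw [norm_smul, norm_inv, Real.norm_of_nonneg hc.le, inv_mul_le_iff₀ hc, mul_one]
      exact hv
  have hunit : ∀ v : Fin k → E, (∀ i, ‖v i‖ ≤ 1) → ‖A v‖ ≤ Real.exp 1 ^ k * B := by
    intro v hv
    have hterm : ∀ e ∈ Fintype.piFinset (fun _ : Fin k => ({1, -1} : Finset ℝ)),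
        ‖(∏ i, e i) • A (fun _ => ∑ i, e i • v i)‖ ≤ (k : ℝ) ^ k * B := by
      intro e he
      have he1 : ∀ i, ‖e i‖ = 1 := by
        intro i
        have := Fintype.mem_piFinset.1 he i
        simp only [Finset.mem_insert, Finset.mem_singleton] at this
        rcases this with h | h <;> simp [h]
      rw [norm_smul, norm_prod, Finset.prod_congr rfl fun i _ => he1 i, Finset.prod_const_one,
        one_mul]
      apply hdiag _ (by positivity)
      calc ‖∑ i, e i • v i‖ ≤ ∑ i : Fin k, (1 : ℝ) := by
            refine norm_sum_le_of_le _ fun i _ => ?_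
            rw [norm_smul, he1, one_mul]
            exact hv i
        _ = k := by simp
    have hsum := norm_sum_le_of_le _ hterm
    rw [polarization_identity A hA v, norm_smul, Real.norm_of_nonneg (by positivity),
      Finset.sum_const, Fintype.card_piFinset_const, Finset.card_pair (by norm_num),
      nsmul_eq_mul, Nat.cast_pow, Nat.cast_two, mul_assoc] at hsum
    have h3 := le_of_mul_le_mul_left hsum (by positivity)
    have h4 : (k.factorial : ℝ) * ‖A v‖ ≤ k.factorial * (Real.exp 1 ^ k * B) := by
      rw [← mul_assoc]
      exact h3.trans (by gcongr)
    exact le_of_mul_le_mul_left h4 (by positivity)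
  refine ContinuousMultilinearMap.opNorm_le_bound (by positivity) fun v => ?_
  by_cases h0 : ∃ i, v i = 0
  · obtain ⟨i, hi⟩ := h0
    rw [A.map_coord_zero i hi, norm_zero]
    positivity
  push Not at h0
  have e : v = fun i => ‖v i‖ • (‖v i‖⁻¹ • v i) := by
    funext i
    rw [smul_smul, mul_inv_cancel₀ (norm_ne_zero_iff.2 (h0 i)), one_smul]
  have h5 := hunit (fun i => ‖v i‖⁻¹ • v i) fun i => by
    rw [norm_smul, norm_inv, norm_norm, inv_mul_cancel₀ (norm_ne_zero_iff.2 (h0 i))]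
  conv_lhs => rw [e]
  rw [A.map_smul_univ, norm_smul, norm_prod, mul_comm]
  simp only [norm_norm]
  gcongr

lemma norm_fderiv_le_of_norm_le {E F : Type*} [NormedAddCommGroup E] [NormedSpace ℝ E]
    [NormedAddCommGroup F] [NormedSpace ℝ F] {g : E → F} {x : E} {t b η : ℝ} (ht : 0 < t)
    (hη : 0 ≤ η) (hb : 0 ≤ b) (hg : Differentiable ℝ g) (hg' : Differentiable ℝ (fderiv ℝ g))
    (hgb : ∀ y ∈ closedBall x t, ‖fderiv ℝ (fderiv ℝ g) y‖ ≤ b)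
    (hgη : ∀ y ∈ closedBall x t, ‖g y‖ ≤ η) : ‖fderiv ℝ g x‖ ≤ b * t + 2 * η / t := by
  refine ContinuousLinearMap.opNorm_le_of_unit_norm (by positivity) fun v hv => ?_
  have hx : x ∈ closedBall x t := mem_closedBall_self ht.le
  have hy : x + t • v ∈ closedBall x t := by
    rw [mem_closedBall_iff_norm, add_sub_cancel_left, norm_smul, hv, mul_one,
      Real.norm_of_nonneg ht.le]
  have hlip : ∀ y ∈ closedBall x t, ‖fderiv ℝ g y - fderiv ℝ g x‖ ≤ b * t := fun y hy => by
    refine ((convex_closedBall x t).norm_image_sub_le_of_norm_fderiv_le (fun z _ => hg' z) hgb hx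
      hy).trans ?_
    gcongr
    exact mem_closedBall_iff_norm.1 hy
  have hT := (convex_closedBall x t).norm_image_sub_le_of_norm_fderiv_le' (fun z _ => hg z) hlip hx
    hy
  rw [add_sub_cancel_left, norm_smul, hv, mul_one, Real.norm_of_nonneg ht.le, map_smul] at hT
  have h1 : ‖t • fderiv ℝ g x v‖ ≤ b * t * t + 2 * η := by
    have h2 := norm_sub_le (g (x + t • v) - g x) (g (x + t • v) - g x - t • fderiv ℝ g x v)
    have h3 := norm_sub_le (g (x + t • v)) (g x)
    rw [sub_sub_cancel] at h2
    linarith [hgη x hx, hgη _ hy]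
  rw [norm_smul, Real.norm_of_nonneg ht.le] at h1
  have h4 : t * ‖fderiv ℝ g x v‖ ≤ t * (b * t + 2 * η / t) := h1.trans (le_of_eq (by field_simp))
  exact le_of_mul_le_mul_left h4 ht

lemma uniformCauchySeqOn_fderiv {E F : Type*} [NormedAddCommGroup E] [NormedSpace ℝ E]
    [NormedAddCommGroup F] [NormedSpace ℝ F] {g : ℕ → E → F} {x₀ : E} {r r' b : ℝ} (hr : r' < r)
    (hg : ∀ n, Differentiable ℝ (g n)) (hg' : ∀ n, Differentiable ℝ (fderiv ℝ (g n)))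
    (hgb : ∀ n, ∀ y ∈ ball x₀ r, ‖fderiv ℝ (fderiv ℝ (g n)) y‖ ≤ b)
    (hgc : UniformCauchySeqOn g atTop (ball x₀ r)) :
    UniformCauchySeqOn (fun n => fderiv ℝ (g n)) atTop (ball x₀ r') := by
  rcases le_or_gt r' 0 with h0 | h0
  · rw [ball_eq_empty.2 h0]
    exact fun u hu => by simp
  have hb : 0 ≤ b := (norm_nonneg (fderiv ℝ (fderiv ℝ (g 0)) x₀)).trans
    (hgb 0 x₀ (mem_ball_self (h0.trans hr)))
  rw [Metric.uniformCauchySeqOn_iff] at hgc ⊢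
  intro ε hε
  obtain ⟨t, ht⟩ : ∃ t, t = min ((r - r') / 2) (ε / (8 * (b + 1))) := ⟨_, rfl⟩
  have ht0 : 0 < t := by
    rw [ht]
    exact lt_min (by linarith) (by positivity)
  have htr : t < r - r' := by
    have := min_le_left ((r - r') / 2) (ε / (8 * (b + 1)))
    linarith
  have htε : t * (8 * (b + 1)) ≤ ε := by
    rw [← le_div_iff₀ (by positivity), ht]
    exact min_le_right _ _
  obtain ⟨N, hN⟩ := hgc (t * ε / 8) (by positivity)
  refine ⟨N, fun m hm n hn x hx => ?_⟩
  have hsub : closedBall x t ⊆ ball x₀ r := closedBall_subset_ball' (by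
    have := mem_ball.1 hx
    linarith)
  have e1 : fderiv ℝ (g m - g n) = fderiv ℝ (g m) - fderiv ℝ (g n) := by
    ext1 y
    exact fderiv_sub (hg m y) (hg n y)
  have h := norm_fderiv_le_of_norm_le (g := g m - g n) (x := x) (b := 2 * b) (η := t * ε / 8) ht0
    (by positivity) (by positivity) ((hg m).sub (hg n)) (by rw [e1]; exact (hg' m).sub (hg' n))
    (fun y hy => by
      rw [e1, fderiv_sub (hg' m y) (hg' n y)]
      linarith [norm_sub_le (fderiv ℝ (fderiv ℝ (g m)) y) (fderiv ℝ (fderiv ℝ (g n)) y),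
        hgb m y (hsub hy), hgb n y (hsub hy)])
    (fun y hy => by
      have := (hN m hm n hn y (hsub hy)).le
      rwa [dist_eq_norm] at this)
  rw [e1] at h
  rw [dist_eq_norm]
  refine h.trans_lt ?_
  have e2 : 2 * (t * ε / 8) / t = ε / 4 := by field_simp; norm_num
  rw [e2]
  nlinarith

/-- A uniform limit of smooth functions with uniformly bounded derivatives is smooth, and the
derivatives satisfy the same bounds. -/
lemma contDiffOn_of_tendstoUniformlyOn {E F : Type*} [NormedAddCommGroup E] [NormedSpace ℝ E]
    [NormedAddCommGroup F] [NormedSpace ℝ F] [CompleteSpace F] {g : ℕ → E → F} {f : E → F} {x₀ : E}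
    {r : ℝ} {b : ℕ → ℝ} (hg : ∀ n, ContDiff ℝ (⊤ : ℕ∞) (g n))
    (hgb : ∀ n k, ∀ y ∈ ball x₀ r, ‖iteratedFDeriv ℝ k (g n) y‖ ≤ b k)
    (hgf : TendstoUniformlyOn g f atTop (ball x₀ r)) :
    ContDiffOn ℝ (⊤ : ℕ∞) f (ball x₀ r) ∧
      ∀ k, ∀ y ∈ ball x₀ r, ‖iteratedFDeriv ℝ k f y‖ ≤ b k := by
  have hd : ∀ n k, Differentiable ℝ (iteratedFDeriv ℝ k (g n)) := fun n k =>
    (hg n).differentiable_iteratedFDeriv (mod_cast WithTop.coe_lt_top k)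
  have hcauchy : ∀ k, ∀ r' < r,
      UniformCauchySeqOn (fun n => iteratedFDeriv ℝ k (g n)) atTop (ball x₀ r') := by
    intro k
    induction k with
    | zero =>
      intro r' hr'
      have h := (hgf.mono (ball_subset_ball hr'.le)).uniformCauchySeqOn
      rw [Metric.uniformCauchySeqOn_iff] at h ⊢
      intro ε hε
      obtain ⟨N, hN⟩ := h ε hε
      refine ⟨N, fun m hm n hn x hx => ?_⟩
      simp only [iteratedFDeriv_zero_eq_comp, Function.comp_apply, LinearIsometryEquiv.dist_map]
      exact hN m hm n hn x hx
    | succ k ih =>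
      intro r' hr'
      obtain ⟨s, hs, hs'⟩ := exists_between hr'
      have h := uniformCauchySeqOn_fderiv (b := b (k + 2)) hs (fun n => hd n k)
        (fun n => ?_) (fun n y hy => ?_) (ih s hs')
      · rw [Metric.uniformCauchySeqOn_iff] at h ⊢
        intro ε hε
        obtain ⟨N, hN⟩ := h ε hε
        refine ⟨N, fun m hm n hn x hx => ?_⟩
        simp only [iteratedFDeriv_succ_eq_comp_left, Function.comp_apply,
          LinearIsometryEquiv.dist_map]
        exact hN m hm n hn x hx
      · rw [fderiv_iteratedFDeriv]
        exact (LinearIsometryEquiv.differentiable _).comp (hd n (k + 1))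
      · have hb := hgb n (k + 2) y (ball_subset_ball hs'.le hy)
        have hb0 := (norm_nonneg (iteratedFDeriv ℝ (k + 2) (g n) y)).trans hb
        rw [← norm_fderiv_iteratedFDeriv] at hb
        rw [fderiv_iteratedFDeriv, LinearIsometryEquiv.comp_fderiv]
        refine ContinuousLinearMap.opNorm_le_bound _ hb0 fun v => ?_
        refine ((continuousMultilinearCurryLeftEquiv ℝ (fun _ : Fin (k + 1) => E) F).norm_map
          _).le.trans ?_
        exact ContinuousLinearMap.le_of_opNorm_le _ hb v
  have hlim : ∀ k, ∀ y ∈ ball x₀ r, ∃ p,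
      Tendsto (fun n => iteratedFDeriv ℝ k (g n) y) atTop (𝓝 p) := by
    intro k y hy
    obtain ⟨s, hs, hs'⟩ := exists_between (mem_ball.1 hy)
    exact cauchySeq_tendsto_of_complete ((hcauchy k s hs').cauchySeq hs)
  choose! p hp using hlim
  have hunif : ∀ k, TendstoLocallyUniformlyOn (fun n => iteratedFDeriv ℝ k (g n)) (p k) atTop
      (ball x₀ r) := by
    intro k u hu y hy
    obtain ⟨s, hs, hs'⟩ := exists_between (mem_ball.1 hy)
    refine ⟨ball x₀ s, mem_nhdsWithin_of_mem_nhds (isOpen_ball.mem_nhds hs), ?_⟩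
    exact (hcauchy k s hs').tendstoUniformlyOn_of_tendsto
      (fun z hz => hp k z (ball_subset_ball hs'.le hz)) u hu
  have hder : ∀ k, ∀ y ∈ ball x₀ r, HasFDerivAt (p k) (p (k + 1) y).curryLeft y := by
    intro k y hy
    refine hasFDerivAt_of_tendstoLocallyUniformlyOn isOpen_ball (l := atTop)
      (f' := fun n => fderiv ℝ (iteratedFDeriv ℝ k (g n)))
      (g' := fun y => (p (k + 1) y).curryLeft) ?_ (fun n y _ => (hd n k y).hasFDerivAt) (hp k) hy
    simp only [fderiv_iteratedFDeriv]
    exact (continuousMultilinearCurryLeftEquiv ℝ (fun _ : Fin (k + 1) => E)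
      F).isometry.uniformContinuous.comp_tendstoLocallyUniformlyOn (hunif (k + 1))
  have hT : HasFTaylorSeriesUpToOn (⊤ : ℕ∞) f (fun y k => p k y) (ball x₀ r) := by
    refine ⟨fun y hy => ?_, fun m _ y hy => (hder m y hy).hasFDerivWithinAt,
      fun m _ y hy => (hder m y hy).continuousAt.continuousWithinAt⟩
    refine tendsto_nhds_unique ?_ (hgf.tendsto_at hy)
    exact ((continuousMultilinearCurryFin0 ℝ E F).continuous.tendsto _).comp (hp 0 y hy)
  refine ⟨hT.contDiffOn, fun k y hy => ?_⟩
  rw [← iteratedFDerivWithin_of_isOpen k isOpen_ball hy,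
    ← hT.eq_iteratedFDerivWithin_of_uniqueDiffOn (mod_cast le_top) isOpen_ball.uniqueDiffOn hy]
  exact le_of_tendsto (hp k y hy).norm (Eventually.of_forall fun n => hgb n k y hy)

lemma isDerivFamily_line {E : Type*} [NormedAddCommGroup E] [NormedSpace ℝ E] {g : E → ℂ} {x v : E}
    {s : Set ℝ} (hg : ∀ t ∈ s, ContDiffAt ℝ (⊤ : ℕ∞) g (x + t • v)) :
    IsDerivFamily (fun m t => iteratedFDeriv ℝ m g (x + t • v) fun _ => v) s := by
  intro m t ht
  have h1 : HasFDerivAt (iteratedFDeriv ℝ m g) (fderiv ℝ (iteratedFDeriv ℝ m g) (x + t • v))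
      (x + t • v) :=
    ((hg t ht).differentiableAt_iteratedFDeriv (mod_cast WithTop.coe_lt_top m)).hasFDerivAt
  have h2 : HasDerivAt (fun t : ℝ => x + t • v) v t := by
    simpa using ((hasDerivAt_id t).smul_const v).const_add x
  exact ((ContinuousMultilinearMap.apply ℝ (fun _ : Fin m => E) ℂ
    fun _ => v).hasFDerivAt.comp_hasDerivAt t (h1.comp_hasDerivAt t h2))

lemma hasWeightBounds_line {E : Type*} [NormedAddCommGroup E] [NormedSpace ℝ E] {ω : ℝ → ℝ}
    {ρ A R : ℝ} {g : E → ℂ} {U K : Set E} (hU : IsOpen U) (hKU : K ⊆ U) (hA : 0 ≤ A)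
    (hg : ContDiffOn ℝ (⊤ : ℕ∞) g U)
    (hgK : ∀ y ∈ K, ∀ k : ℕ,
      ‖iteratedFDerivWithin ℝ k g U y‖ ≤ A * Real.exp (1 / ρ * youngConj ω (ρ * k)))
    {x v : E} (hv : ‖v‖ ≤ 1) (hxv : ∀ t ∈ Icc (-R) R, x + t • v ∈ K) :
    HasWeightBounds ω ρ A R (fun t => g (x + t • v)) := by
  refine ⟨fun m t => iteratedFDeriv ℝ m g (x + t • v) fun _ => v, by ext; simp,
    isDerivFamily_line fun t ht => hg.contDiffAt (hU.mem_nhds (hKU (hxv t ht))), fun m t ht => ?_⟩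
  have h := hgK _ (hxv t ht) m
  rw [iteratedFDerivWithin_of_isOpen m hU (hKU (hxv t ht))] at h
  refine (ContinuousMultilinearMap.le_of_opNorm_le h _).trans ?_
  refine mul_le_of_le_one_right (by positivity) ?_
  simpa using pow_le_one₀ (norm_nonneg v) hv

lemma norm_iteratedFDeriv_diagonal_le {E : Type*} [NormedAddCommGroup E] [NormedSpace ℝ E]
    {g : E → ℂ} (hg : ContDiff ℝ (⊤ : ℕ∞) g) {x v : E} {k : ℕ} {h : ℕ → ℝ} {B : ℝ}
    (hh : ∀ n, 0 < h n) (hlim : Tendsto h atTop (𝓝 0))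
    (hb : ∀ n, ‖(fwdDiff (h n))^[k] (fun t : ℝ => g (x + t • v)) 0‖ ≤ B * h n ^ k) :
    ‖iteratedFDeriv ℝ k g x fun _ => v‖ ≤ B := by
  set ψ : ℕ → ℝ → ℂ := fun m t => iteratedFDeriv ℝ m g (x + t • v) fun _ => v with hψ
  have hder : IsDerivFamily ψ univ := isDerivFamily_line fun t _ => hg.contDiffAt
  have hψ0 : ψ 0 = fun t : ℝ => g (x + t • v) := by ext; simp [hψ]
  have hgoal : iteratedFDeriv ℝ k g x (fun _ => v) = ψ k 0 := by simp [hψ]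
  rw [hgoal]
  refine le_of_forall_pos_le_add fun δ hδ => ?_
  have hc : ContinuousAt (ψ k) 0 := (hder k 0 trivial).continuousAt
  obtain ⟨η, hη, hηδ⟩ := Metric.continuousAt_iff.1 hc δ hδ
  have hkh : Tendsto (fun n => k * h n) atTop (𝓝 0) := by simpa using hlim.const_mul (k : ℝ)
  obtain ⟨n, hn⟩ := (hkh.eventually (gt_mem_nhds hη)).exists
  have h1 := norm_fwdDiff_iter_sub_le (hh n).le k (ψ := ψ) (c := ψ k 0) (ε := δ)
    (fun m t _ => hder m t trivial) (fun t ht => by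
      have := @hηδ t (by
        rw [Real.dist_0_eq_abs, abs_of_nonneg ht.1]
        exact ht.2.trans_lt hn)
      rw [dist_eq_norm] at this
      exact this.le)
  rw [hψ0] at h1
  have h2 := hb n
  have hpos : 0 < h n ^ k := pow_pos (hh n) k
  have h3 := norm_sub_norm_le ((h n : ℂ) ^ k * ψ k 0)
    ((fwdDiff (h n))^[k] (fun t : ℝ => g (x + t • v)) 0)
  rw [norm_sub_rev, norm_mul, norm_pow, Complex.norm_of_nonneg (hh n).le] at h3
  have h4 : h n ^ k * ‖ψ k 0‖ ≤ h n ^ k * (B + δ) := by linarith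
  exact le_of_mul_le_mul_left h4 hpos

lemma fwdDiff_iter_line {E G : Type*} [NormedAddCommGroup E] [NormedSpace ℝ E] [AddCommGroup G]
    (F : E → G) (y v : E) (h : ℝ) (k : ℕ) :
    (fwdDiff h)^[k] (fun t : ℝ => F (y + t • v)) 0 = (fwdDiff (h • v))^[k] F y := by
  simp only [fwdDiff_iter_eq_sum_shift, zero_add, smul_assoc]

open Convolution

lemma integrable_fwdDiff_iter {E : Type*} [NormedAddCommGroup E] [MeasurableSpace E] [BorelSpace E]
    {μ : Measure E} [μ.IsAddRightInvariant] {F : E → ℂ} (hF : Integrable F μ) (a : E) (k : ℕ) :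
    Integrable ((fwdDiff a)^[k] F) μ := by
  induction k generalizing F with
  | zero => exact hF
  | succ k ih => exact ih ((hF.comp_add_right a).sub hF)

lemma fwdDiff_iter_convolution {E : Type*} [NormedAddCommGroup E] [NormedSpace ℝ E]
    [FiniteDimensional ℝ E] [MeasurableSpace E] [BorelSpace E] {μ : Measure E} [μ.IsAddHaarMeasure]
    {φ : E → ℝ} (hφ : Continuous φ) (hφc : HasCompactSupport φ) {F : E → ℂ} (hF : Integrable F μ)
    (a : E) (k : ℕ) :
    (fwdDiff a)^[k] (φ ⋆[ContinuousLinearMap.lsmul ℝ ℝ, μ] F) =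
      φ ⋆[ContinuousLinearMap.lsmul ℝ ℝ, μ] ((fwdDiff a)^[k] F) := by
  induction k generalizing F with
  | zero => rfl
  | succ k ih =>
    have h1 : fwdDiff a (φ ⋆[ContinuousLinearMap.lsmul ℝ ℝ, μ] F) =
        φ ⋆[ContinuousLinearMap.lsmul ℝ ℝ, μ] (fwdDiff a F) := by
      ext x
      have hex := hφc.convolutionExists_left (ContinuousLinearMap.lsmul ℝ ℝ) hφ
        hF.locallyIntegrable
      simp only [fwdDiff, convolution_def]
      rw [← integral_sub (hex (x + a)) (hex x)]
      refine integral_congr_ae (Eventually.of_forall fun t => ?_)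
      simp only [ContinuousLinearMap.lsmul_apply, smul_sub]
      rw [sub_add_eq_add_sub]
    rw [Function.iterate_succ_apply, h1, ih (F := fwdDiff a F) (integrable_fwdDiff_iter hF a 1),
      Function.iterate_succ_apply]

lemma continuousAt_of_pow {X : Type*} [TopologicalSpace X] {f : X → ℂ} {x : X} {j : ℕ} (hj : 1 ≤ j)
    (h1 : ContinuousAt (fun y => f y ^ j) x) (h2 : ContinuousAt (fun y => f y ^ (j + 1)) x) :
    ContinuousAt f x := by
  set M : ℝ := ‖f x ^ j‖ + 1 with hM
  have hM1 : 1 ≤ M := by linarith [norm_nonneg (f x ^ j)]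
  have hbd : ∀ᶠ y in 𝓝 x, ‖f y ^ j‖ < M := h1.norm.eventually (gt_mem_nhds (by linarith))
  have hfx : ‖f x‖ ≤ M := norm_le_of_norm_pow_le (by lia) hM1 hbd.self_of_nhds.le
  have herr : Tendsto (fun y => 2 ^ j * ((1 + M) *
      (‖f y ^ j - f x ^ j‖ + ‖f y ^ (j + 1) - f x ^ (j + 1)‖))) (𝓝 x) (𝓝 0) := by
    have e1 := (h1.sub_const (f x ^ j)).norm
    have e2 := (h2.sub_const (f x ^ (j + 1))).norm
    simpa using (((e1.add e2).const_mul (1 + M)).const_mul ((2 : ℝ) ^ j))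
  rw [Metric.continuousAt_iff']
  intro ε hε
  filter_upwards [hbd, herr.eventually (gt_mem_nhds (pow_pos hε (j + 1)))] with y hy hy'
  rw [dist_eq_norm]
  refine lt_of_pow_lt_pow_left₀ (j + 1) hε.le (lt_of_le_of_lt ?_ hy')
  exact norm_sub_pow_le_of_pow_sub j (norm_le_of_norm_pow_le (by lia) hM1 hy.le) hfx
    (le_add_of_nonneg_right (norm_nonneg _)) (le_add_of_nonneg_left (norm_nonneg _))

/-- A continuous function whose directional differences are bounded along a null sequence of steps
is smooth, with the corresponding bounds on the derivatives. -/
lemma contDiffOn_of_fwdDiff_iter_le {E : Type*} [NormedAddCommGroup E] [NormedSpace ℝ E]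
    [FiniteDimensional ℝ E] {f : E → ℂ} {x₀ : E} {r : ℝ} (hr : 0 < r)
    (hf : ContinuousOn f (closedBall x₀ (4 * r))) {h : ℕ → ℕ → ℝ} {B : ℕ → ℝ} (hB : ∀ k, 0 ≤ B k)
    (hh : ∀ k n, 0 < h k n) (hlim : ∀ k, Tendsto (h k) atTop (𝓝 0)) (hkh : ∀ k n, k * h k n ≤ r)
    (hfB : ∀ k n, ∀ y ∈ ball x₀ (2 * r), ∀ v : E, ‖v‖ ≤ 1 →
      ‖(fwdDiff (h k n))^[k] (fun t : ℝ => f (y + t • v)) 0‖ ≤ B k * h k n ^ k) :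
    ContDiffOn ℝ (⊤ : ℕ∞) f (ball x₀ r) ∧
      ∀ k, ∀ y ∈ ball x₀ r, ‖iteratedFDeriv ℝ k f y‖ ≤ Real.exp 1 ^ k * B k := by
  borelize E
  have hLc : IsCompact (closedBall x₀ (4 * r)) := isCompact_closedBall _ _
  set F : E → ℂ := (closedBall x₀ (4 * r)).indicator f with hFdef
  have hF : Integrable F Measure.addHaar :=
    (integrable_indicator_iff isClosed_closedBall.measurableSet).2 (hf.integrableOn_compact hLc)
  let φ : ℕ → ContDiffBump (0 : E) := fun n =>
    ⟨r / (2 * (n + 1)), r / (n + 1), by positivity, by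
      rw [div_lt_div_iff₀ (by positivity) (by positivity)]
      nlinarith [mul_pos hr (n.cast_add_one_pos (α := ℝ))]⟩
  have hφr : ∀ n, (φ n).rOut = r / (n + 1) := fun n => rfl
  have hφr' : ∀ n, (φ n).rOut ≤ r := fun n => by
    rw [hφr]
    exact div_le_self hr.le (by linarith [n.cast_nonneg (α := ℝ)])
  set g : ℕ → E → ℂ := fun n =>
    (φ n).normed Measure.addHaar ⋆[ContinuousLinearMap.lsmul ℝ ℝ, Measure.addHaar] F with hg
  have hgs : ∀ n, ContDiff ℝ (⊤ : ℕ∞) (g n) := fun n =>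
    (φ n).hasCompactSupport_normed.contDiff_convolution_left _ (φ n).contDiff_normed
      hF.locallyIntegrable
  have hnear : ∀ n, ∀ x ∈ ball x₀ r, ∀ y ∈ ball x (φ n).rOut, y ∈ ball x₀ (2 * r) := by
    intro n x hx y hy
    rw [mem_ball] at hx hy ⊢
    linarith [dist_triangle y x x₀, hφr' n]
  refine contDiffOn_of_tendstoUniformlyOn hgs (fun n k x hx => ?_) ?_
  · refine norm_le_of_diagonal_le _
      (iteratedFDeriv_comp_perm_of_contDiff (hgs n) k x) (hB k) fun v hv => ?_
    refine norm_iteratedFDeriv_diagonal_le (hgs n) (hh k) (hlim k) fun m => ?_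
    rw [fwdDiff_iter_line, hg, fwdDiff_iter_convolution (φ n).continuous_normed
      (φ n).hasCompactSupport_normed hF, ← dist_zero_right]
    have hhk := pow_nonneg (hh k m).le k
    refine dist_convolution_le (mul_nonneg (hB k) hhk) (φ n).support_normed_eq.le
      (φ n).nonneg_normed (φ n).integral_normed (integrable_fwdDiff_iter hF _ k).1 fun y hy => ?_
    have hy2 := hnear n x hx y hy
    rw [dist_zero_right]
    refine le_of_eq_of_le (congrArg norm ?_) (hfB k m y hy2 v hv)
    rw [fwdDiff_iter_line, fwdDiff_iter_eq_sum_shift, fwdDiff_iter_eq_sum_shift]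
    refine Finset.sum_congr rfl fun i hi => ?_
    rw [hFdef, indicator_of_mem]
    have hik : (i : ℝ) ≤ k := by exact_mod_cast Nat.lt_succ_iff.1 (Finset.mem_range.1 hi)
    have h3 : ‖i • h k m • v‖ ≤ r := by
      rw [← Nat.cast_smul_eq_nsmul ℝ, norm_smul, norm_smul, Real.norm_of_nonneg (hh k m).le,
        Real.norm_of_nonneg (by positivity)]
      have h4 := hkh k m
      have h5 := hh k m
      calc (i : ℝ) * (h k m * ‖v‖) ≤ k * (h k m * 1) := by gcongr
        _ ≤ r := by linarith
    rw [mem_ball] at hy2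
    have h6 := dist_triangle (y + i • h k m • v) y x₀
    rw [dist_self_add_left] at h6
    rw [mem_closedBall]
    linarith
  · rw [Metric.tendstoUniformlyOn_iff]
    intro ε hε
    obtain ⟨δ, hδ, hδε⟩ := Metric.uniformContinuousOn_iff.1
      (hLc.uniformContinuousOn_of_continuous hf) (ε / 2) (by positivity)
    have ht : Tendsto (fun n : ℕ => r / ((n : ℝ) + 1)) atTop (𝓝 0) := by
      simpa [div_eq_mul_inv] using tendsto_one_div_add_atTop_nhds_zero_nat.const_mul r
    filter_upwards [ht.eventually (gt_mem_nhds hδ)] with n hn x hx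
    rw [dist_comm]
    refine lt_of_le_of_lt ?_ (half_lt_self hε)
    refine dist_convolution_le (half_pos hε).le (φ n).support_normed_eq.le (φ n).nonneg_normed
      (φ n).integral_normed hF.1 fun y hy => ?_
    have hy2 := hnear n x hx y hy
    have hy4 : y ∈ closedBall x₀ (4 * r) :=
      ball_subset_closedBall (ball_subset_ball (by linarith) hy2)
    have hx4 : x ∈ closedBall x₀ (4 * r) :=
      ball_subset_closedBall (ball_subset_ball (by linarith) hx)
    rw [hFdef, indicator_of_mem hy4]
    exact (hδε y hy4 x hx4 ((mem_ball.1 hy).trans hn)).le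

/-- Joris' theorem for the Beurling class, locally. -/
lemma exists_ball_weight_bounds {E : Type*} [NormedAddCommGroup E] [NormedSpace ℝ E]
    [FiniteDimensional ℝ E] {ω : ℝ → ℝ} (hω : IsWeightFunction ω) (hconc : ConcaveOn ℝ (Ici 0) ω)
    {U : Set E} (hU : IsOpen U) {j : ℕ} (hj : 1 ≤ j) {f : E → ℂ}
    (h1 : BeurlingW ω U (fun x => f x ^ j)) (h2 : BeurlingW ω U (fun x => f x ^ (j + 1)))
    {x₀ : E} (hx₀ : x₀ ∈ U) {ρ' : ℝ} (hρ' : 0 < ρ') :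
    ∃ r : ℝ, 0 < r ∧ ContDiffOn ℝ (⊤ : ℕ∞) f (ball x₀ r) ∧ ∃ C : ℝ, 0 < C ∧
      ∀ y ∈ ball x₀ r, ∀ k : ℕ,
        ‖iteratedFDeriv ℝ k f y‖ ≤ C * Real.exp (1 / ρ' * youngConj ω (ρ' * k)) := by
  obtain ⟨R, hR, hRU⟩ := Metric.nhds_basis_closedBall.mem_iff.1 (hU.mem_nhds hx₀)
  obtain ⟨r, rfl⟩ : ∃ r, R = 4 * r := ⟨R / 4, by ring⟩
  have hr : 0 < r := by linarith
  have hc : ContinuousOn f (closedBall x₀ (4 * r)) := fun x hx =>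
    (continuousAt_of_pow hj (h1.1.continuousOn.continuousAt (hU.mem_nhds (hRU hx)))
      (h2.1.continuousOn.continuousAt (hU.mem_nhds (hRU hx)))).continuousWithinAt
  obtain ⟨ρ, hρ, H⟩ := exists_norm_fwdDiff_iter_le hω hconc j hj hρ' (Real.exp_pos (-1))
  obtain ⟨A₁, hA₁, hb₁⟩ := h1.2 _ hRU (isCompact_closedBall _ _) ρ hρ
  obtain ⟨A₂, hA₂, hb₂⟩ := h2.2 _ hRU (isCompact_closedBall _ _) ρ hρ
  have hA : 0 ≤ 1 + A₁ + A₂ := by positivity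
  obtain ⟨C, hC, H⟩ := H r (1 + A₁ + A₂) hr (by linarith)
  choose h hh hlim hkh H using H
  have hB : ∀ k : ℕ,
      0 ≤ C * (Real.exp (-1) ^ k * Real.exp (1 / ρ' * youngConj ω (ρ' * k))) := fun k => by
    positivity
  have hmem : ∀ y ∈ ball x₀ (2 * r), ∀ v : E, ‖v‖ ≤ 1 → ∀ t ∈ Icc (-r) r,
      y + t • v ∈ closedBall x₀ (4 * r) := by
    intro y hy v hv t ht
    have h3 : ‖t • v‖ ≤ r := by
      rw [norm_smul]
      exact (mul_le_of_le_one_right (norm_nonneg t) hv).trans (abs_le.2 ht)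
    have h4 := dist_triangle (y + t • v) y x₀
    rw [dist_self_add_left] at h4
    rw [mem_ball] at hy
    rw [mem_closedBall]
    linarith
  obtain ⟨hs, hbd⟩ := contDiffOn_of_fwdDiff_iter_le hr hc hB hh hlim hkh (fun k n y hy v hv =>
    H k (fun t => f (y + t • v))
      (hasWeightBounds_line hU hRU hA h1.1 (fun z hz k => (hb₁ z hz k).trans (by gcongr; linarith))
        hv (hmem y hy v hv))
      (hasWeightBounds_line hU hRU hA h2.1 (fun z hz k => (hb₂ z hz k).trans (by gcongr; linarith))
        hv (hmem y hy v hv)) n)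
  refine ⟨r, hr, hs, C + 1, by positivity, fun y hy k => (hbd k y hy).trans ?_⟩
  have e : Real.exp 1 ^ k * Real.exp (-1) ^ k = 1 := by
    rw [← mul_pow, ← Real.exp_add]
    simp
  calc _ = C * Real.exp (1 / ρ' * youngConj ω (ρ' * k)) := by
        linear_combination (C * Real.exp (1 / ρ' * youngConj ω (ρ' * k))) * e
    _ ≤ _ := by gcongr; linarith

/-- Joris' theorem for the Beurling Braun–Meise–Taylor class of a concave weight function. -/
theorem statement5 {d : ℕ} (ω : ℝ → ℝ) (hω : IsWeightFunction ω)
    (hconc : ConcaveOn ℝ (Ici 0) ω)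
    (U : Set (EuclideanSpace ℝ (Fin d))) (hU : IsOpen U)
    (j : ℕ) (hj : 1 ≤ j) (f : EuclideanSpace ℝ (Fin d) → ℂ)
    (h1 : BeurlingW ω U (fun x => f x ^ j))
    (h2 : BeurlingW ω U (fun x => f x ^ (j + 1))) :
    BeurlingW ω U f := by
  refine ⟨fun x hx => ?_, fun K hK hKc ρ hρ => ?_⟩
  · obtain ⟨r, hr, hf, -⟩ := exists_ball_weight_bounds hω hconc hU hj h1 h2 hx one_pos
    exact (hf.contDiffAt (ball_mem_nhds x hr)).contDiffWithinAt
  · obtain ⟨C, hC, hb⟩ : ∃ C : ℝ, 0 < C ∧ ∀ x ∈ K, ∀ k : ℕ,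
        ‖iteratedFDeriv ℝ k f x‖ ≤ C * Real.exp (1 / ρ * youngConj ω (ρ * k)) := by
      refine hKc.induction_on (p := fun s => ∃ C : ℝ, 0 < C ∧ ∀ x ∈ s, ∀ k : ℕ,
        ‖iteratedFDeriv ℝ k f x‖ ≤ C * Real.exp (1 / ρ * youngConj ω (ρ * k)))
        ⟨1, one_pos, by simp⟩ ?_ ?_ ?_
      · rintro s t hst ⟨C, hC, h⟩
        exact ⟨C, hC, fun x hx => h x (hst hx)⟩
      · rintro s t ⟨C, hC, h⟩ ⟨D, hD, h'⟩
        refine ⟨C + D, add_pos hC hD, ?_⟩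
        rintro x (hx | hx) k
        · exact (h x hx k).trans (by gcongr; linarith)
        · exact (h' x hx k).trans (by gcongr; linarith)
      · intro x hx
        obtain ⟨r, hr, -, hb⟩ := exists_ball_weight_bounds hω hconc hU hj h1 h2 (hK hx) hρ
        exact ⟨ball x r, mem_nhdsWithin_of_mem_nhds (ball_mem_nhds x hr), hb⟩
    refine ⟨C, hC, fun x hx k => ?_⟩
    rw [iteratedFDerivWithin_of_isOpen k hU (hK hx)]
    exact hb x hx k

end JorisPaper
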